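/- Let μ ∈ ℚ and 0 ≠ α ∈ ℕ^n. Then there exists a polynomial f ∈ ℚ[x] such that for every prime power q, A^{ss}_μ(α, q) = f(q), where A^{ss}_μ(α, q) denotes the number of isomorphism classes of absolutely indecomposable semistable representations of Γ over F_q of dimension α and slope μ. -/

import Mathlib

open Matrix BigOperators
open scoped Classical

/-- A representation over `k` of the quiver `Γ` with vertices `{1,…,n}` and `a i j`
arrows from `i` to `j`, of dimension vector `α`. -/
abbrev QRep (n : ℕ) (a : Fin n → Fin n → ℕ) (k : Type*) [Field k] (α : Fin n → ℕ) :=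
  ∀ i j : Fin n, Fin (a i j) → Matrix (Fin (α j)) (Fin (α i)) k

/-- A subrepresentation: a family of subspaces stable under all arrow maps. -/
structure SubRep {n : ℕ} {a : Fin n → Fin n → ℕ} {k : Type*} [Field k]
    {α : Fin n → ℕ} (σ : QRep n a k α) where
  U : ∀ i, Submodule k (Fin (α i) → k)
  stable : ∀ i j (t : Fin (a i j)), ∀ x ∈ U i, (σ i j t).mulVec x ∈ U j

/-- The slope `μ(β) = θ(β)/ht(β)` of a dimension vector. -/
def qSlope (n : ℕ) (θ : (Fin n → ℤ) →ₗ[ℤ] ℤ) (β : Fin n → ℕ) : ℚ :=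
  (θ (fun i => (β i : ℤ)) : ℚ) / ((∑ i, β i : ℕ) : ℚ)

/-- `θ(β) = μ · ht(β)`: the vector `β` has slope `μ` (i.e. `β ∈ Δ_μ`). -/
def qSlopeIs (n : ℕ) (θ : (Fin n → ℤ) →ₗ[ℤ] ℤ) (μ : ℚ) (β : Fin n → ℕ) : Prop :=
  (θ (fun i => (β i : ℤ)) : ℚ) = μ * ((∑ i, β i : ℕ) : ℚ)

/-- A (non-zero) representation is semistable if every non-zero proper
subrepresentation `U` satisfies `μ(U) ≤ μ(M)`. -/
def IsSemistable {n : ℕ} {a : Fin n → Fin n → ℕ} (θ : (Fin n → ℤ) →ₗ[ℤ] ℤ)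
    {k : Type*} [Field k] {α : Fin n → ℕ} (σ : QRep n a k α) : Prop :=
  ∀ W : SubRep σ, (∃ i, W.U i ≠ ⊥) → (∃ i, W.U i ≠ ⊤) →
    qSlope n θ (fun i => Module.finrank k (W.U i)) ≤ qSlope n θ α

/-- `R^{ss}_μ(α, q)`: the number of semistable representations of `Γ` over `F` of
dimension vector `α` of slope `μ` (with `R^{ss}_μ(0, q) = 1`). -/
noncomputable def Rss (F : Type) [Field F] [Fintype F] (n : ℕ) (a : Fin n → Fin n → ℕ)
    (θ : (Fin n → ℤ) →ₗ[ℤ] ℤ) (μ : ℚ) (α : Fin n → ℕ) : ℕ :=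
  Nat.card {σ : QRep n a F α // IsSemistable θ σ ∧ qSlopeIs n θ μ α}

/-- The Euler form `⟨β,γ⟩ = Σ_i β_i γ_i − Σ_{i,j} a_{ij} β_i γ_j` of `Γ`. -/
def eulerForm (n : ℕ) (a : Fin n → Fin n → ℕ) (β γ : Fin n → ℕ) : ℤ :=
  ∑ i, (β i : ℤ) * (γ i : ℤ) - ∑ i, ∑ j, (a i j : ℤ) * (β i : ℤ) * (γ j : ℤ)

/-- `|GL(β, F_q)| = ∏_i ∏_{k=0}^{β_i − 1} (q^{β_i} − q^k)` as a rational number. -/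
def cardGLq (q : ℚ) {n : ℕ} (β : Fin n → ℕ) : ℚ :=
  ∏ i, ∏ k ∈ Finset.range (β i), (q ^ (β i) - q ^ k)

/-- `R(β, q) = q^{Σ_{i,j} a_{ij} β_i β_j}`, the number of representations of
dimension vector `β`. -/
def Rall (q : ℚ) (n : ℕ) (a : Fin n → Fin n → ℕ) (β : Fin n → ℕ) : ℚ :=
  q ^ (∑ i, ∑ j, a i j * β i * β j)

/-- The base-change action of `GL(α) = ∏_i GL(α_i)` on representations:
`(g·σ)_a = g_j σ_a g_i⁻¹` for an arrow `a : i → j`. -/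
def glSmul {n : ℕ} {a : Fin n → Fin n → ℕ} {k : Type*} [Field k] {α : Fin n → ℕ}
    (g : ∀ i, GL (Fin (α i)) k) (σ : QRep n a k α) : QRep n a k α :=
  fun i j t => (g j).val * σ i j t * ((g i)⁻¹).val

/-- Base change of a representation along a field homomorphism. -/
def mapRep {n : ℕ} {a : Fin n → Fin n → ℕ} {k K : Type*} [Field k] [Field K]
    (φ : k →+* K) {α : Fin n → ℕ} (σ : QRep n a k α) : QRep n a K α :=
  fun i j t => (σ i j t).map φ

/-- A representation is indecomposable if it is non-zero and is not the direct sum of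
two non-zero subrepresentations. -/
def IndecRep {n : ℕ} {a : Fin n → Fin n → ℕ} {k : Type*} [Field k] {α : Fin n → ℕ}
    (ρ : QRep n a k α) : Prop :=
  α ≠ 0 ∧ ∀ U W : SubRep ρ, (∀ i, IsCompl (U.U i) (W.U i)) →
    (∀ i, U.U i = ⊥) ∨ (∀ i, W.U i = ⊥)

/-- A representation over a finite field is absolutely indecomposable if it stays
indecomposable after extension of scalars to the algebraic closure. -/
def AbsIndec {n : ℕ} {a : Fin n → Fin n → ℕ} {F : Type} [Field F] {α : Fin n → ℕ}
    (σ : QRep n a F α) : Prop :=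
  IndecRep (mapRep (algebraMap F (AlgebraicClosure F)) σ)

/-- `A^{ss}_μ(α, q)`: the number of isomorphism classes (`GL(α)`-orbits) of absolutely
indecomposable semistable representations of `Γ` over `F` of dimension `α` and slope `μ`. -/
noncomputable def Ass (F : Type) [Field F] [Fintype F] (n : ℕ) (a : Fin n → Fin n → ℕ)
    (θ : (Fin n → ℤ) →ₗ[ℤ] ℤ) (μ : ℚ) (α : Fin n → ℕ) : ℕ :=
  Nat.card (Quot (fun σ σ' :
      {σ : QRep n a F α // IsSemistable θ σ ∧ qSlopeIs n θ μ α ∧ AbsIndec σ} =>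
    ∃ g : ∀ i, GL (Fin (α i)) F, glSmul g σ.1 = σ'.1))


set_option linter.all false


/-! ### Part A: functions of `q` which are rational functions -/

/-- Functions of `q` given, for `q ≥ 2`, by a rational function without poles there. -/
def ratS : Subalgebra ℚ (ℕ → ℚ) where
  carrier := {r | ∃ P Q : Polynomial ℚ, ∀ q : ℕ, 2 ≤ q →
    Q.eval (q : ℚ) ≠ 0 ∧ r q * Q.eval (q : ℚ) = P.eval (q : ℚ)}
  mul_mem' := by
    rintro a b ⟨P, Q, h⟩ ⟨P', Q', h'⟩
    refine ⟨P * P', Q * Q', fun q hq => ?_⟩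
    obtain ⟨h1, h2⟩ := h q hq
    obtain ⟨h3, h4⟩ := h' q hq
    simp only [Polynomial.eval_mul, Pi.mul_apply]
    refine ⟨mul_ne_zero h1 h3, ?_⟩
    rw [← h2, ← h4]; ring
  add_mem' := by
    rintro a b ⟨P, Q, h⟩ ⟨P', Q', h'⟩
    refine ⟨P * Q' + P' * Q, Q * Q', fun q hq => ?_⟩
    obtain ⟨h1, h2⟩ := h q hq
    obtain ⟨h3, h4⟩ := h' q hq
    simp only [Polynomial.eval_mul, Pi.add_apply, Polynomial.eval_add]
    refine ⟨mul_ne_zero h1 h3, ?_⟩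
    rw [← h2, ← h4]; ring
  algebraMap_mem' := by
    intro c
    refine ⟨Polynomial.C c, 1, fun q _ => ?_⟩
    simp

theorem ratS_congr {r r' : ℕ → ℚ} (h : r ∈ ratS) (e : ∀ q, 2 ≤ q → r' q = r q) : r' ∈ ratS := by
  obtain ⟨P, Q, h⟩ := h
  exact ⟨P, Q, fun q hq => by rw [e q hq]; exact h q hq⟩

theorem ratS_poly (P : Polynomial ℚ) : (fun q : ℕ => P.eval (q : ℚ)) ∈ ratS :=
  ⟨P, 1, fun q _ => by simp⟩

theorem ratS_id : (fun q : ℕ => (q : ℚ)) ∈ ratS := by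
  simpa using ratS_poly Polynomial.X

theorem ratS_const (c : ℚ) : (fun _ : ℕ => c) ∈ ratS := by
  simpa using ratS_poly (Polynomial.C c)

theorem ratS_pow (k : ℕ) : (fun q : ℕ => (q : ℚ) ^ k) ∈ ratS := by
  simpa using ratS_poly (Polynomial.X ^ k)

theorem ratS_mul {a b : ℕ → ℚ} (ha : a ∈ ratS) (hb : b ∈ ratS) :
    (fun q => a q * b q) ∈ ratS := ratS.mul_mem ha hb

theorem ratS_add {a b : ℕ → ℚ} (ha : a ∈ ratS) (hb : b ∈ ratS) :
    (fun q => a q + b q) ∈ ratS := ratS.add_mem ha hb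

theorem ratS_sub {a b : ℕ → ℚ} (ha : a ∈ ratS) (hb : b ∈ ratS) :
    (fun q => a q - b q) ∈ ratS := ratS.sub_mem ha hb

theorem ratS_sum {I : Type*} (s : Finset I) {a : I → ℕ → ℚ} (ha : ∀ i ∈ s, a i ∈ ratS) :
    (fun q => ∑ i ∈ s, a i q) ∈ ratS := by
  have := ratS.sum_mem ha
  convert this using 1
  ext q; simp

theorem ratS_prod {I : Type*} (s : Finset I) {a : I → ℕ → ℚ} (ha : ∀ i ∈ s, a i ∈ ratS) :
    (fun q => ∏ i ∈ s, a i q) ∈ ratS := by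
  have := ratS.prod_mem ha
  convert this using 1
  ext q; simp

theorem ratS_inv {a : ℕ → ℚ} (ha : a ∈ ratS) (h0 : ∀ q, 2 ≤ q → a q ≠ 0) :
    (fun q => (a q)⁻¹) ∈ ratS := by
  obtain ⟨P, Q, h⟩ := ha
  refine ⟨Q, P, fun q hq => ?_⟩
  obtain ⟨h1, h2⟩ := h q hq
  have := h0 q hq
  rw [← h2]
  refine ⟨mul_ne_zero this h1, ?_⟩
  field_simp

theorem ratS_div {a b : ℕ → ℚ} (ha : a ∈ ratS) (hb : b ∈ ratS) (h0 : ∀ q, 2 ≤ q → b q ≠ 0) :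
    (fun q => a q / b q) ∈ ratS := by
  simpa [div_eq_mul_inv] using ratS_mul ha (ratS_inv hb h0)

theorem ratS_comp {a : ℕ → ℚ} (ha : a ∈ ratS) {d : ℕ} (hd : 1 ≤ d) :
    (fun q => a (q ^ d)) ∈ ratS := by
  obtain ⟨P, Q, h⟩ := ha
  refine ⟨P.comp (Polynomial.X ^ d), Q.comp (Polynomial.X ^ d), fun q hq => ?_⟩
  have := h (q ^ d) (le_trans hq (Nat.le_self_pow (by omega) q))
  simpa using this

theorem cast_choose_prod (N k : ℕ) : (N.choose k : ℚ) =
    ((k.factorial : ℚ))⁻¹ * ∏ i ∈ Finset.range k, ((N : ℚ) - (i : ℚ)) := by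
  have h2 : (k.factorial : ℚ) ≠ 0 := by exact_mod_cast k.factorial_ne_zero
  rw [← descPochhammer_eval_eq_prod_range, eq_inv_mul_iff_mul_eq₀ h2,
    descPochhammer_eval_eq_descFactorial, Nat.descFactorial_eq_factorial_mul_choose]
  push_cast; rfl

/-- order of `GL_m(F_q)` -/
def glq (q m : ℕ) : ℚ := ∏ i ∈ Finset.range m, ((q : ℚ) ^ m - (q : ℚ) ^ i)

theorem glq_ne_zero {q : ℕ} (hq : 2 ≤ q) (m : ℕ) : glq q m ≠ 0 := by
  unfold glq
  rw [Finset.prod_ne_zero_iff]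
  intro i hi
  have : (q : ℚ) ^ i < (q : ℚ) ^ m :=
    pow_lt_pow_right₀ (by exact_mod_cast hq) (Finset.mem_range.1 hi)
  exact (sub_pos.2 this).ne'

theorem ratS_glq (m : ℕ) : (fun q => glq q m) ∈ ratS :=
  ratS_prod _ fun _ _ => ratS_sub (ratS_pow _) (ratS_pow _)

theorem card_GL_eq (F : Type*) [Field F] [Fintype F] (m : ℕ) :
    (Nat.card (GL (Fin m) F) : ℚ) = glq (Fintype.card F) m := by
  rw [Matrix.card_GL_field, glq, Finset.prod_range, Nat.cast_prod]
  refine Finset.prod_congr rfl fun i _ => ?_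
  rw [Nat.cast_sub]
  · push_cast; rfl
  · exact Nat.pow_le_pow_right Fintype.card_pos i.2.le

/-- A rational function of `q` taking integral values at all primes is a polynomial. -/
theorem ratS_poly_of_int {r : ℕ → ℚ} (hr : r ∈ ratS) (hi : ∀ q, q.Prime → ∃ z : ℤ, r q = z) :
    ∃ f : Polynomial ℚ, ∀ q, 2 ≤ q → r q = f.eval (q : ℚ) := by
  obtain ⟨P, Q, h⟩ := hr
  have hQ0 : Q ≠ 0 := by
    rintro rfl
    exact (h 2 le_rfl).1 (by simp)
  set S := P / Q with hS
  set T := P % Q with hT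
  have hPQ : P = Q * S + T := (EuclideanDomain.div_add_mod P Q).symm
  have hdeg : T.degree < Q.degree := EuclideanDomain.mod_lt P hQ0
  obtain ⟨N, hN, hNS⟩ : ∃ N : ℕ, 0 < N ∧ ∀ z : ℤ, ∃ y : ℤ, (N : ℚ) * S.eval (z : ℚ) = y := by
    obtain ⟨b, hbm, hb⟩ := IsLocalization.integerNormalization_spec (nonZeroDivisors ℤ) S
    have hb0 : (b : ℤ) ≠ 0 := nonZeroDivisors.ne_zero hbm
    refine ⟨(b : ℤ).natAbs, Int.natAbs_pos.2 hb0, fun z => ?_⟩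
    have h2 : ((b : ℤ) : ℚ) * S.eval (z : ℚ) =
        (((IsLocalization.integerNormalization (nonZeroDivisors ℤ) S).eval z : ℤ) : ℚ) := by
      have := congrArg (Polynomial.eval (z : ℚ)) hb
      rw [Polynomial.eval_smul, zsmul_eq_mul] at this
      rw [← this, Polynomial.eval_map]
      have h3 := Polynomial.eval₂_at_apply (p := IsLocalization.integerNormalization
        (nonZeroDivisors ℤ) S) (algebraMap ℤ ℚ) z
      simpa using h3
    rcases Int.natAbs_eq (b : ℤ) with h3 | h3
    · refine ⟨(IsLocalization.integerNormalization (nonZeroDivisors ℤ) S).eval z, ?_⟩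
      rw [← h2]
      congr 1
      rw [h3]; simp
    · refine ⟨-(IsLocalization.integerNormalization (nonZeroDivisors ℤ) S).eval z, ?_⟩
      rw [Int.cast_neg, ← h2, ← neg_mul]
      congr 1
      rw [h3]; simp
  have hlim := Polynomial.div_tendsto_atTop_zero_of_degree_lt T Q hdeg
  have hlim2 : Filter.Tendsto (fun q : ℕ => (N : ℚ) * (T.eval (q : ℚ) / Q.eval (q : ℚ)))
      Filter.atTop (nhds 0) := by
    have := (hlim.comp (tendsto_natCast_atTop_atTop (R := ℚ))).const_mul (N : ℚ)
    simpa using this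
  have hev : ∀ᶠ q : ℕ in Filter.atTop, |(N : ℚ) * (T.eval (q : ℚ) / Q.eval (q : ℚ))| < 1 := by
    have := hlim2.eventually (Metric.ball_mem_nhds (0 : ℚ) one_pos)
    filter_upwards [this] with q hq
    rw [dist_zero_right] at hq
    have h5 : ‖((N : ℚ) * (T.eval (q : ℚ) / Q.eval (q : ℚ)))‖ =
      ((|(N : ℚ) * (T.eval (q : ℚ) / Q.eval (q : ℚ))| : ℚ) : ℝ) := by
      rw [← Rat.norm_cast_real, Real.norm_eq_abs, Rat.cast_abs]
    rw [h5] at hq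
    exact_mod_cast hq
  obtain ⟨q0, hq0⟩ := Filter.eventually_atTop.1 hev
  have hroot : ∀ q : ℕ, q.Prime → q0 ≤ q → T.eval (q : ℚ) = 0 := by
    intro q hq hqq
    obtain ⟨z, hz⟩ := hi q hq
    obtain ⟨y, hy⟩ := hNS q
    obtain ⟨h1, h2⟩ := h q hq.two_le
    have h3 := hq0 q hqq
    have h4 : (N : ℚ) * (T.eval (q : ℚ) / Q.eval (q : ℚ)) = ((N * z - y : ℤ) : ℚ) := by
      push_cast
      rw [← hy, ← hz]
      rw [hPQ] at h2
      simp only [Polynomial.eval_add, Polynomial.eval_mul] at h2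
      push_cast
      field_simp
      linear_combination (-1 : ℚ) * h2
    rw [h4] at h3
    have h5 : (N * z - y : ℤ) = 0 := by
      have : |(N * z - y : ℤ)| < 1 := by exact_mod_cast h3
      exact Int.abs_lt_one_iff.1 this
    rw [h5] at h4
    simp only [Int.cast_zero, mul_eq_zero, div_eq_zero_iff, h1, or_false] at h4
    rcases h4 with h4 | h4
    · exact absurd h4 (by exact_mod_cast hN.ne')
    · exact h4
  have hT0 : T = 0 := by
    refine Polynomial.eq_zero_of_infinite_isRoot T ?_
    have hinf : ((fun q : ℕ => (q : ℚ)) '' {q : ℕ | q.Prime ∧ q0 ≤ q}).Infinite := by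
      refine Set.Infinite.image (Nat.cast_injective.injOn) ?_
      rw [Set.infinite_iff_exists_gt] 
      intro a
      obtain ⟨p, hp, hpp⟩ := Nat.exists_infinite_primes (max (a + 1) q0)
      exact ⟨p, ⟨hpp, le_trans (le_max_right _ _) hp⟩, by
        have := le_trans (le_max_left _ _) hp; omega⟩
    refine hinf.mono ?_
    rintro _ ⟨q, ⟨hq, hq'⟩, rfl⟩
    exact hroot q hq hq'
  refine ⟨S, fun q hq => ?_⟩
  obtain ⟨h1, h2⟩ := h q hq
  rw [hPQ, hT0] at h2
  simp only [Polynomial.eval_add, Polynomial.eval_mul, Polynomial.eval_zero, add_zero] at h2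
  exact mul_right_cancel₀ h1 (by rw [h2, mul_comm])


/-! ### Part B1: representations on families of vector spaces -/

section FRepBasics

/-- representations of a quiver with arrows `Ar`, on the family `V` of vector spaces -/
abbrev FRep (F : Type) [Field F] {ι Ar : Type} (s t : Ar → ι) (V : ι → Type)
    [∀ i, AddCommGroup (V i)] [∀ i, Module F (V i)] := ∀ x : Ar, V (s x) →ₗ[F] V (t x)

variable {F : Type} [Field F] {ι Ar : Type} [Fintype ι] {s t : Ar → ι} {V V' : ι → Type}
  [∀ i, AddCommGroup (V i)] [∀ i, Module F (V i)]
  [∀ i, AddCommGroup (V' i)] [∀ i, Module F (V' i)]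

/-- stable families of subspaces -/
def Stb (σ : FRep F s t V) (W : ∀ i, Submodule F (V i)) : Prop :=
  ∀ x, ∀ v ∈ W (s x), σ x v ∈ W (t x)

/-- weighted dimension -/
noncomputable def dg (w : ι → ℚ) (W : ∀ i, Submodule F (V i)) : ℚ :=
  ∑ i, w i * (Module.finrank F (W i) : ℚ)

def FF (w : ι → ℚ) (σ : FRep F s t V) : Prop := ∀ W, Stb σ W → dg w W ≤ 0

def TT (w : ι → ℚ) (σ : FRep F s t V) : Prop := ∀ W, Stb σ W → W ≠ ⊤ → dg w W < dg w (⊤ : ∀ i, Submodule F (V i))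

def SS (w : ι → ℚ) (σ : FRep F s t V) : Prop :=
  dg w (⊤ : ∀ i, Submodule F (V i)) = 0 ∧ ∀ W, Stb σ W → dg w W ≤ 0

def HN (w : ι → ℚ) (σ : FRep F s t V) (U : ∀ i, Submodule F (V i)) : Prop :=
  Stb σ U ∧ (∀ W, Stb σ W → W < U → dg w W < dg w U) ∧ (∀ W, Stb σ W → U ≤ W → dg w W ≤ dg w U)

theorem Stb.sup {σ : FRep F s t V} {W W' : ∀ i, Submodule F (V i)} (h : Stb σ W) (h' : Stb σ W') :
    Stb σ (W ⊔ W') := by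
  intro x v hv
  rw [Pi.sup_apply] at hv ⊢
  obtain ⟨a, ha, b, hb, rfl⟩ := Submodule.mem_sup.1 hv
  rw [map_add]
  exact Submodule.add_mem_sup (h x a ha) (h' x b hb)

theorem Stb.inf {σ : FRep F s t V} {W W' : ∀ i, Submodule F (V i)} (h : Stb σ W) (h' : Stb σ W') :
    Stb σ (W ⊓ W') := fun x v hv => ⟨h x v hv.1, h' x v hv.2⟩

theorem Stb.bot {σ : FRep F s t V} : Stb σ ⊥ := by
  intro x v hv
  rw [Pi.bot_apply, Submodule.mem_bot] at hv ⊢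
  rw [hv, map_zero]

theorem Stb.top {σ : FRep F s t V} : Stb σ ⊤ := fun x v hv => trivial

theorem dg_bot (w : ι → ℚ) : dg w (⊥ : ∀ i, Submodule F (V i)) = 0 := by
  simp [dg]

theorem dg_top (w : ι → ℚ) : dg w (⊤ : ∀ i, Submodule F (V i)) =
    ∑ i, w i * (Module.finrank F (V i) : ℚ) := by
  simp [dg]

theorem dg_sup_inf [∀ i, Module.Finite F (V i)] (w : ι → ℚ) (W W' : ∀ i, Submodule F (V i)) :
    dg w (W ⊔ W') + dg w (W ⊓ W') = dg w W + dg w W' := by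
  simp only [dg, ← Finset.sum_add_distrib, ← mul_add]
  refine Finset.sum_congr rfl fun i _ => ?_
  congr 1
  exact_mod_cast Submodule.finrank_sup_add_finrank_inf_eq (W i) (W' i)

theorem HN_unique [∀ i, Module.Finite F (V i)] {w : ι → ℚ} {σ : FRep F s t V}
    {U U' : ∀ i, Submodule F (V i)} (h : HN w σ U) (h' : HN w σ U') : U = U' := by
  have key : ∀ U U' : ∀ i, Submodule F (V i), HN w σ U → HN w σ U' → U ≤ U' := by
    intro U U' h h'
    have h1 := h'.2.2 _ (h.1.sup h'.1) le_sup_right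
    have h2 := dg_sup_inf w U U'
    have h3 : ¬ (U ⊓ U' < U) := fun hlt => by
      have := h.2.1 _ (h.1.inf h'.1) hlt
      linarith
    have h4 : U ⊓ U' = U := by
      by_contra hne
      exact h3 (lt_of_le_of_ne inf_le_left hne)
    exact inf_eq_left.1 h4
  exact le_antisymm (key _ _ h h') (key _ _ h' h)

theorem HN_exists [∀ i, Finite (V i)] (w : ι → ℚ) (σ : FRep F s t V) : ∃ U, HN w σ U := by
  have hfin : Finite (∀ i, Submodule F (V i)) := inferInstance
  obtain ⟨U0, hU0, hmax⟩ := Set.Finite.exists_maximalFor (dg w) {W | Stb σ W} (Set.toFinite _)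
    ⟨⊥, Stb.bot⟩
  have hmax' : ∀ W, Stb σ W → dg w W ≤ dg w U0 := by
    intro W hW
    by_contra hlt
    exact hlt (hmax hW (not_le.1 hlt).le)
  obtain ⟨U, hU, hmin⟩ := Set.Finite.exists_minimal (s := {W | Stb σ W ∧ dg w W = dg w U0})
    (Set.toFinite _) ⟨U0, hU0, rfl⟩
  refine ⟨U, hU.1, fun W hW hlt => ?_, fun W hW _ => hU.2 ▸ hmax' W hW⟩
  refine lt_of_le_of_ne (hU.2 ▸ hmax' W hW) fun he => ?_
  exact absurd (hmin ⟨hW, he.trans hU.2⟩ hlt.le) (not_le_of_gt hlt)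

/-- transport of representations -/
def trF (e : ∀ i, V i ≃ₗ[F] V' i) (σ : FRep F s t V) : FRep F s t V' :=
  fun x => (e (t x)).toLinearMap ∘ₗ σ x ∘ₗ (e (s x)).symm.toLinearMap

@[simp] theorem trF_apply (e : ∀ i, V i ≃ₗ[F] V' i) (σ : FRep F s t V) (x : Ar) (v) :
    trF e σ x v = e (t x) (σ x ((e (s x)).symm v)) := rfl

/-- transport as an equivalence -/
def trFEquiv (s t : Ar → ι) (e : ∀ i, V i ≃ₗ[F] V' i) : FRep F s t V ≃ FRep F s t V' where
  toFun := trF e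
  invFun := trF fun i => (e i).symm
  left_inv σ := by funext x; ext v; simp
  right_inv σ := by funext x; ext v; simp

/-- transport of families of subspaces -/
def mpF (e : ∀ i, V i ≃ₗ[F] V' i) : (∀ i, Submodule F (V i)) ≃o (∀ i, Submodule F (V' i)) where
  toFun W i := (W i).map (e i).toLinearMap
  invFun W i := (W i).map (e i).symm.toLinearMap
  left_inv W := by
    funext i; ext v; simp
  right_inv W := by
    funext i; ext v; simp
  map_rel_iff' := by
    intro W W'
    constructor
    · intro h i
      exact (Submodule.map_le_map_iff_of_injective (e i).injective _ _).1 (h i)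
    · intro h i
      exact (Submodule.map_le_map_iff_of_injective (e i).injective _ _).2 (h i)

theorem mpF_apply (e : ∀ i, V i ≃ₗ[F] V' i) (W : ∀ i, Submodule F (V i)) (i : ι) :
    mpF e W i = (W i).map (e i).toLinearMap := rfl

theorem stb_trF (e : ∀ i, V i ≃ₗ[F] V' i) (σ : FRep F s t V) (W : ∀ i, Submodule F (V i)) :
    Stb (trF e σ) (mpF e W) ↔ Stb σ W := by
  constructor
  · intro h x v hv
    have := h x (e (s x) v) (Submodule.mem_map_of_mem hv)
    rw [mpF_apply, Submodule.mem_map] at this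
    obtain ⟨y, hy, hye⟩ := this
    simp at hye
    rwa [← hye]
  · intro h x v hv
    rw [mpF_apply, Submodule.mem_map] at hv
    obtain ⟨y, hy, rfl⟩ := hv
    refine Submodule.mem_map.2 ⟨σ x y, h x y hy, ?_⟩
    simp

theorem dg_mpF (w : ι → ℚ) (e : ∀ i, V i ≃ₗ[F] V' i) (W : ∀ i, Submodule F (V i)) :
    dg w (mpF e W) = dg w W := by
  refine Finset.sum_congr rfl fun i _ => ?_
  congr 2
  exact LinearEquiv.finrank_map_eq (e i) (W i)

theorem FF_trF (w : ι → ℚ) (e : ∀ i, V i ≃ₗ[F] V' i) (σ : FRep F s t V) :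
    FF w (trF e σ) ↔ FF w σ := by
  unfold FF
  rw [(mpF e).surjective.forall]
  simp only [stb_trF, dg_mpF]

theorem TT_trF (w : ι → ℚ) (e : ∀ i, V i ≃ₗ[F] V' i) (σ : FRep F s t V) :
    TT w (trF e σ) ↔ TT w σ := by
  unfold TT
  rw [(mpF e).surjective.forall, ← (mpF e).map_top]
  simp only [stb_trF, dg_mpF, ne_eq, (mpF e).injective.eq_iff]

theorem SS_trF (w : ι → ℚ) (e : ∀ i, V i ≃ₗ[F] V' i) (σ : FRep F s t V) :
    SS w (trF e σ) ↔ SS w σ := by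
  unfold SS
  rw [(mpF e).surjective.forall, ← (mpF e).map_top]
  simp only [stb_trF, dg_mpF]

theorem HN_trF (w : ι → ℚ) (e : ∀ i, V i ≃ₗ[F] V' i) (σ : FRep F s t V) (U : ∀ i, Submodule F (V i)) :
    HN w (trF e σ) (mpF e U) ↔ HN w σ U := by
  unfold HN
  rw [(mpF e).surjective.forall, (mpF e).surjective.forall]
  simp only [stb_trF, dg_mpF, (mpF e).lt_iff_lt, (mpF e).le_iff_le]

end FRepBasics

section Counting

/-- The basic counting lemma. -/
theorem groupoid_count {G X : Type} [Group G] [Finite G] [Finite X] (act : G → X → X)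
    (act_mul : ∀ g h x, act g (act h x) = act (g * h) x) (act_one : ∀ x, act 1 x = x)
    (Xm Y : Set X) (H : Set G)
    (h1 : ∀ x ∈ Xm, ∃ g, ∃ y ∈ Y, act g y = x)
    (h2 : ∀ y ∈ Y, ∀ g, act g y ∈ Xm)
    (h3 : ∀ y ∈ Y, ∀ g, act g y ∈ Y ↔ g ∈ H) :
    Nat.card Xm * Nat.card H = Nat.card G * Nat.card Y := by
  rw [← Nat.card_prod, ← Nat.card_prod]
  choose γ y hy hγ using h1
  refine (Nat.card_congr ?_)
  refine Equiv.ofBijective (fun p : Xm × H =>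
    (⟨γ p.1.1 p.1.2 * (p.2.1)⁻¹, ⟨act p.2.1 (y p.1.1 p.1.2),
      (h3 _ (hy _ _) _).2 p.2.2⟩⟩ : G × Y)) ⟨?_, ?_⟩
  · rintro ⟨⟨x, hx⟩, ⟨g, hg⟩⟩ ⟨⟨x', hx'⟩, ⟨g', hg'⟩⟩ he
    simp only [Prod.mk.injEq, Subtype.mk.injEq] at he
    obtain ⟨he1, he2⟩ := he
    have hxx : x = x' := by
      rw [← hγ x hx, ← hγ x' hx']
      have e1 : act (γ x hx) (y x hx) = act (γ x hx * g⁻¹) (act g (y x hx)) := by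
        rw [act_mul]; simp
      have e2 : act (γ x' hx') (y x' hx') = act (γ x' hx' * g'⁻¹) (act g' (y x' hx')) := by
        rw [act_mul]; simp
      rw [e1, e2, he1, he2]
    subst hxx
    have : g = g' := by simpa using he1
    subst this
    rfl
  · rintro ⟨g, ⟨z, hz⟩⟩
    have hx := h2 z hz g
    have hgg : act (γ _ hx) (y _ hx) = act g z := hγ _ hx
    have hz' : act (g⁻¹ * γ _ hx) (y _ hx) = z := by
      rw [← act_mul, hgg, act_mul]; simp [act_one]
    refine ⟨⟨⟨act g z, hx⟩, ⟨g⁻¹ * γ _ hx, (h3 _ (hy _ hx) _).1 (by rw [hz']; exact hz)⟩⟩, ?_⟩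
    simp [hz']

theorem natCard_equiv_gl (F : Type) [Field F] [Fintype F] (V : Type) [AddCommGroup V] [Module F V]
    [Module.Finite F V] {m : ℕ} (hm : Module.finrank F V = m) :
    (Nat.card (V ≃ₗ[F] V) : ℚ) = glq (Fintype.card F) m := by
  rw [← card_GL_eq]
  congr 1
  let e : V ≃ₗ[F] (Fin m → F) := LinearEquiv.ofFinrankEq _ _ (by simp [hm])
  have e1 : (V ≃ₗ[F] V) ≃ ((Fin m → F) ≃ₗ[F] (Fin m → F)) :=
    { toFun := fun f => e.symm.trans (f.trans e)
      invFun := fun f => e.trans (f.trans e.symm)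
      left_inv := fun f => by ext; simp
      right_inv := fun f => by ext1 v; simp }
  exact Nat.card_congr (e1.trans ((LinearMap.GeneralLinearGroup.generalLinearEquiv F _).symm.toEquiv.trans
    Matrix.GeneralLinearGroup.toLin.symm.toEquiv))

theorem natCard_hom (F : Type) [Field F] [Fintype F] (V W : Type) [AddCommGroup V] [Module F V]
    [AddCommGroup W] [Module F W]
    [Module.Finite F V] [Module.Finite F W] :
    Nat.card (V →ₗ[F] W) = Fintype.card F ^ (Module.finrank F V * Module.finrank F W) := by
  rw [Module.natCard_eq_pow_finrank (K := F), Module.finrank_linearMap, Nat.card_eq_fintype_card]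

end Counting


/-! ### Part B2: Harder-Narasimhan recursion -/

section Tri

variable {F : Type} [Field F] {B C B' C' : Type} [AddCommGroup B] [Module F B]
  [AddCommGroup C] [Module F C] [AddCommGroup B'] [Module F B'] [AddCommGroup C'] [Module F C']

/-- block triangular map -/
def tri (p : B →ₗ[F] B') (r : C →ₗ[F] C') (q : C →ₗ[F] B') : (B × C) →ₗ[F] (B' × C') :=
  LinearMap.prod (p ∘ₗ LinearMap.fst F B C + q ∘ₗ LinearMap.snd F B C) (r ∘ₗ LinearMap.snd F B C)

@[simp] theorem tri_apply (p : B →ₗ[F] B') (r : C →ₗ[F] C') (q : C →ₗ[F] B') (v : B × C) :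
    tri p r q v = (p v.1 + q v.2, r v.2) := rfl

/-- maps preserving the first factor are triangular -/
def triEquiv : {f : (B × C) →ₗ[F] (B' × C') // ∀ v, v.2 = 0 → (f v).2 = 0} ≃
    (B →ₗ[F] B') × (C →ₗ[F] C') × (C →ₗ[F] B') where
  toFun f := (LinearMap.fst F B' C' ∘ₗ f.1 ∘ₗ LinearMap.inl F B C,
    LinearMap.snd F B' C' ∘ₗ f.1 ∘ₗ LinearMap.inr F B C,
    LinearMap.fst F B' C' ∘ₗ f.1 ∘ₗ LinearMap.inr F B C)
  invFun m := ⟨tri m.1 m.2.1 m.2.2, fun v hv => by simp [hv]⟩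
  left_inv f := by
    obtain ⟨f, hf⟩ := f
    apply Subtype.ext
    apply LinearMap.prod_ext
    · ext v
      · simp [show (((0 : B), (0 : C))) = 0 from rfl]
      · simp [hf]
    · ext v <;> simp [show (((0 : B), (0 : C))) = 0 from rfl]
  right_inv m := by
    obtain ⟨p, r, q⟩ := m
    simp only [Prod.mk.injEq]
    refine ⟨?_, ?_, ?_⟩ <;> (ext v; simp)

/-- automorphisms preserving the first factor -/
theorem triEquiv_bij [Module.Finite F B] [Module.Finite F C] (p : B →ₗ[F] B) (r : C →ₗ[F] C) (q : C →ₗ[F] B) :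
    Function.Bijective (tri p r q) ↔ Function.Bijective p ∧ Function.Bijective r := by
  constructor
  · intro h
    constructor
    · have : Function.Injective p := by
        intro v v' hv
        have := @h.1 (v, 0) (v', 0) (by simp [hv])
        simpa using this
      exact ⟨this, LinearMap.injective_iff_surjective.1 this⟩
    · have : Function.Surjective r := by
        intro c
        obtain ⟨v, hv⟩ := h.2 (0, c)
        exact ⟨v.2, by simpa using congrArg Prod.snd hv⟩
      exact ⟨LinearMap.injective_iff_surjective.2 this, this⟩
  · rintro ⟨hp, hr⟩
    have : Function.Injective (tri p r q) := by
      rw [injective_iff_map_eq_zero]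
      rintro ⟨b, c⟩ h
      simp only [tri_apply, Prod.mk_eq_zero] at h
      have hc : c = 0 := hr.1 (by simpa using h.2)
      subst hc
      have hb : b = 0 := hp.1 (by simpa using h.1)
      subst hb; rfl
    exact ⟨this, LinearMap.injective_iff_surjective.1 this⟩

noncomputable def bijEquiv : {f : B →ₗ[F] B' // Function.Bijective f} ≃ (B ≃ₗ[F] B') where
  toFun f := LinearEquiv.ofBijective f.1 f.2
  invFun e := ⟨e.toLinearMap, e.bijective⟩
  left_inv f := by ext; simp
  right_inv e := by ext; simp

theorem card_triAut [Fintype F] [Module.Finite F B] [Module.Finite F C] :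
    (Nat.card {g : (B × C) ≃ₗ[F] (B × C) // ∀ v, v.2 = 0 → (g v).2 = 0} : ℚ) =
      glq (Fintype.card F) (Module.finrank F B) * glq (Fintype.card F) (Module.finrank F C) *
        (Fintype.card F : ℚ) ^ (Module.finrank F B * Module.finrank F C) := by
  have e : {g : (B × C) ≃ₗ[F] (B × C) // ∀ v, v.2 = 0 → (g v).2 = 0} ≃
      (B ≃ₗ[F] B) × (C ≃ₗ[F] C) × (C →ₗ[F] B) := by
    refine (Equiv.subtypeEquiv (q := fun f => ∀ v, v.2 = 0 → (f.1 v).2 = 0) bijEquiv.symm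
      (by intro g; rfl)).trans ?_
    refine (Equiv.subtypeSubtypeEquivSubtypeInter _ (fun f : (B × C) →ₗ[F] (B × C) =>
       ∀ v, v.2 = 0 → (f v).2 = 0)).trans ?_
    refine (Equiv.subtypeEquivRight (fun f => and_comm)).trans ?_
    refine (Equiv.subtypeSubtypeEquivSubtypeInter (fun f : (B × C) →ₗ[F] (B × C) =>
       ∀ v, v.2 = 0 → (f v).2 = 0) (fun f => Function.Bijective f)).symm.trans ?_
    refine (Equiv.subtypeEquiv (q := fun m => Function.Bijective m.1 ∧ Function.Bijective m.2.1) triEquiv ?_).trans ?_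
    · intro f
      rw [← triEquiv_bij _ _ (triEquiv f).2.2]
      have : f.1 = tri (triEquiv f).1 (triEquiv f).2.1 (triEquiv f).2.2 :=
        congrArg Subtype.val (triEquiv.symm_apply_apply f).symm
      rw [← this]
    · exact
      { toFun := fun m => (bijEquiv ⟨m.1.1, m.2.1⟩, bijEquiv ⟨m.1.2.1, m.2.2⟩, m.1.2.2)
        invFun := fun m => ⟨(m.1.toLinearMap, m.2.1.toLinearMap, m.2.2), m.1.bijective, m.2.1.bijective⟩
        left_inv := fun m => rfl
        right_inv := fun m => by
          refine Prod.ext ?_ (Prod.ext ?_ rfl)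
          · ext; rfl
          · ext; rfl }
  rw [Nat.card_congr e, Nat.card_prod, Nat.card_prod, natCard_hom]
  push_cast
  rw [natCard_equiv_gl F B rfl, natCard_equiv_gl F C rfl]
  ring

end Tri

section HNcount

variable {F : Type} [Field F] {ι Ar : Type} [Fintype ι] {s t : Ar → ι} {B C : ι → Type}
  [∀ i, AddCommGroup (B i)] [∀ i, Module F (B i)]
  [∀ i, AddCommGroup (C i)] [∀ i, Module F (C i)]

variable (F B C) in
/-- the standard sub-family -/
def stdE : ∀ i, Submodule F (B i × C i) := fun i => LinearMap.ker (LinearMap.snd F (B i) (C i))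

theorem mem_stdE {i : ι} {v : B i × C i} : v ∈ stdE F B C i ↔ v.2 = 0 := by
  simp [stdE]

/-- triangular representation -/
def triRep (p : FRep F s t B) (r : FRep F s t C) (q : ∀ x, C (s x) →ₗ[F] B (t x)) :
    FRep F s t (fun i => B i × C i) := fun x => tri (p x) (r x) (q x)

/-- subfamilies below and above the standard one -/
def loF (W : ∀ i, Submodule F (B i)) : ∀ i, Submodule F (B i × C i) :=
  fun i => (W i).map (LinearMap.inl F (B i) (C i))

def upF (W : ∀ i, Submodule F (C i)) : ∀ i, Submodule F (B i × C i) :=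
  fun i => (W i).comap (LinearMap.snd F (B i) (C i))

theorem mem_loF {W : ∀ i, Submodule F (B i)} {i : ι} {v : B i × C i} :
    v ∈ loF W i ↔ v.1 ∈ W i ∧ v.2 = 0 := by
  simp only [loF, Submodule.mem_map, LinearMap.inl_apply]
  constructor
  · rintro ⟨y, hy, rfl⟩; exact ⟨hy, rfl⟩
  · rintro ⟨h, h'⟩; exact ⟨v.1, h, by rw [← h']⟩

theorem mem_upF {W : ∀ i, Submodule F (C i)} {i : ι} {v : B i × C i} :
    v ∈ upF W i ↔ v.2 ∈ W i := Iff.rfl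

theorem finrank_map_inf_ker {V V' : Type} [AddCommGroup V] [Module F V] [AddCommGroup V'] [Module F V']
    [Module.Finite F V] (f : V →ₗ[F] V') (W : Submodule F V) :
    Module.finrank F W = Module.finrank F (W.map f) + Module.finrank F (W ⊓ LinearMap.ker f : Submodule F V) := by
  have h := (f.domRestrict W).finrank_range_add_finrank_ker
  rw [← h]
  congr 1
  · rw [LinearMap.range_domRestrict]
  · rw [LinearMap.ker_domRestrict]
    have : (W ⊓ LinearMap.ker f : Submodule F V) = ((LinearMap.ker f).submoduleOf W).map W.subtype := by
      rw [Submodule.submoduleOf, Submodule.map_comap_subtype]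
    rw [this]
    exact (LinearEquiv.finrank_eq (Submodule.equivMapOfInjective _ W.injective_subtype _))

theorem dg_map_inf_ker {V V' : ι → Type} [∀ i, AddCommGroup (V i)] [∀ i, Module F (V i)]
    [∀ i, AddCommGroup (V' i)] [∀ i, Module F (V' i)]
    [∀ i, Module.Finite F (V i)] (w : ι → ℚ) (f : ∀ i, V i →ₗ[F] V' i) (W : ∀ i, Submodule F (V i)) :
    dg w W = dg w (fun i => (W i).map (f i)) + dg w (fun i => W i ⊓ LinearMap.ker (f i)) := by
  simp only [dg, ← Finset.sum_add_distrib, ← mul_add]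
  refine Finset.sum_congr rfl fun i _ => ?_
  rw [finrank_map_inf_ker (f i) (W i)]
  push_cast; ring

variable [∀ i, Module.Finite F (B i)] [∀ i, Module.Finite F (C i)]

theorem dg_loF (w : ι → ℚ) (W : ∀ i, Submodule F (B i)) : dg w (loF (C := C) W) = dg w W := by
  rw [dg_map_inf_ker w (fun i => LinearMap.inl F (B i) (C i)) W]
  have : (fun i => W i ⊓ LinearMap.ker (LinearMap.inl F (B i) (C i))) = ⊥ := by
    funext i
    rw [LinearMap.ker_eq_bot.2 LinearMap.inl_injective, inf_bot_eq]; rfl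
  rw [this, dg_bot, add_zero]; rfl

theorem dg_upF (w : ι → ℚ) (W : ∀ i, Submodule F (C i)) :
    dg w (upF (B := B) W) = dg w W + dg w (stdE F B C) := by
  rw [dg_map_inf_ker w (fun i => LinearMap.snd F (B i) (C i)) (upF W)]
  congr 2
  · funext i
    exact Submodule.map_comap_eq_of_surjective LinearMap.snd_surjective _
  · funext i
    refine inf_eq_right.2 fun v hv => ?_
    rw [mem_upF]
    rw [LinearMap.mem_ker] at hv
    have : v.2 = 0 := hv
    rw [this]; exact zero_mem _

theorem loF_top : loF (C := C) (⊤ : ∀ i, Submodule F (B i)) = stdE F B C := by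
  funext i; ext v; rw [mem_loF, mem_stdE]; simp

theorem stb_loF (p : FRep F s t B) (r : FRep F s t C) (q : ∀ x, C (s x) →ₗ[F] B (t x))
    (W : ∀ i, Submodule F (B i)) : Stb (triRep p r q) (loF W) ↔ Stb p W := by
  constructor
  · intro h x v hv
    have := h x (v, 0) (mem_loF.2 ⟨hv, rfl⟩)
    rw [mem_loF] at this
    simpa [triRep] using this.1
  · intro h x v hv
    rw [mem_loF] at hv ⊢
    simpa [triRep, hv.2] using h x _ hv.1

theorem stb_upF (p : FRep F s t B) (r : FRep F s t C) (q : ∀ x, C (s x) →ₗ[F] B (t x))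
    (W : ∀ i, Submodule F (C i)) : Stb (triRep p r q) (upF W) ↔ Stb r W := by
  constructor
  · intro h x v hv
    have := h x (0, v) (mem_upF.2 hv)
    rw [mem_upF] at this
    simpa [triRep] using this
  · intro h x v hv
    rw [mem_upF] at hv ⊢
    simpa [triRep] using h x _ hv

theorem eq_loF {W : ∀ i, Submodule F (B i × C i)} (h : W ≤ stdE F B C) :
    W = loF (fun i => (W i).comap (LinearMap.inl F (B i) (C i))) := by
  funext i; ext v
  rw [mem_loF]
  constructor
  · intro hv
    have h2 := mem_stdE.1 (h i hv)
    refine ⟨?_, h2⟩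
    rw [Submodule.mem_comap, LinearMap.inl_apply, ← h2]; exact hv
  · rintro ⟨h1, h2⟩
    rw [Submodule.mem_comap, LinearMap.inl_apply, ← h2] at h1; exact h1

theorem eq_upF {W : ∀ i, Submodule F (B i × C i)} (h : stdE F B C ≤ W) :
    W = upF (fun i => (W i).map (LinearMap.snd F (B i) (C i))) := by
  funext i
  change _ = Submodule.comap _ (Submodule.map _ _)
  rw [Submodule.comap_map_eq, sup_eq_left.2]
  exact h i

theorem loF_injective : Function.Injective (loF (F := F) (B := B) (C := C)) := by
  intro W W' h
  funext i
  ext v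
  have : ((v, 0) : B i × C i) ∈ loF W i ↔ ((v, 0) : B i × C i) ∈ loF W' i := by rw [h]
  simpa [mem_loF] using this

theorem HN_tri (w : ι → ℚ) (p : FRep F s t B) (r : FRep F s t C) (q : ∀ x, C (s x) →ₗ[F] B (t x)) :
    HN w (triRep p r q) (stdE F B C) ↔ TT w p ∧ FF w r := by
  have hst : Stb (triRep p r q) (stdE F B C) := by
    rw [← loF_top, stb_loF]; exact Stb.top
  constructor
  · rintro ⟨h1, h2, h3⟩
    refine ⟨fun W hW hne => ?_, fun W hW => ?_⟩
    · have := h2 (loF W) ((stb_loF _ _ _ _).2 hW) ?_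
      · rwa [← loF_top, dg_loF, dg_loF] at this
      · rw [← loF_top]
        refine lt_of_le_of_ne ?_ (fun e => hne (loF_injective e))
        intro i v hv
        rw [mem_loF] at hv ⊢
        exact ⟨trivial, hv.2⟩
    · have := h3 (upF W) ((stb_upF _ _ _ _).2 hW) ?_
      · rw [dg_upF] at this; linarith
      · intro i v hv
        rw [mem_upF, mem_stdE.1 hv]; exact zero_mem _
  · rintro ⟨hT, hF⟩
    refine ⟨hst, fun W hW hlt => ?_, fun W hW hle => ?_⟩
    · obtain ⟨W', rfl⟩ : ∃ W', W = loF W' := ⟨_, eq_loF hlt.le⟩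
      rw [← loF_top, dg_loF, dg_loF]
      refine hT _ ((stb_loF _ _ _ _).1 hW) fun e => ?_
      rw [e, loF_top] at hlt
      exact lt_irrefl _ hlt
    · obtain ⟨W', rfl⟩ : ∃ W', W = upF W' := ⟨_, eq_upF hle⟩
      rw [dg_upF]
      have := hF _ ((stb_upF _ _ _ _).1 hW)
      linarith

/-- stable triangular equivalence -/
def triRepEquiv : {σ : FRep F s t (fun i => B i × C i) // Stb σ (stdE F B C)} ≃
    FRep F s t B × FRep F s t C × (∀ x, C (s x) →ₗ[F] B (t x)) where
  toFun σ := (fun x => (triEquiv ⟨σ.1 x, fun v hv => mem_stdE.1 (σ.2 x v (mem_stdE.2 hv))⟩).1,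
    fun x => (triEquiv ⟨σ.1 x, fun v hv => mem_stdE.1 (σ.2 x v (mem_stdE.2 hv))⟩).2.1,
    fun x => (triEquiv ⟨σ.1 x, fun v hv => mem_stdE.1 (σ.2 x v (mem_stdE.2 hv))⟩).2.2)
  invFun m := ⟨triRep m.1 m.2.1 m.2.2, fun x v hv =>
    mem_stdE.2 ((triEquiv.symm (m.1 x, m.2.1 x, m.2.2 x)).2 v (mem_stdE.1 hv))⟩
  left_inv σ := by
    apply Subtype.ext
    funext x
    exact congrArg Subtype.val (triEquiv.symm_apply_apply
      ⟨σ.1 x, fun v hv => mem_stdE.1 (σ.2 x v (mem_stdE.2 hv))⟩)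
  right_inv m := by
    obtain ⟨p, r, q⟩ := m
    have h : ∀ x, triEquiv (triEquiv.symm (p x, r x, q x)) = (p x, r x, q x) :=
      fun x => triEquiv.apply_symm_apply _
    refine Prod.ext ?_ (Prod.ext ?_ ?_)
    · funext x; exact congrArg Prod.fst (h x)
    · funext x; exact congrArg (fun m => m.2.1) (h x)
    · funext x; exact congrArg (fun m => m.2.2) (h x)

theorem card_Y [Fintype F] [Fintype Ar] (w : ι → ℚ) :
    (Nat.card {σ : FRep F s t (fun i => B i × C i) | HN w σ (stdE F B C)} : ℚ) =
      Nat.card {p : FRep F s t B // TT w p} * Nat.card {r : FRep F s t C // FF w r} *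
      (Fintype.card F : ℚ) ^ (∑ x, Module.finrank F (C (s x)) * Module.finrank F (B (t x))) := by
  have e : {σ : FRep F s t (fun i => B i × C i) // HN w σ (stdE F B C)} ≃
      {p : FRep F s t B // TT w p} × {r : FRep F s t C // FF w r} ×
        (∀ x, C (s x) →ₗ[F] B (t x)) := by
    refine (Equiv.subtypeEquivRight (q := fun σ => Stb σ (stdE F B C) ∧ HN w σ (stdE F B C))
      fun σ => ⟨fun h => ⟨h.1, h⟩, fun h => h.2⟩).trans ?_
    refine (Equiv.subtypeSubtypeEquivSubtypeInter _ _).symm.trans ?_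
    refine (Equiv.subtypeEquiv (q := fun m => TT w m.1 ∧ FF w m.2.1) triRepEquiv ?_).trans ?_
    · intro σ
      rw [← HN_tri w _ _ (triRepEquiv σ).2.2]
      have : σ.1 = triRep (triRepEquiv σ).1 (triRepEquiv σ).2.1 (triRepEquiv σ).2.2 :=
        congrArg Subtype.val (triRepEquiv.symm_apply_apply σ).symm
      rw [← this]
    · exact
      { toFun := fun m => (⟨m.1.1, m.2.1⟩, ⟨m.1.2.1, m.2.2⟩, m.1.2.2)
        invFun := fun m => ⟨(m.1.1, m.2.1.1, m.2.2), m.1.2, m.2.1.2⟩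
        left_inv := fun m => rfl
        right_inv := fun m => rfl }
  rw [show Nat.card {σ : FRep F s t (fun i => B i × C i) | HN w σ (stdE F B C)} = _ from
    Nat.card_congr e, Nat.card_prod, Nat.card_prod, Nat.card_pi]
  simp only [natCard_hom]
  rw [Finset.prod_pow_eq_pow_sum]
  push_cast
  ring

theorem card_HH [Fintype F] :
    (Nat.card {g : ∀ i, (B i × C i) ≃ₗ[F] (B i × C i) | mpF g (stdE F B C) = stdE F B C} : ℚ) =
      ∏ i, (glq (Fintype.card F) (Module.finrank F (B i)) * glq (Fintype.card F) (Module.finrank F (C i)) *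
        (Fintype.card F : ℚ) ^ (Module.finrank F (B i) * Module.finrank F (C i))) := by
  have e : {g : ∀ i, (B i × C i) ≃ₗ[F] (B i × C i) // mpF g (stdE F B C) = stdE F B C} ≃
      ∀ i, {g : (B i × C i) ≃ₗ[F] (B i × C i) // ∀ v, v.2 = 0 → (g v).2 = 0} := by
    refine (Equiv.subtypeEquivRight ?_).trans (Equiv.subtypePiEquivPi (p := fun i (g : (B i × C i) ≃ₗ[F] (B i × C i)) => ∀ v, v.2 = 0 → (g v).2 = 0))
    intro g
    rw [funext_iff]
    refine forall_congr' fun i => ?_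
    rw [mpF_apply]
    constructor
    · intro h v hv
      rw [← mem_stdE (F := F) (i := i)] at hv ⊢
      rw [← h]; exact Submodule.mem_map_of_mem hv
    · intro h
      refine Submodule.eq_of_le_of_finrank_eq ?_ (LinearEquiv.finrank_map_eq (g i) _)
      rw [Submodule.map_le_iff_le_comap]
      intro v hv
      rw [mem_stdE] at hv
      exact mem_stdE.2 (h v hv)
  rw [show Nat.card {g : ∀ i, (B i × C i) ≃ₗ[F] (B i × C i) | mpF g (stdE F B C) = stdE F B C} = _ from
    Nat.card_congr e, Nat.card_pi]
  push_cast
  exact Finset.prod_congr rfl fun i _ => card_triAut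

end HNcount


/-! ### Part B3: counting semistable representations -/

section HNrec

variable {F : Type} [Field F] {ι Ar : Type} [Fintype ι] {s t : Ar → ι} {V V' : ι → Type}
  [∀ i, AddCommGroup (V i)] [∀ i, Module F (V i)]
  [∀ i, AddCommGroup (V' i)] [∀ i, Module F (V' i)]

/-- standard family of vector spaces -/
abbrev stdV (F : Type) [Field F] {ι : Type} (α : ι → ℕ) : ι → Type := fun i => Fin (α i) → F

/-- has HN subspace of dimension `β` -/
def HNdim (w : ι → ℚ) (β : ι → ℕ) (σ : FRep F s t V) : Prop :=
  ∃ U, HN w σ U ∧ ∀ i, Module.finrank F (U i) = β i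

theorem HNdim_trF (w : ι → ℚ) (β : ι → ℕ) (e : ∀ i, V i ≃ₗ[F] V' i) (σ : FRep F s t V) :
    HNdim w β (trF e σ) ↔ HNdim w β σ := by
  unfold HNdim
  rw [(mpF e).surjective.exists]
  refine exists_congr fun U => ?_
  rw [HN_trF]
  refine and_congr_right fun _ => forall_congr' fun i => ?_
  rw [show Module.finrank F (mpF e U i) = Module.finrank F (U i) from LinearEquiv.finrank_map_eq (e i) (U i)]

/-- transport of counts -/
theorem card_trF (P : FRep F s t V → Prop) (P' : FRep F s t V' → Prop) (e : ∀ i, V i ≃ₗ[F] V' i)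
    (h : ∀ σ, P' (trF e σ) ↔ P σ) : Nat.card {σ // P σ} = Nat.card {σ // P' σ} :=
  Nat.card_congr (Equiv.subtypeEquiv (trFEquiv s t e) fun σ => (h σ).symm)

/-- a linear equivalence with the standard space -/
noncomputable def toStd (F : Type) [Field F] (V : Type) [AddCommGroup V] [Module F V] [Module.Finite F V] {m : ℕ}
    (h : Module.finrank F V = m) : V ≃ₗ[F] (Fin m → F) := LinearEquiv.ofFinrankEq _ _ (by simp [h])

noncomputable def nFF (F : Type) [Field F] (s t : Ar → ι) (w : ι → ℚ) (α : ι → ℕ) : ℕ :=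
  Nat.card {σ : FRep F s t (stdV F α) // FF w σ}
noncomputable def nTT (F : Type) [Field F] (s t : Ar → ι) (w : ι → ℚ) (α : ι → ℕ) : ℕ :=
  Nat.card {σ : FRep F s t (stdV F α) // TT w σ}
noncomputable def nSS (F : Type) [Field F] (s t : Ar → ι) (w : ι → ℚ) (α : ι → ℕ) : ℕ :=
  Nat.card {σ : FRep F s t (stdV F α) // SS w σ}

theorem card_SS [∀ i, Module.Finite F (V i)] (w : ι → ℚ) (α : ι → ℕ) (h : ∀ i, Module.finrank F (V i) = α i) :
    Nat.card {σ : FRep F s t V // SS w σ} = nSS F s t w α :=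
  card_trF _ _ (fun i => toStd F (V i) (h i)) fun σ => SS_trF w _ σ

variable [Fintype F] [Fintype Ar]

instance finFRep [∀ i, Module.Finite F (V i)] : Finite (FRep F s t V) := by
  have : ∀ x, Finite (V (s x) →ₗ[F] V (t x)) := fun x => Module.finite_of_finite F
  infer_instance

theorem trF_mul (g h : ∀ i, V i ≃ₗ[F] V i) (σ : FRep F s t V) :
    trF g (trF h σ) = trF (g * h) σ := rfl

theorem trF_one (σ : FRep F s t V) : trF (1 : ∀ i, V i ≃ₗ[F] V i) σ = σ := rfl

instance finAut {V : Type} [AddCommGroup V] [Module F V] [Module.Finite F V] : Finite (V ≃ₗ[F] V) := by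
  have : Finite (V →ₗ[F] V) := Module.finite_of_finite F
  exact Finite.of_injective (fun e : V ≃ₗ[F] V => e.toLinearMap) LinearEquiv.toLinearMap_injective

theorem card_GLpi [∀ i, Module.Finite F (V i)] (α : ι → ℕ) (h : ∀ i, Module.finrank F (V i) = α i) :
    (Nat.card (∀ i, V i ≃ₗ[F] V i) : ℚ) = ∏ i, glq (Fintype.card F) (α i) := by
  rw [Nat.card_pi]; push_cast
  exact Finset.prod_congr rfl fun i _ => natCard_equiv_gl F (V i) (h i)

/-- one stratum -/
theorem card_HNdim (w : ι → ℚ) (β γ α : ι → ℕ) (hα : ∀ i, α i = β i + γ i) :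
    (Nat.card {σ : FRep F s t (stdV F α) // HNdim w β σ} : ℚ) *
      (∏ i, (glq (Fintype.card F) (β i) * glq (Fintype.card F) (γ i) * (Fintype.card F : ℚ) ^ (β i * γ i))) =
    (∏ i, glq (Fintype.card F) (α i)) * (nTT F s t w β * nFF F s t w γ *
      (Fintype.card F : ℚ) ^ (∑ x, γ (s x) * β (t x))) := by
  let D : ι → Type := fun i => (Fin (β i) → F) × (Fin (γ i) → F)
  have hD : ∀ i, Module.finrank F (D i) = α i := fun i => by
    simp [D, Module.finrank_prod, hα]
  have hE : ∀ i, Module.finrank F (stdE F (stdV F β) (stdV F γ) i) = β i := by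
    intro i
    have h1 := finrank_map_inf_ker (LinearMap.inl F (Fin (β i) → F) (Fin (γ i) → F)) ⊤
    have h2 : (loF (⊤ : ∀ i, Submodule F (stdV F β i)) : ∀ i, Submodule F (stdV F β i × stdV F γ i)) i
      = stdE F (stdV F β) (stdV F γ) i := by rw [loF_top]
    rw [LinearMap.ker_eq_bot.2 LinearMap.inl_injective, inf_bot_eq, finrank_bot, add_zero, finrank_top,
      Module.finrank_fin_fun] at h1
    rw [← h2]; exact h1.symm
  have h0 : Nat.card {σ : FRep F s t (stdV F α) // HNdim w β σ} = Nat.card {σ : FRep F s t D // HNdim w β σ} :=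
    (card_trF _ _ (fun i => toStd F (D i) (hD i)) fun σ => HNdim_trF w β _ σ).symm
  have key := groupoid_count (G := ∀ i, D i ≃ₗ[F] D i) (X := FRep F s t D) (fun g σ => trF g σ)
    trF_mul trF_one {σ | HNdim w β σ} {σ | HN w σ (stdE F (stdV F β) (stdV F γ))}
    {g | mpF g (stdE F (stdV F β) (stdV F γ)) = stdE F (stdV F β) (stdV F γ)} ?_ ?_ ?_
  · have key' := congrArg (Nat.cast (R := ℚ)) key
    push_cast at key'
    have e1 := card_HH (F := F) (B := stdV F β) (C := stdV F γ)
    have e2 := card_Y (F := F) (B := stdV F β) (C := stdV F γ) (s := s) (t := t) w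
    have e3 := card_GLpi (V := D) α hD
    rw [e1, e2, e3] at key'
    simp only [Module.finrank_fin_fun] at key'
    rw [h0]
    exact key'
  · rintro σ ⟨U, hU, hd⟩
    have : ∀ i, ∃ g : D i ≃ₗ[F] D i, (stdE F (stdV F β) (stdV F γ) i).map g.toLinearMap = U i := by
      intro i
      obtain ⟨U', hU'⟩ := Submodule.exists_isCompl (U i)
      obtain ⟨E', hE'⟩ := Submodule.exists_isCompl (stdE F (stdV F β) (stdV F γ) i)
      have hd1 : Module.finrank F (stdE F (stdV F β) (stdV F γ) i) = Module.finrank F (U i) := by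
        rw [hE, hd]
      have hd2 : Module.finrank F E' = Module.finrank F U' := by
        have a1 := Submodule.finrank_add_eq_of_isCompl hU'
        have a2 := Submodule.finrank_add_eq_of_isCompl hE'
        change _ = Module.finrank F (D i) at a2
        omega
      let e1 := LinearEquiv.ofFinrankEq _ _ hd1
      let e2 := LinearEquiv.ofFinrankEq _ _ hd2
      refine ⟨(Submodule.prodEquivOfIsCompl _ _ hE').symm.trans
        ((LinearEquiv.prodCongr e1 e2).trans (Submodule.prodEquivOfIsCompl _ _ hU')), ?_⟩
      refine Submodule.eq_of_le_of_finrank_eq ?_ ?_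
      · rintro _ ⟨v, hv, rfl⟩
        have := Submodule.prodEquivOfIsCompl_symm_apply_left _ _ hE' ⟨v, hv⟩
        simp only [LinearEquiv.coe_coe, LinearEquiv.trans_apply]
        rw [this]
        simp
      · rw [LinearEquiv.finrank_map_eq, hd1]
    choose g hg using this
    refine ⟨g, trF (fun i => (g i).symm) σ, ?_, ?_⟩
    · have : mpF (fun i => (g i).symm) U = stdE F (stdV F β) (stdV F γ) := by
        have h2 : U = mpF g (stdE F (stdV F β) (stdV F γ)) := funext fun i => (hg i).symm
        rw [h2]; exact (mpF g).symm_apply_apply _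
      change HN _ _ _
      rw [← this, HN_trF]; exact hU
    · exact (trFEquiv s t g).right_inv σ
  · intro σ hσ g
    exact (HNdim_trF w β g σ).2 ⟨_, hσ, hE⟩
  · intro σ hσ g
    have h1 : HN w (trF g σ) (mpF g (stdE F (stdV F β) (stdV F γ))) := (HN_trF w g σ _).2 hσ
    constructor
    · intro h; exact HN_unique h1 h
    · intro h; rw [← Set.mem_setOf.1 h]
      change HN _ _ _
      rw [HN_trF]; exact hσ

theorem sum_HNdim (w : ι → ℚ) (α : ι → ℕ) :
    Nat.card (FRep F s t (stdV F α)) = ∑ β ∈ Finset.Icc 0 α, Nat.card {σ : FRep F s t (stdV F α) // HNdim w β σ} := by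
  have := Fintype.ofFinite (FRep F s t (stdV F α))
  choose U hU using fun σ : FRep F s t (stdV F α) => HN_exists w σ
  rw [Nat.card_eq_fintype_card, ← Finset.card_univ,
    Finset.card_eq_sum_card_fiberwise (f := fun σ => fun i => Module.finrank F (U σ i)) (t := Finset.Icc 0 α)]
  · refine Finset.sum_congr rfl fun β _ => ?_
    rw [Nat.card_eq_fintype_card, Fintype.card_subtype]
    congr 1
    ext σ
    simp only [Finset.mem_filter, Finset.mem_univ, true_and]
    constructor
    · intro h; exact ⟨_, hU σ, fun i => congrFun h i⟩
    · rintro ⟨U', h1, h2⟩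
      rw [HN_unique (hU σ) h1]; exact funext h2
  · intro σ _
    simp only [Finset.coe_Icc, Set.mem_Icc]
    refine ⟨fun i => Nat.zero_le _, fun i => ?_⟩
    have := Submodule.finrank_le (U σ i)
    simpa using this

theorem nFF_zero (w : ι → ℚ) : nFF F s t w 0 = 1 := by
  have : Subsingleton (FRep F s t (stdV F (0 : ι → ℕ))) := ⟨fun a b => by
    funext x; ext v i; exact i.elim0⟩
  rw [nFF, Nat.card_eq_one_iff_unique]
  refine ⟨inferInstance, ⟨0, fun W _ => ?_⟩⟩
  have : W = ⊥ := by
    funext i; ext v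
    have : v = 0 := by ext i; exact i.elim0
    simp [this]
  rw [this, dg_bot]

theorem nTT_zero (w : ι → ℚ) : nTT F s t w 0 = 1 := by
  have : Subsingleton (FRep F s t (stdV F (0 : ι → ℕ))) := ⟨fun a b => by
    funext x; ext v i; exact i.elim0⟩
  rw [nTT, Nat.card_eq_one_iff_unique]
  refine ⟨inferInstance, ⟨0, fun W _ hW => ?_⟩⟩
  refine absurd ?_ hW
  funext i; ext v
  have : v = 0 := by ext i; exact i.elim0
  simp [this]

theorem HNrec_eq (w : ι → ℚ) (α : ι → ℕ) (hα : α ≠ 0) :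
    (Fintype.card F : ℚ) ^ (∑ x, α (s x) * α (t x)) = nFF F s t w α + nTT F s t w α +
      ∑ β ∈ ((Finset.Icc 0 α).erase 0).erase α,
        (∏ i, glq (Fintype.card F) (α i)) * (nTT F s t w β * nFF F s t w (α - β) *
          (Fintype.card F : ℚ) ^ (∑ x, (α - β) (s x) * β (t x))) /
      (∏ i, (glq (Fintype.card F) (β i) * glq (Fintype.card F) ((α - β) i) *
        (Fintype.card F : ℚ) ^ (β i * (α - β) i))) := by
  have hq : 2 ≤ Fintype.card F := Fintype.one_lt_card
  have hq0 : (Fintype.card F : ℚ) ≠ 0 := by positivity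
  have h := sum_HNdim (F := F) (s := s) (t := t) w α
  have h1 : Nat.card (FRep F s t (stdV F α)) = Fintype.card F ^ (∑ x, α (s x) * α (t x)) := by
    rw [Nat.card_pi, ← Finset.prod_pow_eq_pow_sum]
    refine Finset.prod_congr rfl fun x _ => ?_
    rw [natCard_hom]; simp
  rw [h1] at h
  have h' := congrArg (Nat.cast (R := ℚ)) h
  push_cast at h'
  have m0 : (0 : ι → ℕ) ∈ Finset.Icc 0 α := by simp
  have mα : α ∈ (Finset.Icc 0 α).erase 0 := by simp [hα, pos_iff_ne_zero]
  have hgl : ∀ β : ι → ℕ, ∏ i, glq (Fintype.card F) (β i) ≠ 0 := fun β =>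
    Finset.prod_ne_zero_iff.2 fun i _ => glq_ne_zero hq _
  have hg0 : glq (Fintype.card F) 0 = 1 := by simp [glq]
  rw [h', ← Finset.add_sum_erase _ _ m0, ← Finset.add_sum_erase _ _ mα, ← add_assoc]
  congr 1
  · congr 1
    · have := card_HNdim (F := F) (s := s) (t := t) w 0 α α (by simp)
      rw [nTT_zero] at this
      simp [hg0] at this
      rw [mul_comm] at this
      exact mul_left_cancel₀ (hgl α) this
    · have := card_HNdim (F := F) (s := s) (t := t) w α 0 α (by simp)
      rw [nFF_zero] at this
      simp [hg0] at this
      rw [mul_comm] at this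
      exact mul_left_cancel₀ (hgl α) this
  · refine Finset.sum_congr rfl fun β hβ => ?_
    have hle : β ≤ α := (Finset.mem_Icc.1 (Finset.mem_of_mem_erase (Finset.mem_of_mem_erase hβ))).2
    rw [eq_div_iff]
    · exact card_HNdim w β (α - β) α (fun i => by have h5 : β i ≤ α i := hle i; simp only [Pi.sub_apply]; omega)
    · refine Finset.prod_ne_zero_iff.2 fun i _ => ?_
      exact mul_ne_zero (mul_ne_zero (glq_ne_zero hq _) (glq_ne_zero hq _)) (pow_ne_zero _ hq0)

theorem nFF_pos (w : ι → ℚ) (α : ι → ℕ) (h : 0 < ∑ i, w i * (α i : ℚ)) : nFF F s t w α = 0 := by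
  rw [nFF, Nat.card_eq_zero]
  left
  refine ⟨fun σ => ?_⟩
  have := σ.2 ⊤ Stb.top
  rw [dg_top] at this
  simp at this
  linarith

theorem nTT_neg (w : ι → ℚ) (α : ι → ℕ) (hα : α ≠ 0) (h : ∑ i, w i * (α i : ℚ) ≤ 0) : nTT F s t w α = 0 := by
  rw [nTT, Nat.card_eq_zero]
  left
  refine ⟨fun σ => ?_⟩
  have := σ.2 ⊥ Stb.bot ?_
  · rw [dg_top, dg_bot] at this
    simp at this
    linarith
  · intro h
    apply hα
    funext i
    have h1 : Module.finrank F (⊥ : Submodule F (Fin (α i) → F)) = Module.finrank F (⊤ : Submodule F (Fin (α i) → F)) := by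
      rw [show (⊥ : Submodule F (Fin (α i) → F)) = ⊤ from congrFun h i]
    simp at h1
    simp [← h1]

end HNrec

theorem rat_FT {ι Ar : Type} [Fintype ι] [Fintype Ar] (s t : Ar → ι) (w : ι → ℚ) (α : ι → ℕ) :
    ∃ rF ∈ ratS, ∃ rT ∈ ratS, ∀ (F : Type) [Field F] [Fintype F],
      (nFF F s t w α : ℚ) = rF (Fintype.card F) ∧ (nTT F s t w α : ℚ) = rT (Fintype.card F) := by
  induction α using WellFoundedLT.induction with
  | _ α ih =>
  by_cases hα : α = 0
  · subst hα
    refine ⟨_, ratS_const 1, _, ratS_const 1, fun F _ _ => ?_⟩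
    simp [nFF_zero, nTT_zero]
  choose! rF hF rT hT hr using ih
  let r : ℕ → ℚ := fun q => (q : ℚ) ^ (∑ x, α (s x) * α (t x)) -
      ∑ β ∈ ((Finset.Icc 0 α).erase 0).erase α,
        (∏ i, glq q (α i)) * (rT β q * rF (α - β) q *
          (q : ℚ) ^ (∑ x, (α - β) (s x) * β (t x))) /
      (∏ i, (glq q (β i) * glq q ((α - β) i) *
        (q : ℚ) ^ (β i * (α - β) i)))
  have hlt : ∀ β ∈ ((Finset.Icc 0 α).erase 0).erase α, β < α ∧ α - β < α := by
    intro β hβ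
    simp only [Finset.mem_erase, Finset.mem_Icc] at hβ
    refine ⟨lt_of_le_of_ne hβ.2.2.2 hβ.1, lt_of_le_of_ne (fun i => Nat.sub_le _ _) ?_⟩
    intro h
    apply hβ.2.1
    funext i
    have h1 := congrFun h i
    have h2 : β i ≤ α i := hβ.2.2.2 i
    simp only [Pi.sub_apply, Pi.zero_apply] at h1 ⊢
    omega
  have hrr : r ∈ ratS := by
    refine ratS_sub (ratS_pow _) (ratS_sum _ fun β hβ => ?_)
    refine ratS_div ?_ ?_ ?_
    · exact ratS_mul (ratS_prod _ fun i _ => ratS_glq _)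
        (ratS_mul (ratS_mul (hT β (hlt β hβ).1) (hF _ (hlt β hβ).2)) (ratS_pow _))
    · exact ratS_prod _ fun i _ => ratS_mul (ratS_mul (ratS_glq _) (ratS_glq _)) (ratS_pow _)
    · intro q hq
      refine Finset.prod_ne_zero_iff.2 fun i _ => ?_
      exact mul_ne_zero (mul_ne_zero (glq_ne_zero hq _) (glq_ne_zero hq _)) (pow_ne_zero _ (by positivity))
  have hsum : ∀ (F : Type) [Field F] [Fintype F],
      (nFF F s t w α + nTT F s t w α : ℚ) = r (Fintype.card F) := by
    intro F _ _
    have h := HNrec_eq (F := F) (s := s) (t := t) w α hα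
    simp only [r]
    rw [h, eq_sub_iff_add_eq]
    congr 1
    refine Finset.sum_congr rfl fun β hβ => ?_
    rw [(hr β (hlt β hβ).1 F).2, (hr _ (hlt β hβ).2 F).1]
  by_cases h : 0 < ∑ i, w i * (α i : ℚ)
  · refine ⟨_, ratS_const 0, r, hrr, fun F _ _ => ?_⟩
    rw [← hsum, nFF_pos w α h]; simp
  · refine ⟨r, hrr, _, ratS_const 0, fun F _ _ => ?_⟩
    rw [← hsum, nTT_neg w α hα (not_lt.1 h)]; simp

theorem rat_SS {ι Ar : Type} [Fintype ι] [Fintype Ar] (s t : Ar → ι) (w : ι → ℚ) (α : ι → ℕ) :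
    ∃ r ∈ ratS, ∀ (F : Type) [Field F] [Fintype F], (nSS F s t w α : ℚ) = r (Fintype.card F) := by
  obtain ⟨rF, hF, rT, hT, hr⟩ := rat_FT s t w α
  by_cases h : ∑ i, w i * (α i : ℚ) = 0
  · refine ⟨rF, hF, fun F _ _ => ?_⟩
    rw [← (hr F).1, nSS, nFF]
    congr 1
    refine Nat.card_congr (Equiv.subtypeEquivRight fun σ => ?_)
    simp [SS, FF, dg_top, h]
  · refine ⟨_, ratS_const 0, fun F _ _ => ?_⟩
    rw [nSS, Nat.cast_eq_zero, Nat.card_eq_zero]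
    left
    refine ⟨fun σ => h ?_⟩
    have := σ.2.1
    rw [dg_top] at this
    simpa using this


/-! ### Part C1: modules over `F[X]` primary at an irreducible polynomial -/

section Qm

variable {F : Type} [Field F] (p : Polynomial F)

/-- the quotient `F[X]/(p^a)` -/
abbrev Qm (a : ℕ) : Type := Polynomial F ⧸ Ideal.span {p ^ a}

theorem Qm_mk_eq_zero (a : ℕ) (x : Polynomial F) :
    (Ideal.Quotient.mk (Ideal.span {p ^ a}) x : Qm p a) = 0 ↔ p ^ a ∣ x := by
  rw [Ideal.Quotient.eq_zero_iff_dvd]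

theorem Qm_smul_mk (a : ℕ) (c x : Polynomial F) :
    c • (Ideal.Quotient.mk (Ideal.span {p ^ a}) x : Qm p a) = Ideal.Quotient.mk _ (c * x) := rfl

theorem Qm_pow_smul (a : ℕ) (v : Qm p a) : p ^ a • v = 0 := by
  obtain ⟨x, rfl⟩ := Ideal.Quotient.mk_surjective v
  rw [Qm_smul_mk, Qm_mk_eq_zero]; exact dvd_mul_right _ _

/-- multiplication by `p^(b-a)` from `F[X]/p^a` to `F[X]/p^b` -/
noncomputable def uu (a b : ℕ) (h : a ≤ b) : Qm p a →ₗ[Polynomial F] Qm p b :=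
  Submodule.mapQ (Ideal.span {p ^ a}) (Ideal.span {p ^ b}) (LinearMap.lsmul (Polynomial F) (Polynomial F) (p ^ (b - a))) (by
    rw [Ideal.span, Submodule.span_le, Set.singleton_subset_iff]
    change p ^ (b - a) * p ^ a ∈ Ideal.span {p ^ b}
    rw [← pow_add, Nat.sub_add_cancel h]
    exact Ideal.mem_span_singleton_self _)

theorem uu_mk (a b : ℕ) (h : a ≤ b) (x : Polynomial F) :
    uu p a b h (Ideal.Quotient.mk _ x) = Ideal.Quotient.mk _ (p ^ (b - a) * x) := rfl

variable [hp : Fact (Irreducible p)]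

theorem pow_ne (k : ℕ) : p ^ k ≠ 0 := pow_ne_zero _ hp.out.ne_zero

theorem uu_injective (a b : ℕ) (h : a ≤ b) : Function.Injective (uu p a b h) := by
  rw [injective_iff_map_eq_zero]
  intro v hv
  obtain ⟨x, rfl⟩ := Ideal.Quotient.mk_surjective v
  rw [uu_mk, Qm_mk_eq_zero] at hv
  rw [Qm_mk_eq_zero]
  have : p ^ b = p ^ (b - a) * p ^ a := by rw [← pow_add, Nat.sub_add_cancel h]
  rw [this] at hv
  exact (mul_dvd_mul_iff_left (pow_ne p _)).1 hv

theorem uu_range (a b : ℕ) (h : a ≤ b) (v : Qm p b) : p ^ a • v = 0 ↔ ∃ y, uu p a b h y = v := by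
  constructor
  · intro hv
    obtain ⟨x, rfl⟩ := Ideal.Quotient.mk_surjective v
    rw [Qm_smul_mk, Qm_mk_eq_zero] at hv
    have : p ^ b = p ^ a * p ^ (b - a) := by rw [← pow_add, Nat.add_sub_cancel' h]
    rw [this] at hv
    obtain ⟨y, rfl⟩ := (mul_dvd_mul_iff_left (pow_ne p _)).1 hv
    exact ⟨Ideal.Quotient.mk _ y, rfl⟩
  · rintro ⟨y, rfl⟩
    rw [← map_smul, Qm_pow_smul, map_zero]

theorem Qm_finite_dim (a : ℕ) : Module.Finite F (Qm p a) := by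
  have : p ^ a ≠ 0 := pow_ne p a
  exact Module.Finite.of_basis (AdjoinRoot.powerBasis this).basis

theorem Qm_finrank (a : ℕ) : Module.finrank F (Qm p a) = a * p.natDegree := by
  rw [finrank_quotient_span_eq_natDegree, Polynomial.natDegree_pow]

instance instQmFin (a : ℕ) : Module.Finite F (Qm p a) := Qm_finite_dim p a

noncomputable instance instQmField : Field (Qm p 1) :=
  @Ideal.Quotient.field _ _ (Ideal.span {p ^ 1}) (by
    rw [pow_one]
    exact PrincipalIdealRing.isMaximal_of_irreducible hp.out)

instance instQmFinite [Finite F] (a : ℕ) : Finite (Qm p a) := Module.finite_of_finite F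

noncomputable instance instQmFintype [Finite F] (a : ℕ) : Fintype (Qm p a) := Fintype.ofFinite _

theorem Qm_card [Fintype F] (a : ℕ) : Nat.card (Qm p a) = Fintype.card F ^ (a * p.natDegree) := by
  rw [Module.natCard_eq_pow_finrank (K := F), Qm_finrank, Nat.card_eq_fintype_card]

theorem Qm_fcard [Fintype F] : Fintype.card (Qm p 1) = Fintype.card F ^ p.natDegree := by
  rw [← Nat.card_eq_fintype_card, Qm_card, one_mul]

/-- homs out of a cyclic module -/
noncomputable def homQm (a : ℕ) (M : Type) [AddCommGroup M] [Module (Polynomial F) M] :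
    (Qm p a →ₗ[Polynomial F] M) ≃ {v : M // p ^ a • v = 0} where
  toFun f := ⟨f (Ideal.Quotient.mk _ 1), by
    rw [← map_smul, Qm_pow_smul, map_zero]⟩
  invFun v := Submodule.liftQ (Ideal.span {p ^ a}) (LinearMap.toSpanSingleton (Polynomial F) M v.1) (by
    rw [Ideal.span, Submodule.span_le, Set.singleton_subset_iff]
    exact v.2)
  left_inv f := by
    apply LinearMap.ext
    intro x
    obtain ⟨x, rfl⟩ := Ideal.Quotient.mk_surjective x
    change x • f _ = _
    rw [← map_smul, Qm_smul_mk, mul_one]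
  right_inv v := by
    apply Subtype.ext
    change (1 : Polynomial F) • v.1 = v.1
    rw [one_smul]

theorem card_homQm [Fintype F] (a b : ℕ) :
    Nat.card (Qm p a →ₗ[Polynomial F] Qm p b) = Fintype.card F ^ (min a b * p.natDegree) := by
  rw [Nat.card_congr (homQm p a (Qm p b))]
  rcases le_total a b with h | h
  · rw [min_eq_left h, ← Qm_card]
    symm
    refine Nat.card_congr (Equiv.ofBijective (fun y => ⟨uu p a b h y, (uu_range p a b h _).2 ⟨y, rfl⟩⟩) ⟨?_, ?_⟩)
    · intro y y' hy
      exact uu_injective p a b h (congrArg Subtype.val hy)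
    · rintro ⟨v, hv⟩
      obtain ⟨y, hy⟩ := (uu_range p a b h v).1 hv
      exact ⟨y, Subtype.ext hy⟩
  · rw [min_eq_right h, ← Qm_card]
    refine Nat.card_congr (Equiv.subtypeUnivEquiv fun v => ?_)
    have : p ^ a = p ^ (a - b) * p ^ b := by rw [← pow_add, Nat.sub_add_cancel h]
    rw [this, mul_smul, Qm_pow_smul, smul_zero]

end Qm

section DD

variable {F : Type} [Field F] (p : Polynomial F) {N : ℕ}

/-- the model module of type `m` -/
abbrev DD (m : Fin N → ℕ) : Type := ∀ k : Fin N, Fin (m k) → Qm p (k.1 + 1)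

/-- the socle -/
abbrev LL (m : Fin N → ℕ) : Type := ∀ k : Fin N, Fin (m k) → Qm p 1

/-- the inclusion of the socle -/
noncomputable def JJ (m : Fin N → ℕ) : LL p m →ₗ[Polynomial F] DD p m where
  toFun v k i := uu p 1 (k.1 + 1) (Nat.le_add_left _ _) (v k i)
  map_add' v v' := by funext k i; simp
  map_smul' c v := by funext k i; simp

theorem JJ_apply (m : Fin N → ℕ) (v : LL p m) (k i) :
    JJ p m v k i = uu p 1 (k.1 + 1) (Nat.le_add_left _ _) (v k i) := rfl

theorem LL_smul {m : Fin N → ℕ} (v : LL p m) : p • v = 0 := by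
  funext k i
  have h1 := Qm_pow_smul p 1 (v k i)
  have h2 : p • v k i = p ^ 1 • v k i := congrArg (fun c : Polynomial F => c • v k i) (pow_one p).symm
  exact h2.trans h1

variable [hp : Fact (Irreducible p)]

theorem JJ_injective (m : Fin N → ℕ) : Function.Injective (JJ p m) := by
  intro v v' h
  funext k i
  exact uu_injective p 1 (k.1 + 1) (Nat.le_add_left _ _) (congrFun (congrFun h k) i)

theorem JJ_range (m : Fin N → ℕ) (v : DD p m) : v ∈ LinearMap.range (JJ p m) ↔ p • v = 0 := by
  constructor
  · rintro ⟨y, rfl⟩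
    rw [← map_smul, LL_smul, map_zero]
  · intro h
    have : ∀ k i, ∃ y, uu p 1 (k.1 + 1) (Nat.le_add_left _ _) y = v k i := by
      intro k i
      rw [← uu_range]
      refine Eq.trans (congrArg (fun c : Polynomial F => c • v k i) (pow_one p)) ?_
      exact congrFun (congrFun h k) i
    choose y hy using this
    exact ⟨y, funext fun k => funext fun i => hy k i⟩

/-- `v` in the socle lies in `p^j D` iff its components below `j` vanish -/
theorem JJ_pow (m : Fin N → ℕ) (v : LL p m) (j : ℕ) :
    (∃ y : DD p m, p ^ j • y = JJ p m v) ↔ ∀ k : Fin N, k.1 < j → v k = 0 := by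
  constructor
  · rintro ⟨y, hy⟩ k hk
    funext i
    apply uu_injective p 1 (k.1 + 1) (Nat.le_add_left _ _)
    rw [← JJ_apply, ← hy]
    refine Eq.trans ?_ (map_zero _).symm
    change p ^ j • (y k i) = 0
    have : p ^ j = p ^ (j - (k.1 + 1)) * p ^ (k.1 + 1) := by rw [← pow_add, Nat.sub_add_cancel hk]
    rw [this, mul_smul, Qm_pow_smul, smul_zero]
  · intro h
    have : ∀ (k : Fin N) (i : Fin (m k)), ∃ y : Qm p (k.1 + 1), p ^ j • y = JJ p m v k i := by
      intro k i
      by_cases hk : k.1 < j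
      · refine ⟨0, ?_⟩
        rw [JJ_apply, h k hk]; simp
      · obtain ⟨x, hx⟩ := Ideal.Quotient.mk_surjective (v k i)
        refine ⟨Ideal.Quotient.mk _ (p ^ (k.1 - j) * x), ?_⟩
        rw [JJ_apply, ← hx, uu_mk, Qm_smul_mk, ← mul_assoc, ← pow_add]
        congr 3
        omega
    choose y hy using this
    exact ⟨y, funext fun k => funext fun i => hy k i⟩

variable {m m' m'' : Fin N → ℕ}

/-- the induced map on socles -/
noncomputable def fJ (f : DD p m →ₗ[Polynomial F] DD p m') : LL p m →ₗ[Polynomial F] LL p m' :=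
  (LinearEquiv.ofInjective (JJ p m') (JJ_injective p m')).symm.toLinearMap ∘ₗ
    LinearMap.codRestrict (LinearMap.range (JJ p m')) (f ∘ₗ JJ p m) (fun v => by
      rw [JJ_range, LinearMap.comp_apply, ← map_smul, ← map_smul, LL_smul, map_zero, map_zero])

theorem JJ_fJ (f : DD p m →ₗ[Polynomial F] DD p m') (v : LL p m) :
    JJ p m' (fJ p f v) = f (JJ p m v) := by
  have h := (LinearEquiv.ofInjective (JJ p m') (JJ_injective p m')).apply_symm_apply
    (LinearMap.codRestrict (LinearMap.range (JJ p m')) (f ∘ₗ JJ p m) (fun v => by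
      rw [JJ_range, LinearMap.comp_apply, ← map_smul, ← map_smul, LL_smul, map_zero, map_zero]) v)
  exact congrArg Subtype.val h

/-- triangularity -/
theorem fJ_tri (f : DD p m →ₗ[Polynomial F] DD p m') (v : LL p m) (j : ℕ)
    (h : ∀ k : Fin N, k.1 < j → v k = 0) : ∀ k : Fin N, k.1 < j → fJ p f v k = 0 := by
  rw [← JJ_pow] at h ⊢
  obtain ⟨y, hy⟩ := h
  refine ⟨f y, ?_⟩
  rw [JJ_fJ, ← hy, map_smul]

theorem algMap_surj : Function.Surjective (algebraMap (Polynomial F) (Qm p 1)) :=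
  Ideal.Quotient.mk_surjective

instance : IsScalarTower (Polynomial F) (Qm p 1) (Qm p 1) := inferInstance

/-- the diagonal blocks -/
noncomputable def del (f : DD p m →ₗ[Polynomial F] DD p m') (k : Fin N) :
    (Fin (m k) → Qm p 1) →ₗ[Qm p 1] (Fin (m' k) → Qm p 1) :=
  LinearMap.extendScalarsOfSurjective (algMap_surj p)
    (LinearMap.proj k ∘ₗ fJ p f ∘ₗ LinearMap.single (Polynomial F) (fun k : Fin N => Fin (m k) → Qm p 1) k)

theorem del_apply (f : DD p m →ₗ[Polynomial F] DD p m') (k : Fin N) (c) :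
    del p f k c = fJ p f (Pi.single k c) k := rfl

theorem fJ_diag (f : DD p m →ₗ[Polynomial F] DD p m') (k : Fin N) (v : LL p m)
    (h : ∀ l : Fin N, l.1 < k.1 → v l = 0) : fJ p f v k = del p f k (v k) := by
  rw [del_apply, ← sub_eq_zero, ← Pi.sub_apply, ← map_sub]
  refine fJ_tri p f _ (k.1 + 1) ?_ k (Nat.lt_succ_self _)
  intro l hl
  by_cases hlk : l = k
  · subst hlk; simp
  · have : l.1 < k.1 := by
      have : l.1 ≠ k.1 := fun e => hlk (Fin.ext e)
      omega
    simp [h l this, hlk]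

theorem fJ_add (f g : DD p m →ₗ[Polynomial F] DD p m') : fJ p (f + g) = fJ p f + fJ p g := by
  refine LinearMap.ext fun v => ?_
  apply JJ_injective p m'
  simp [JJ_fJ]

theorem fJ_comp (f : DD p m' →ₗ[Polynomial F] DD p m'') (g : DD p m →ₗ[Polynomial F] DD p m') :
    fJ p (f ∘ₗ g) = fJ p f ∘ₗ fJ p g := by
  refine LinearMap.ext fun v => ?_
  apply JJ_injective p m''
  simp [JJ_fJ]

theorem fJ_id : fJ p (LinearMap.id : DD p m →ₗ[Polynomial F] DD p m) = LinearMap.id := by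
  refine LinearMap.ext fun v => ?_
  apply JJ_injective p m
  simp [JJ_fJ]

theorem del_id (k : Fin N) : del p (LinearMap.id : DD p m →ₗ[Polynomial F] DD p m) k = LinearMap.id := by
  refine LinearMap.ext fun c => ?_
  rw [del_apply, fJ_id]; simp

theorem del_comp (f : DD p m' →ₗ[Polynomial F] DD p m'') (g : DD p m →ₗ[Polynomial F] DD p m') (k : Fin N) :
    del p (f ∘ₗ g) k = del p f k ∘ₗ del p g k := by
  refine LinearMap.ext fun c => ?_
  rw [LinearMap.comp_apply, del_apply, fJ_comp, LinearMap.comp_apply, fJ_diag]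
  · rfl
  · apply fJ_tri
    intro l hl
    have : l ≠ k := fun e => by subst e; exact lt_irrefl _ hl
    simp [this]

/-- the diagonal as additive hom -/
noncomputable def delH (m m' : Fin N → ℕ) : (DD p m →ₗ[Polynomial F] DD p m') →+
    (∀ k : Fin N, (Fin (m k) → Qm p 1) →ₗ[Qm p 1] (Fin (m' k) → Qm p 1)) :=
  AddMonoidHom.mk' (fun f k => del p f k) (fun f g => by
    funext k; refine LinearMap.ext fun c => ?_
    rw [del_apply, fJ_add]; rfl)

theorem delH_surjective (m m' : Fin N → ℕ) : Function.Surjective (delH p m m') := by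
  intro M
  have : ∀ (k : Fin N) (i : Fin (m' k)) (j : Fin (m k)), ∃ a : Polynomial F,
      algebraMap (Polynomial F) (Qm p 1) a = M k (Pi.single j 1) i := fun k i j => algMap_surj p _
  choose A hA using this
  let f : DD p m →ₗ[Polynomial F] DD p m' :=
    { toFun := fun v k i => ∑ j, A k i j • v k j
      map_add' := fun v v' => by funext k i; simp [Finset.sum_add_distrib]
      map_smul' := fun c v => by
        funext k i
        simp only [Pi.smul_apply, RingHom.id_apply, Finset.smul_sum]
        exact Finset.sum_congr rfl fun j _ => smul_comm _ _ _ }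
  refine ⟨f, ?_⟩
  funext k
  refine LinearMap.ext fun c => ?_
  change fJ p f (Pi.single k c) k = M k c
  have key : fJ p f (Pi.single k c) = Pi.single k (M k c) := by
    apply JJ_injective p m'
    rw [JJ_fJ]
    funext l i
    change ∑ j, A l i j • JJ p m (Pi.single k c) l j = _
    simp only [JJ_apply, ← map_smul, ← map_sum]
    congr 1
    by_cases hl : l = k
    · subst hl
      simp only [Pi.single_eq_same]
      have h1 : M l c = M l (∑ j, c j • Pi.single j 1) := by
        congr 1
        funext j
        simp [Finset.sum_apply, Pi.single_apply]
      rw [h1, map_sum, Finset.sum_apply]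
      refine Finset.sum_congr rfl fun j _ => ?_
      rw [map_smul, Pi.smul_apply, ← hA, Algebra.smul_def, smul_eq_mul, mul_comm]
    · simp [hl]
  rw [key]; simp

end DD


/-! ### Part C2: counting homs and automorphisms, types -/

section CardHom

variable {R : Type} [CommRing R]

theorem card_hom_pi_right {ι : Type} [Fintype ι] (X : Type) [AddCommGroup X] [Module R X] (Y : ι → Type)
    [∀ i, AddCommGroup (Y i)] [∀ i, Module R (Y i)] :
    Nat.card (X →ₗ[R] (∀ i, Y i)) = ∏ i, Nat.card (X →ₗ[R] Y i) := by
  rw [← Nat.card_pi]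
  exact Nat.card_congr
    { toFun := fun f i => LinearMap.proj i ∘ₗ f
      invFun := fun f => LinearMap.pi f
      left_inv := fun f => rfl
      right_inv := fun f => rfl }

theorem card_hom_pi_left {ι : Type} [Fintype ι] (X : Type) [AddCommGroup X] [Module R X] (Y : ι → Type)
    [∀ i, AddCommGroup (Y i)] [∀ i, Module R (Y i)] :
    Nat.card ((∀ i, Y i) →ₗ[R] X) = ∏ i, Nat.card (Y i →ₗ[R] X) := by
  rw [← Nat.card_pi]
  exact Nat.card_congr (LinearMap.lsum R Y R (M := X)).symm.toEquiv

end CardHom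

/-- counting through a surjective additive map -/
theorem card_preimage_surj {A B : Type} [AddGroup A] [AddGroup B] [Finite A] (δ : A →+ B)
    (hδ : Function.Surjective δ) (P : B → Prop) :
    Nat.card {a // P (δ a)} * Nat.card B = Nat.card A * Nat.card {b // P b} := by
  have hB : Finite B := Finite.of_surjective _ hδ
  have key : ∀ Q : B → Prop, Nat.card {a // Q (δ a)} = Nat.card δ.ker * Nat.card {b // Q b} := by
    intro Q
    rw [← Nat.card_prod]
    refine Nat.card_congr ?_
    choose γ hγ using hδ
    exact
      { toFun := fun a => (⟨a.1 - γ (δ a.1), by rw [AddMonoidHom.mem_ker, map_sub, hγ, sub_self]⟩, ⟨δ a.1, a.2⟩)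
        invFun := fun x => ⟨x.1.1 + γ x.2.1, by
          rw [map_add, hγ, AddMonoidHom.mem_ker.1 x.1.2, zero_add]; exact x.2.2⟩
        left_inv := fun a => by apply Subtype.ext; simp
        right_inv := fun x => by
          obtain ⟨⟨x, hx⟩, ⟨y, hy⟩⟩ := x
          have : δ x = 0 := hx
          simp [hγ, this] }
  have h1 := key P
  have h2 := key (fun _ => True)
  rw [Nat.card_congr (Equiv.subtypeUnivEquiv (fun _ => trivial)),
    Nat.card_congr (Equiv.subtypeUnivEquiv (fun _ => trivial))] at h2
  rw [h1, h2]; ring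

section DD2

variable {F : Type} [Field F] (p : Polynomial F) {N : ℕ} [hp : Fact (Irreducible p)]

theorem card_homDD [Fintype F] (m m' : Fin N → ℕ) :
    Nat.card (DD p m →ₗ[Polynomial F] DD p m') =
      Fintype.card F ^ (∑ k : Fin N, ∑ l : Fin N, m k * m' l * (min (k.1 + 1) (l.1 + 1) * p.natDegree)) := by
  rw [card_hom_pi_left]
  simp only [card_hom_pi_left, card_hom_pi_right, card_homQm, Finset.prod_const, Finset.card_univ, Fintype.card_fin]
  rw [← Finset.prod_pow_eq_pow_sum]
  refine Finset.prod_congr rfl fun k _ => ?_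
  rw [← Finset.prod_pow_eq_pow_sum]
  refine Finset.prod_congr rfl fun l _ => ?_
  rw [← pow_mul, ← pow_mul]
  congr 1; ring

instance finHomDD [Finite F] (m m' : Fin N → ℕ) : Finite (DD p m →ₗ[Polynomial F] DD p m') :=
  Finite.of_injective (fun f => (f : DD p m → DD p m')) DFunLike.coe_injective

theorem DD_pow_smul (m : Fin N → ℕ) (v : DD p m) : p ^ N • v = 0 := by
  funext k i
  change p ^ N • v k i = 0
  have : p ^ N = p ^ (N - (k.1 + 1)) * p ^ (k.1 + 1) := by
    rw [← pow_add, Nat.sub_add_cancel k.2]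
  rw [this, mul_smul, Qm_pow_smul, smul_zero]

theorem exists_socle {m : Fin N → ℕ} (v : DD p m) (hv : v ≠ 0) : ∃ n, ∃ l, l ≠ 0 ∧ p ^ n • v = JJ p m l := by
  have hex : ∃ n, p ^ n • v = 0 := ⟨N, DD_pow_smul p m v⟩
  obtain ⟨n, hn⟩ : ∃ n, Nat.find hex = n + 1 := by
    refine ⟨Nat.find hex - 1, (Nat.succ_pred_eq_of_ne_zero ?_).symm⟩
    intro h0
    have := Nat.find_spec hex
    rw [h0, pow_zero, one_smul] at this
    exact hv this
  have h1 : p ^ (n + 1) • v = 0 := hn ▸ Nat.find_spec hex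
  have h2 : p ^ n • v ≠ 0 := Nat.find_min hex (by omega)
  obtain ⟨l, hl⟩ := (JJ_range p m (p ^ n • v)).2 (by rw [smul_smul, ← pow_succ']; exact h1)
  refine ⟨n, l, ?_, hl.symm⟩
  rintro rfl
  rw [map_zero] at hl
  exact h2 hl.symm

theorem bij_iff_del [Finite F] {m : Fin N → ℕ} (f : DD p m →ₗ[Polynomial F] DD p m) :
    Function.Bijective f ↔ ∀ k, Function.Bijective (del p f k) := by
  constructor
  · intro h k
    let e := LinearEquiv.ofBijective f h
    have h1 : f ∘ₗ e.symm.toLinearMap = LinearMap.id := by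
      refine LinearMap.ext fun v => e.apply_symm_apply v
    have h2 : e.symm.toLinearMap ∘ₗ f = LinearMap.id := by
      refine LinearMap.ext fun v => e.symm_apply_apply v
    have h1' := congrArg (fun g => del p g k) h1
    have h2' := congrArg (fun g => del p g k) h2
    simp only [del_comp, del_id] at h1' h2'
    refine Function.bijective_iff_has_inverse.2 ⟨del p e.symm.toLinearMap k, ?_, ?_⟩
    · intro v; exact LinearMap.congr_fun h2' v
    · intro v; exact LinearMap.congr_fun h1' v
  · intro h
    rw [← Finite.injective_iff_bijective, injective_iff_map_eq_zero]
    intro v hv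
    by_contra hne
    obtain ⟨n, l, hl, hnl⟩ := exists_socle p v hne
    apply hl
    have h0 : fJ p f l = 0 := by
      apply JJ_injective
      rw [JJ_fJ, ← hnl, map_smul, hv, smul_zero, map_zero]
    have hk : ∀ j, ∀ k : Fin N, k.1 < j → l k = 0 := by
      intro j
      induction j with
      | zero => intro k hk; omega
      | succ j ih =>
        intro k hk
        by_cases hkj : k.1 < j
        · exact ih k hkj
        · have hkj' : k.1 = j := by omega
          have := fJ_diag p f k l (fun l' hl' => ih l' (by omega))
          rw [h0] at this
          exact (h k).1 (by rw [← this, map_zero]; rfl)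
    funext k
    exact hk (k.1 + 1) k (Nat.lt_succ_self _)

theorem card_autDD [Fintype F] (m : Fin N → ℕ) :
    (Nat.card (DD p m ≃ₗ[Polynomial F] DD p m) : ℚ) =
      (Nat.card (DD p m →ₗ[Polynomial F] DD p m) : ℚ) *
      (∏ k, glq (Fintype.card F ^ p.natDegree) (m k)) / 
        (((Fintype.card F : ℚ) ^ p.natDegree) ^ (∑ k, m k * m k)) := by
  have hq0 : (Fintype.card F : ℚ) ≠ 0 := by
    have := Fintype.card_pos (α := F); positivity
  have h := card_preimage_surj (A := DD p m →ₗ[Polynomial F] DD p m)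
    (B := ∀ k : Fin N, (Fin (m k) → Qm p 1) →ₗ[Qm p 1] (Fin (m k) → Qm p 1)) (delH p m m) (delH_surjective p m m) (fun b => ∀ k, Function.Bijective (b k))
  have e1 : Nat.card {a // ∀ k, Function.Bijective (delH p m m a k)} = Nat.card (DD p m ≃ₗ[Polynomial F] DD p m) := by
    refine Nat.card_congr ((Equiv.subtypeEquivRight fun f => (bij_iff_del p f).symm).trans ?_)
    exact
    { toFun := fun f => LinearEquiv.ofBijective f.1 f.2
      invFun := fun e => ⟨e.toLinearMap, e.bijective⟩
      left_inv := fun f => rfl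
      right_inv := fun e => by apply LinearEquiv.toLinearMap_injective; rfl }
  have e2 : Nat.card (∀ k : Fin N, (Fin (m k) → Qm p 1) →ₗ[Qm p 1] (Fin (m k) → Qm p 1)) = 
      (Fintype.card F ^ p.natDegree) ^ (∑ k, m k * m k) := by
    rw [Nat.card_pi, ← Finset.prod_pow_eq_pow_sum]
    refine Finset.prod_congr rfl fun k _ => ?_
    rw [natCard_hom, Qm_fcard]; simp
  have e3 : (Nat.card {b : ∀ k : Fin N, (Fin (m k) → Qm p 1) →ₗ[Qm p 1] (Fin (m k) → Qm p 1) //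
      ∀ k, Function.Bijective (b k)} : ℚ) = ∏ k, glq (Fintype.card F ^ p.natDegree) (m k) := by
    rw [Nat.card_congr (Equiv.subtypePiEquivPi (p := fun k (b : (Fin (m k) → Qm p 1) →ₗ[Qm p 1] (Fin (m k) → Qm p 1)) => Function.Bijective b)), Nat.card_pi]
    push_cast
    refine Finset.prod_congr rfl fun k _ => ?_
    rw [Nat.card_congr bijEquiv, natCard_equiv_gl (Qm p 1) _ (m := m k) (by simp), Qm_fcard]
  rw [e1, e2] at h
  have h' := congrArg (Nat.cast (R := ℚ)) h
  push_cast at h'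
  rw [e3] at h'
  rw [eq_div_iff (by positivity)]
  exact h'

theorem type_unique [Fintype F] {m m' : Fin N → ℕ} (e : DD p m ≃ₗ[Polynomial F] DD p m') : m = m' := by
  have hq : 1 < Fintype.card F := Fintype.one_lt_card
  have hd : 0 < p.natDegree := hp.out.natDegree_pos
  have h1 : ∀ j, ∑ l : Fin N, m l * min j (l.1 + 1) = ∑ l : Fin N, m' l * min j (l.1 + 1) := by
    intro j
    have hc : ∀ m : Fin N → ℕ, Nat.card (Qm p j →ₗ[Polynomial F] DD p m) =
        Fintype.card F ^ ((∑ l : Fin N, m l * min j (l.1 + 1)) * p.natDegree) := by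
      intro m
      rw [card_hom_pi_right]
      simp only [card_hom_pi_right, card_homQm, Finset.prod_const, Finset.card_univ, Fintype.card_fin]
      rw [Finset.sum_mul, ← Finset.prod_pow_eq_pow_sum]
      refine Finset.prod_congr rfl fun l _ => ?_
      rw [← pow_mul]; congr 1; ring
    have hh : Nat.card (Qm p j →ₗ[Polynomial F] DD p m) = Nat.card (Qm p j →ₗ[Polynomial F] DD p m') :=
      Nat.card_congr (LinearEquiv.congrRight e).toEquiv
    rw [hc, hc] at hh
    have := Nat.pow_right_injective hq hh
    exact Nat.eq_of_mul_eq_mul_right hd this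
  have h2 : ∀ (m : Fin N → ℕ) (k : Fin N), (m k : ℤ) = 2 * ∑ l : Fin N, (m l : ℤ) * min ((k.1 : ℤ) + 1) (l.1 + 1) - 
      ∑ l : Fin N, (m l : ℤ) * min (k.1 : ℤ) (l.1 + 1) - ∑ l : Fin N, (m l : ℤ) * min ((k.1 : ℤ) + 2) (l.1 + 1) := by
    intro m k
    rw [Finset.mul_sum, ← Finset.sum_sub_distrib, ← Finset.sum_sub_distrib]
    rw [Finset.sum_eq_single k]
    · rw [min_self, min_eq_left (by omega : (k.1 : ℤ) ≤ k.1 + 1), min_eq_right (by omega : (k.1 : ℤ) + 1 ≤ k.1 + 2)]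
      ring
    · intro l _ hl
      have hl' : l.1 ≠ k.1 := fun e => hl (Fin.ext e)
      rcases lt_or_gt_of_ne hl' with h | h
      · rw [min_eq_right (by omega), min_eq_right (by omega), min_eq_right (by omega)]; ring
      · rw [min_eq_left (by omega), min_eq_left (by omega), min_eq_left (by omega)]; ring
    · simp
  funext k
  have a1 := congrArg (Nat.cast (R := ℤ)) (h1 k.1)
  have a2 := congrArg (Nat.cast (R := ℤ)) (h1 (k.1 + 1))
  have a3 := congrArg (Nat.cast (R := ℤ)) (h1 (k.1 + 2))
  push_cast at a1 a2 a3
  have := h2 m k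
  rw [a1, a2, a3, ← h2 m' k] at this
  exact_mod_cast this

/-- regrouping a product of cyclic modules -/
theorem regroup {J : Type} [Fintype J] (c : J → ℕ) (hc : ∀ j, c j ≤ N) :
    Nonempty ((∀ j, Qm p (c j)) ≃ₗ[Polynomial F]
      DD p (fun k : Fin N => Fintype.card {j // c j = k.1 + 1})) := by
  let ε : ∀ k : Fin N, Fin (Fintype.card {j // c j = k.1 + 1}) ≃ {j // c j = k.1 + 1} :=
    fun k => (Fintype.equivFin _).symm
  have hcast : ∀ (a b : ℕ) (h : a = b), Ideal.span {p ^ a} = Ideal.span {p ^ b} := by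
    intro a b h; rw [h]
  let Θ : (∀ j, Qm p (c j)) →ₗ[Polynomial F] DD p (fun k : Fin N => Fintype.card {j // c j = k.1 + 1}) :=
    { toFun := fun v k i => Submodule.quotEquivOfEq _ _ (hcast _ _ (ε k i).2) (v (ε k i).1)
      map_add' := fun v v' => by funext k i; simp
      map_smul' := fun r v => by funext k i; simp }
  refine ⟨LinearEquiv.ofBijective Θ ⟨?_, ?_⟩⟩
  · rw [injective_iff_map_eq_zero]
    intro v hv
    funext j
    by_cases h0 : c j = 0
    · obtain ⟨x, hx⟩ := Ideal.Quotient.mk_surjective (v j)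
      rw [← hx]
      refine (Qm_mk_eq_zero p (c j) x).2 ?_
      rw [h0, pow_zero]; exact one_dvd _
    · have hlt : c j - 1 < N := by have := hc j; omega
      have hj : c j = (⟨c j - 1, hlt⟩ : Fin N).1 + 1 := by simp; omega
      have := congrFun (congrFun hv ⟨c j - 1, hlt⟩) ((ε ⟨c j - 1, hlt⟩).symm ⟨j, hj⟩)
      change Submodule.quotEquivOfEq _ _ (hcast _ _ (ε ⟨c j - 1, hlt⟩ ((ε ⟨c j - 1, hlt⟩).symm ⟨j, hj⟩)).2) (v (ε _ _).1) = 0 at this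
      rw [LinearEquiv.map_eq_zero_iff] at this
      have he : (ε ⟨c j - 1, hlt⟩ ((ε ⟨c j - 1, hlt⟩).symm ⟨j, hj⟩)) = ⟨j, hj⟩ := Equiv.apply_symm_apply _ _
      have hgen : ∀ x : {j' // c j' = (⟨c j - 1, hlt⟩ : Fin N).1 + 1}, x = ⟨j, hj⟩ → v x.1 = 0 → v j = 0 := by
        rintro x rfl h; exact h
      exact hgen _ he this
  · intro y
    refine ⟨fun j => if h : ∃ k : Fin N, c j = k.1 + 1 then
      (Submodule.quotEquivOfEq _ _ (hcast _ _ h.choose_spec)).symm (y h.choose ((ε h.choose).symm ⟨j, h.choose_spec⟩))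
      else 0, ?_⟩
    funext k i
    have hex : ∃ k' : Fin N, c (ε k i).1 = k'.1 + 1 := ⟨k, (ε k i).2⟩
    change Submodule.quotEquivOfEq _ _ (hcast _ _ (ε k i).2) (dite _ _ _) = _
    rw [dif_pos hex]
    have hk : hex.choose = k := by
      have h1 := hex.choose_spec
      have h2 := (ε k i).2
      exact Fin.ext (by omega)
    have hgen : ∀ (k' : Fin N) (hk' : k' = k) (h3 : c (ε k i).1 = k'.1 + 1) (h4),
       Submodule.quotEquivOfEq _ _ h4 ((Submodule.quotEquivOfEq _ _ (hcast _ _ h3)).symm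
         (y k' ((ε k').symm ⟨(ε k i).1, h3⟩))) = y k i := by
      rintro k' rfl h3 h4
      rw [Equiv.symm_apply_apply]
      exact LinearEquiv.apply_symm_apply _ _
    exact hgen _ hk _ _

end DD2


/-! ### Part C3: semistability and the socle filtration -/

section SSlem

variable {F : Type} [Field F] {ι Ar : Type} [Fintype ι] {s t : Ar → ι} {V V' : ι → Type}
  [∀ i, AddCommGroup (V i)] [∀ i, Module F (V i)]
  [∀ i, AddCommGroup (V' i)] [∀ i, Module F (V' i)]
  [∀ i, Module.Finite F (V i)] [∀ i, Module.Finite F (V' i)]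

theorem dg_map_inj (w : ι → ℚ) (f : ∀ i, V i →ₗ[F] V' i) (hf : ∀ i, Function.Injective (f i))
    (W : ∀ i, Submodule F (V i)) : dg w (fun i => (W i).map (f i)) = dg w W := by
  rw [dg_map_inf_ker w f W]
  have : (fun i => W i ⊓ LinearMap.ker (f i)) = ⊥ := by
    funext i
    rw [LinearMap.ker_eq_bot.2 (hf i), inf_bot_eq]; rfl
  rw [this, dg_bot, add_zero]

theorem Stb.map {σ : FRep F s t V} {σ' : FRep F s t V'} (f : ∀ i, V i →ₗ[F] V' i)
    (hf : ∀ x v, f (t x) (σ x v) = σ' x (f (s x) v)) {W : ∀ i, Submodule F (V i)} (h : Stb σ W) :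
    Stb σ' (fun i => (W i).map (f i)) := by
  rintro x _ ⟨v, hv, rfl⟩
  exact ⟨σ x v, h x v hv, hf x v⟩

theorem Stb.comap {σ : FRep F s t V} {σ' : FRep F s t V'} (f : ∀ i, V i →ₗ[F] V' i)
    (hf : ∀ x v, f (t x) (σ x v) = σ' x (f (s x) v)) {W : ∀ i, Submodule F (V' i)} (h : Stb σ' W) :
    Stb σ (fun i => (W i).comap (f i)) := by
  intro x v hv
  rw [Submodule.mem_comap] at hv ⊢
  rw [hf]; exact h x _ hv

theorem Stb.ker {σ : FRep F s t V} {σ' : FRep F s t V'} (f : ∀ i, V i →ₗ[F] V' i)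
    (hf : ∀ x v, f (t x) (σ x v) = σ' x (f (s x) v)) : Stb σ (fun i => LinearMap.ker (f i)) := by
  intro x v hv
  rw [LinearMap.mem_ker] at hv ⊢
  rw [hf, hv, map_zero]

variable {B : ℕ} {G : Fin B → ι → Type} [∀ k i, AddCommGroup (G k i)] [∀ k i, Module F (G k i)]
  [∀ k i, Module.Finite F (G k i)]

variable (F G) in
/-- the coordinate filtration -/
def KK (j : ℕ) : ∀ i, Submodule F (∀ k, G k i) := fun i =>
  { carrier := {v | ∀ k : Fin B, k.1 < j → v k = 0}
    add_mem' := fun {a b} ha hb k hk => by simp [ha k hk, hb k hk]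
    zero_mem' := fun k hk => rfl
    smul_mem' := fun c v hv k hk => by simp [hv k hk] }

theorem mem_KK {j : ℕ} {i : ι} {v : ∀ k, G k i} : v ∈ KK F G j i ↔ ∀ k : Fin B, k.1 < j → v k = 0 := Iff.rfl

theorem dg_KK_step (w : ι → ℚ) (k : Fin B) (W : ∀ i, Submodule F (∀ k, G k i)) :
    dg w (W ⊓ KK F G k.1) = dg w (fun i => (W i ⊓ KK F G k.1 i).map (LinearMap.proj k)) + dg w (W ⊓ KK F G (k.1 + 1)) := by
  rw [dg_map_inf_ker w (fun i => (LinearMap.proj k : (∀ k, G k i) →ₗ[F] G k i))]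
  congr 2
  funext i
  ext v
  simp only [Pi.inf_apply, Submodule.mem_inf, LinearMap.mem_ker, LinearMap.proj_apply, mem_KK]
  constructor
  · rintro ⟨⟨h1, h2⟩, h3⟩
    refine ⟨h1, fun l hl => ?_⟩
    by_cases h : l = k
    · rw [h, h3]
    · exact h2 l (by have : l.1 ≠ k.1 := fun e => h (Fin.ext e)
                     omega)
  · rintro ⟨h1, h2⟩
    exact ⟨⟨h1, fun l hl => h2 l (by omega)⟩, h2 k (by omega)⟩

theorem KK_zero : KK F G 0 = ⊤ := by
  funext i; ext v; simp [mem_KK]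

theorem KK_last (j : ℕ) (hj : B ≤ j) : KK F G j = ⊥ := by
  funext i; ext v
  simp only [mem_KK, Pi.bot_apply, Submodule.mem_bot]
  constructor
  · intro h; funext k; exact h k (by omega)
  · rintro rfl k _; rfl

theorem proj_KK (k : Fin B) (U : ∀ i, Submodule F (G k i)) (i : ι) :
    ((U i).comap (LinearMap.proj k : (∀ k, G k i) →ₗ[F] G k i) ⊓ KK F G k.1 i).map (LinearMap.proj k) = U i := by
  ext u
  constructor
  · rintro ⟨v, ⟨h1, h2⟩, rfl⟩; exact h1
  · intro hu
    refine ⟨Pi.single k u, ⟨by simpa using hu, fun l hl => ?_⟩, by simp⟩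
    have : l ≠ k := fun e => by subst e; exact lt_irrefl _ hl
    simp [this]

/-- semistability of the diagonal blocks -/
theorem triSS (w : ι → ℚ) (σL : FRep F s t (fun i => ∀ k, G k i)) (σb : ∀ k, FRep F s t (G k))
    (hst : ∀ j, Stb σL (KK F G j))
    (hdiag : ∀ (k : Fin B) x v, v ∈ KK F G k.1 (s x) → σL x v k = σb k x (v k)) :
    (∀ k, SS w (σb k)) ↔ (∀ j, dg w (KK F G j) = 0) ∧ ∀ W, Stb σL W → dg w W ≤ 0 := by
  have hproj : ∀ (k : Fin B) W, Stb σL W → Stb (σb k) (fun i => (W i ⊓ KK F G k.1 i).map (LinearMap.proj k)) := by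
    rintro k W hW x _ ⟨v, hv, rfl⟩
    refine ⟨σL x v, ⟨hW x v hv.1, hst _ x v hv.2⟩, ?_⟩
    exact hdiag k x v hv.2
  constructor
  · intro h
    constructor
    · intro j
      by_cases hj : B ≤ j
      · rw [KK_last j hj, dg_bot]
      · have hjB : j ≤ B := by omega
        induction hjB using Nat.decreasingInduction with
        | self => omega
        | of_succ j hj' ih =>
          have h1 := dg_KK_step (F := F) (G := G) w ⟨j, hj'⟩ ⊤
          rw [top_inf_eq, top_inf_eq] at h1
          have h3 : (fun i => ((⊤ : ∀ i, Submodule F (∀ k, G k i)) i ⊓ KK F G j i).map (LinearMap.proj (⟨j, hj'⟩ : Fin B))) = (⊤ : ∀ i, Submodule F (G ⟨j, hj'⟩ i)) := by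
            funext i
            exact proj_KK ⟨j, hj'⟩ ⊤ i
          change _ = dg w (fun i => ((⊤ : ∀ i, Submodule F (∀ k, G k i)) i ⊓ KK F G j i).map _) + _ at h1
          rw [h3, (h ⟨j, hj'⟩).1, zero_add] at h1
          rw [show KK F G j = KK F G (⟨j, hj'⟩ : Fin B).1 from rfl, h1]
          by_cases hj2 : B ≤ j + 1
          · rw [KK_last (j + 1) hj2, dg_bot]
          · exact ih hj2
    · intro W hW
      have : ∀ j, j ≤ B → dg w (W ⊓ KK F G j) ≤ 0 := by
        intro j hj
        induction hj using Nat.decreasingInduction with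
        | self => rw [KK_last B le_rfl, inf_bot_eq, dg_bot]
        | of_succ j hj' ih =>
          have h1 := dg_KK_step (F := F) (G := G) w ⟨j, hj'⟩ W
          have h2 := (h ⟨j, hj'⟩).2 _ (hproj ⟨j, hj'⟩ W hW)
          change dg w (W ⊓ KK F G j) = _ + dg w (W ⊓ KK F G (j + 1)) at h1
          linarith
      have := this 0 (Nat.zero_le _)
      rwa [KK_zero, inf_top_eq] at this
  · rintro ⟨h1, h2⟩ k
    have key : ∀ U : ∀ i, Submodule F (G k i), dg w ((fun i => (U i).comap (LinearMap.proj k : (∀ k, G k i) →ₗ[F] G k i)) ⊓ KK F G k.1) = dg w U := by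
      intro U
      rw [dg_KK_step]
      have : (fun i => (U i).comap (LinearMap.proj k : (∀ k, G k i) →ₗ[F] G k i)) ⊓ KK F G (k.1 + 1) = KK F G (k.1 + 1) := by
        refine inf_eq_right.2 fun i v hv => ?_
        rw [Submodule.mem_comap, LinearMap.proj_apply, hv k (by omega)]
        exact zero_mem _
      rw [this, h1, add_zero]
      congr 1
      funext i
      exact proj_KK k U i
    refine ⟨?_, fun U hU => ?_⟩
    · rw [← key]
      have : (fun i => ((⊤ : ∀ i, Submodule F (G k i)) i).comap (LinearMap.proj k : (∀ k, G k i) →ₗ[F] G k i)) ⊓ KK F G k.1 = KK F G k.1 := by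
        refine inf_eq_right.2 fun i v hv => trivial
      rw [this, h1]
    · rw [← key]
      apply h2
      intro x v hv
      refine ⟨?_, hst _ x v hv.2⟩
      change σL x v k ∈ U (t x)
      rw [hdiag k x v hv.2]
      exact hU x _ hv.1

theorem SS.dg_ker {w : ι → ℚ} {σ : FRep F s t V} (h : SS w σ) (f : ∀ i, V i →ₗ[F] V i)
    (hf : ∀ x v, f (t x) (σ x v) = σ x (f (s x) v)) :
    dg w (fun i => LinearMap.ker (f i)) = 0 ∧ dg w (fun i => LinearMap.range (f i)) = 0 := by
  have h1 := dg_map_inf_ker w f ⊤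
  rw [h.1] at h1
  have e1 : (fun i => ((⊤ : ∀ i, Submodule F (V i)) i).map (f i)) = fun i => LinearMap.range (f i) := by
    funext i; exact Submodule.map_top _
  have e2 : (fun i => (⊤ : ∀ i, Submodule F (V i)) i ⊓ LinearMap.ker (f i)) = fun i => LinearMap.ker (f i) := by
    funext i; exact top_inf_eq _
  rw [e1, e2] at h1
  have h2 := h.2 _ (Stb.ker f hf)
  have h3 := h.2 _ (Stb.map f hf Stb.top)
  rw [e1] at h3
  constructor <;> linarith

/-- semistability detected on the socle of a nilpotent endomorphism -/
theorem socSS (w : ι → ℚ) (σ : FRep F s t V) (N : ∀ i, V i →ₗ[F] V i)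
    (hN : ∀ x v, N (t x) (σ x v) = σ x (N (s x) v)) (hnil : ∀ i v, (N i ^ B) v = 0)
    (σL : FRep F s t (fun i => ∀ k, G k i)) (J : ∀ i, (∀ k, G k i) →ₗ[F] V i)
    (hJ : ∀ i, Function.Injective (J i)) (hJr : ∀ i v, N i v = 0 ↔ v ∈ LinearMap.range (J i))
    (hJs : ∀ x v, J (t x) (σL x v) = σ x (J (s x) v))
    (hJp : ∀ j i v, (∃ y, (N i ^ j) y = J i v) ↔ v ∈ KK F G j i) :
    SS w σ ↔ (∀ j, dg w (KK F G j) = 0) ∧ ∀ W, Stb σL W → dg w W ≤ 0 := by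
  have hNp : ∀ j x v, (N (t x) ^ j) (σ x v) = σ x ((N (s x) ^ j) v) := by
    intro j x v
    induction j generalizing v with
    | zero => simp
    | succ j ih => rw [pow_succ, Module.End.mul_apply, hN, ih, pow_succ, Module.End.mul_apply]
  have hKK : ∀ j, (fun i => (KK F G j i).map (J i)) =
      (fun i => LinearMap.ker (N i)) ⊓ (fun i => LinearMap.range (N i ^ j)) := by
    intro j
    funext i; ext v
    constructor
    · rintro ⟨l, hl, rfl⟩
      refine ⟨(hJr i _).2 ⟨l, rfl⟩, ?_⟩
      obtain ⟨y, hy⟩ := (hJp j i l).2 hl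
      exact ⟨y, hy⟩
    · rintro ⟨h1, h2⟩
      obtain ⟨l, rfl⟩ := (hJr i v).1 h1
      exact ⟨l, (hJp j i l).1 h2, rfl⟩
  constructor
  · intro h
    constructor
    · intro j
      rw [← dg_map_inj w J hJ, hKK]
      have a1 := (h.dg_ker N hN).1
      have a2 := (h.dg_ker (fun i => N i ^ j) (hNp j)).2
      have a3 := dg_sup_inf w (fun i => LinearMap.ker (N i)) (fun i => LinearMap.range (N i ^ j))
      have s1 := Stb.ker N hN
      have s2 : Stb σ (fun i => LinearMap.range (N i ^ j)) := by
        have := Stb.map (fun i => N i ^ j) (hNp j) (Stb.top (σ := σ))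
        intro x v hv
        have := this x v (by obtain ⟨y, rfl⟩ := hv; exact ⟨y, trivial, rfl⟩)
        obtain ⟨y, _, hy⟩ := this
        exact ⟨y, hy⟩
      have a4 := h.2 _ (s1.sup s2)
      have a5 := h.2 _ (s1.inf s2)
      linarith
    · intro W hW
      rw [← dg_map_inj w J hJ]
      exact h.2 _ (hW.map J hJs)
  · rintro ⟨h1, h2⟩
    have hsoc : ∀ W, Stb σ W → dg w (fun i => W i ⊓ LinearMap.ker (N i)) ≤ 0 := by
      intro W hW
      have := h2 _ (hW.comap J hJs)
      rw [← dg_map_inj w J hJ] at this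
      convert this using 2
      funext i; ext v
      constructor
      · rintro ⟨a, b⟩
        obtain ⟨l, rfl⟩ := (hJr i v).1 b
        exact ⟨l, a, rfl⟩
      · rintro ⟨l, hl, rfl⟩
        exact ⟨hl, (hJr i _).2 ⟨l, rfl⟩⟩
    constructor
    · have : ∀ n, dg w (⊤ : ∀ i, Submodule F (V i)) = dg w (fun i => LinearMap.range (N i ^ n)) := by
        intro n
        induction n with
        | zero => congr 1; funext i; ext v; simp
        | succ n ih =>
          rw [ih, dg_map_inf_ker w N]
          have e1 : (fun i => LinearMap.range (N i ^ n) ⊓ LinearMap.ker (N i)) = fun i => (KK F G n i).map (J i) := by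
            rw [hKK, inf_comm]; rfl
          rw [e1, dg_map_inj w J hJ, h1, add_zero]
          congr 1
          funext i
          rw [← LinearMap.range_comp, pow_succ']; rfl
      rw [this B]
      have : (fun i => LinearMap.range (N i ^ B)) = (⊥ : ∀ i, Submodule F (V i)) := by
        funext i; ext v
        constructor
        · rintro ⟨y, rfl⟩; rw [hnil]; exact zero_mem _
        · intro hv; rw [(Submodule.mem_bot F).1 hv]; exact zero_mem _
      rw [this, dg_bot]
    · have : ∀ n, ∀ W, Stb σ W → (∀ i, ∀ v ∈ W i, (N i ^ n) v = 0) → dg w W ≤ 0 := by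
        intro n
        induction n with
        | zero =>
          intro W _ h
          have : W = ⊥ := by
            funext i; ext v
            constructor
            · intro hv; have := h i v hv; simpa using this
            · intro hv; rw [(Submodule.mem_bot F).1 hv]; exact zero_mem _
          rw [this, dg_bot]
        | succ n ih =>
          intro W hW hn
          rw [dg_map_inf_ker w N W]
          have a1 := ih _ (hW.map N hN) (by
            rintro i _ ⟨v, hv, rfl⟩
            have := hn i v hv
            rwa [pow_succ, Module.End.mul_apply] at this)
          have a2 := hsoc W hW
          linarith
      intro W hW
      exact this B W hW fun i v _ => hnil i v

end SSlem


/-! ### Part C4: restriction of scalars -/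

section SSres

variable {F κ : Type} [Field F] [Field κ] [Algebra F κ] [Module.Finite F κ] {ι Ar : Type} [Fintype ι] {s t : Ar → ι} {V : ι → Type}
  [∀ i, AddCommGroup (V i)] [∀ i, Module F (V i)] [∀ i, Module κ (V i)] [∀ i, IsScalarTower F κ (V i)]

theorem dg_restrict (w : ι → ℚ) (W : ∀ i, Submodule κ (V i)) :
    dg w (fun i => (W i).restrictScalars F) = Module.finrank F κ * dg w W := by
  unfold dg
  rw [Finset.mul_sum]
  refine Finset.sum_congr rfl fun i _ => ?_
  have : Module.finrank F ((W i).restrictScalars F) = Module.finrank F κ * Module.finrank κ (W i) :=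
    (Module.finrank_mul_finrank F κ (W i)).symm
  rw [this]; push_cast; ring

theorem SS_restrict [∀ i, Finite (V i)] (w : ι → ℚ) (σ : FRep κ s t V) :
    SS w (fun x => (σ x).restrictScalars F : FRep F s t V) ↔ SS w σ := by
  have hfin : ∀ i, Module.Finite F (V i) := fun i => Module.Finite.of_finite
  have hd : (0 : ℚ) < Module.finrank F κ := by
    exact_mod_cast Module.finrank_pos
  have htop : dg w (⊤ : ∀ i, Submodule F (V i)) = Module.finrank F κ * dg w (⊤ : ∀ i, Submodule κ (V i)) := by
    rw [← dg_restrict]; rfl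
  constructor
  · intro h
    refine ⟨?_, fun W hW => ?_⟩
    · have := h.1
      rw [htop] at this
      exact (mul_eq_zero.1 this).resolve_left hd.ne'
    · have := h.2 (fun i => (W i).restrictScalars F) (fun x v hv => hW x v hv)
      rw [dg_restrict] at this
      exact nonpos_of_mul_nonpos_right this hd
  · intro h
    refine ⟨by rw [htop, h.1, mul_zero], fun W hW => ?_⟩
    obtain ⟨U, hU⟩ := HN_exists w (fun x => (σ x).restrictScalars F : FRep F s t V)
    have hinv : ∀ c : κ, c ≠ 0 → ∀ i, ∀ v ∈ U i, c • v ∈ U i := by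
      intro c hc i v hv
      let e : ∀ i, V i ≃ₗ[F] V i := fun i =>
        { toFun := fun v => c • v
          invFun := fun v => c⁻¹ • v
          map_add' := fun a b => smul_add _ _ _
          map_smul' := fun a b => smul_comm _ _ _
          left_inv := fun v => by simp [smul_smul, hc]
          right_inv := fun v => by simp [smul_smul, hc] }
      have h1 : trF e (fun x => (σ x).restrictScalars F : FRep F s t V) = fun x => (σ x).restrictScalars F := by
        funext x
        refine LinearMap.ext fun v => ?_
        change c • σ x (c⁻¹ • v) = σ x v
        rw [map_smul, smul_smul, mul_inv_cancel₀ hc, one_smul]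
      have h2 := (HN_trF w e (fun x => (σ x).restrictScalars F : FRep F s t V) U).2 hU
      rw [h1] at h2
      have h3 := HN_unique h2 hU
      rw [← h3]
      exact ⟨v, hv, rfl⟩
    let U' : ∀ i, Submodule κ (V i) := fun i =>
      { carrier := U i
        add_mem' := fun ha hb => (U i).add_mem ha hb
        zero_mem' := (U i).zero_mem
        smul_mem' := fun c v hv => by
          by_cases hc : c = 0
          · rw [hc, zero_smul]; exact (U i).zero_mem
          · exact hinv c hc i v hv }
    have hUU : U = fun i => (U' i).restrictScalars F := by
      funext i; ext v; rfl
    have hU0 : dg w U ≤ 0 := by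
      rw [hUU, dg_restrict]
      exact mul_nonpos_of_nonneg_of_nonpos hd.le (h.2 U' fun x v hv => hU.1 x v hv)
    have a1 := hU.2.2 _ (hU.1.sup hW) le_sup_left
    have a2 := dg_sup_inf w U W
    have a3 : dg w (U ⊓ W) ≤ dg w U := by
      rcases eq_or_lt_of_le (inf_le_left : U ⊓ W ≤ U) with e | e
      · rw [e]
      · exact (hU.2.1 _ (hU.1.inf hW) e).le
    linarith

end SSres

section SSdel

variable {F : Type} [Field F] [Fintype F] (p : Polynomial F) {N : ℕ} [hp : Fact (Irreducible p)]
  {ι Ar : Type} [Fintype ι] {s t : Ar → ι}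

theorem SS_del (w : ι → ℚ) (m : ι → Fin N → ℕ)
    (τ : ∀ x, DD p (m (s x)) →ₗ[Polynomial F] DD p (m (t x))) :
    SS (F := F) (s := s) (t := t) (V := fun i => DD p (m i)) w (fun x => (τ x).restrictScalars F) ↔
      ∀ k, SS (F := Qm p 1) (s := s) (t := t) (V := stdV (Qm p 1) (fun i => m i k)) w (fun x => del p (τ x) k) := by
  have hpow : ∀ (i : ι) (j : ℕ) (v : DD p (m i)),
      ((((LinearMap.lsmul (Polynomial F) (DD p (m i)) p).restrictScalars F) ^ j : DD p (m i) →ₗ[F] DD p (m i))) v = p ^ j • v := by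
    intro i j v
    induction j generalizing v with
    | zero => simp
    | succ j ih =>
      rw [pow_succ, Module.End.mul_apply, ih, pow_succ, mul_smul]; rfl
  rw [socSS (B := N) (G := fun k i => Fin (m i k) → Qm p 1) w _
    (fun i => (LinearMap.lsmul (Polynomial F) (DD p (m i)) p).restrictScalars F) ?_ ?_
    (fun x => (fJ p (τ x)).restrictScalars F) (fun i => (JJ p (m i)).restrictScalars F) ?_ ?_ ?_ ?_]
  · rw [← triSS (G := fun k i => Fin (m i k) → Qm p 1) w (fun x => (fJ p (τ x)).restrictScalars F)
      (fun k x => (del p (τ x) k).restrictScalars F)]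
    · refine forall_congr' fun k => ?_
      exact SS_restrict w _
    · intro j x v hv
      exact fJ_tri p (τ x) v j hv
    · intro k x v hv
      exact fJ_diag p (τ x) k v hv
  · intro x v
    exact ((τ x).map_smul p v).symm
  · intro i v
    rw [hpow, DD_pow_smul]
  · intro i
    exact JJ_injective p (m i)
  · intro i v
    exact (JJ_range p (m i) v).symm
  · intro x v
    exact JJ_fJ p (τ x) v
  · intro j i v
    have := JJ_pow p (m i) v j
    rw [mem_KK, ← this]
    refine exists_congr fun y => ?_
    rw [hpow]; rfl

end SSdel


/-! ### Part C5: types of endomorphisms -/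

section PolyLin

variable {F : Type} [Field F] {M M' : Type} [AddCommGroup M] [AddCommGroup M'] [Module F M] [Module F M']
  [Module (Polynomial F) M] [Module (Polynomial F) M'] [IsScalarTower F (Polynomial F) M]
  [IsScalarTower F (Polynomial F) M']

/-- maps commuting with `X` are `F[X]`-linear -/
def polyLin (f : M →ₗ[F] M') (h : ∀ v, f ((Polynomial.X : Polynomial F) • v) = (Polynomial.X : Polynomial F) • f v) :
    M →ₗ[Polynomial F] M' where
  toFun := f
  map_add' := f.map_add
  map_smul' c v := by
    change f (c • v) = c • f v
    have hpow : ∀ (n : ℕ) v, f ((Polynomial.X ^ n : Polynomial F) • v) = (Polynomial.X ^ n : Polynomial F) • f v := by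
      intro n
      induction n with
      | zero => intro v; simp
      | succ n ih => intro v; rw [pow_succ, mul_smul, ih, h, mul_smul]
    induction c using Polynomial.induction_on' with
    | add a b ha hb => rw [add_smul, map_add, ha, hb, add_smul]
    | monomial n a =>
      rw [← Polynomial.smul_X_eq_monomial, smul_assoc, map_smul, hpow, smul_assoc]

@[simp] theorem polyLin_apply (f : M →ₗ[F] M') (h) (v : M) : polyLin f h v = f v := rfl

end PolyLin

section Types

variable {F : Type} [Field F] (p : Polynomial F) {N : ℕ} [hp : Fact (Irreducible p)]

/-- multiplication by `X` -/
noncomputable def Xmul (m : Fin N → ℕ) : DD p m →ₗ[F] DD p m :=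
  (LinearMap.lsmul (Polynomial F) (DD p m) Polynomial.X).restrictScalars F

theorem Xmul_apply (m : Fin N → ℕ) (v : DD p m) : Xmul p m v = (Polynomial.X : Polynomial F) • v := rfl

theorem aeval_Xmul (m : Fin N → ℕ) (f : Polynomial F) (v : DD p m) :
    Polynomial.aeval (Xmul p m) f v = f • v := by
  induction f using Polynomial.induction_on' with
  | add a b ha hb => rw [map_add, LinearMap.add_apply, ha, hb]; exact (add_smul a b v).symm
  | monomial n a =>
    rw [Polynomial.aeval_monomial, ← Polynomial.smul_X_eq_monomial, smul_assoc]
    rw [Module.End.mul_apply, Module.algebraMap_end_apply]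
    congr 1
    induction n generalizing v with
    | zero => simp
    | succ n ih => rw [pow_succ, Module.End.mul_apply, ih, pow_succ, mul_smul]; rfl

theorem nilp_Xmul (m : Fin N → ℕ) : IsNilpotent (Polynomial.aeval (Xmul p m) p) := by
  refine ⟨N, ?_⟩
  rw [← map_pow]
  refine LinearMap.ext fun v => ?_
  rw [aeval_Xmul, DD_pow_smul]; rfl

theorem DD_finrank (m : Fin N → ℕ) : Module.finrank F (DD p m) = ∑ k : Fin N, m k * ((k.1 + 1) * p.natDegree) := by
  rw [Module.finrank_pi_fintype]
  refine Finset.sum_congr rfl fun k _ => ?_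
  rw [Module.finrank_pi_fintype]
  rw [Finset.sum_congr rfl fun i _ => Qm_finrank p (k.1 + 1)]
  simp

variable {V : Type} [AddCommGroup V] [Module F V] [Module.Finite F V]

theorem exists_type (φ : V →ₗ[F] V) (hφ : IsNilpotent (Polynomial.aeval φ p))
    (hN : Module.finrank F V ≤ N) :
    ∃ (m : Fin N → ℕ) (e : V ≃ₗ[F] DD p m), ∀ v, e (φ v) = (Polynomial.X : Polynomial F) • e v := by
  obtain ⟨n, hn⟩ := hφ
  have htor : Module.IsTorsion' (Module.AEval' φ) (Submonoid.powers p) := by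
    rw [Submodule.isTorsion'_powers_iff]
    intro x
    refine ⟨n, ?_⟩
    obtain ⟨v, rfl⟩ := (Module.AEval'.of φ).surjective x
    rw [← Module.AEval.of_aeval_smul, map_pow, hn]
    simp
  obtain ⟨d, c, ⟨e⟩⟩ := Module.torsion_by_prime_power_decomposition hp.out htor
  let e1 : Module.AEval' φ ≃ₗ[Polynomial F] (∀ j : Fin d, Qm p (c j)) :=
    e.trans (DirectSum.linearEquivFunOnFintype (Polynomial F) (Fin d) _)
  let e2 : V ≃ₗ[F] (∀ j : Fin d, Qm p (c j)) := (Module.AEval'.of φ).trans (e1.restrictScalars F)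
  have hc : ∀ j, c j ≤ N := by
    intro j
    refine le_trans ?_ hN
    rw [e2.finrank_eq, Module.finrank_pi_fintype]
    calc c j ≤ c j * p.natDegree := Nat.le_mul_of_pos_right _ hp.out.natDegree_pos
      _ = Module.finrank F (Qm p (c j)) := (Qm_finrank p _).symm
      _ ≤ _ := Finset.single_le_sum (f := fun j => Module.finrank F (Qm p (c j))) (fun _ _ => Nat.zero_le _) (Finset.mem_univ j)
  obtain ⟨e3⟩ := regroup p c hc
  refine ⟨_, e2.trans (e3.restrictScalars F), fun v => ?_⟩
  change e3 (e1 (Module.AEval'.of φ (φ v))) = (Polynomial.X : Polynomial F) • e3 (e1 (Module.AEval'.of φ v))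
  rw [← Module.AEval'.X_smul_of, map_smul, map_smul]

end Types

section CountTau

variable {F : Type} [Field F] [Fintype F] (p : Polynomial F) {N : ℕ} [hp : Fact (Irreducible p)]
  {ι Ar : Type} [Fintype ι] [Fintype Ar] (s t : Ar → ι)

/-- number of semistable `F[X]`-linear representations on the model -/
noncomputable def nTau (w : ι → ℚ) (m : ι → Fin N → ℕ) : ℕ :=
  Nat.card {τ : (∀ x, DD p (m (s x)) →ₗ[Polynomial F] DD p (m (t x))) //
    SS (F := F) (s := s) (t := t) (V := fun i => DD p (m i)) w (fun x => (τ x).restrictScalars F)}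

theorem card_tau (w : ι → ℚ) (m : ι → Fin N → ℕ) :
    nTau p s t w m *
      (Fintype.card F ^ p.natDegree) ^ (∑ x, ∑ k, m (s x) k * m (t x) k) =
    (∏ x, Nat.card (DD p (m (s x)) →ₗ[Polynomial F] DD p (m (t x)))) *
      ∏ k, nSS (Qm p 1) s t w (fun i => m i k) := by
  let A := ∀ x, DD p (m (s x)) →ₗ[Polynomial F] DD p (m (t x))
  let B := ∀ x, ∀ k : Fin N, (Fin (m (s x) k) → Qm p 1) →ₗ[Qm p 1] (Fin (m (t x) k) → Qm p 1)
  let δ : A →+ B := AddMonoidHom.mk' (fun a x => delH p (m (s x)) (m (t x)) (a x)) (fun a b => by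
    funext x; exact map_add _ _ _)
  have hδ : Function.Surjective δ := by
    intro b
    choose a ha using fun x => delH_surjective p (m (s x)) (m (t x)) (b x)
    exact ⟨a, funext ha⟩
  have h := card_preimage_surj (A := A) (B := B) δ hδ
    (fun b => ∀ k, SS (F := Qm p 1) (s := s) (t := t) (V := stdV (Qm p 1) (fun i => m i k)) w (fun x => b x k))
  have hB : Nat.card B = (Fintype.card F ^ p.natDegree) ^ (∑ x, ∑ k, m (s x) k * m (t x) k) := by
    rw [Nat.card_pi, ← Finset.prod_pow_eq_pow_sum]
    refine Finset.prod_congr rfl fun x _ => ?_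
    rw [Nat.card_pi, ← Finset.prod_pow_eq_pow_sum]
    refine Finset.prod_congr rfl fun k _ => ?_
    have := natCard_hom (Qm p 1) (Fin (m (s x) k) → Qm p 1) (Fin (m (t x) k) → Qm p 1)
    rw [Qm_fcard] at this
    simpa using this
  have hA : Nat.card A = ∏ x, Nat.card (DD p (m (s x)) →ₗ[Polynomial F] DD p (m (t x))) := Nat.card_pi
  rw [hB, hA] at h
  have h1 : nTau p s t w m = Nat.card {a : A // ∀ k, SS (F := Qm p 1) (s := s) (t := t) (V := stdV (Qm p 1) (fun i => m i k)) w (fun x => δ a x k)} := by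
    refine Nat.card_congr (Equiv.subtypeEquivRight fun a => ?_)
    exact SS_del p w m a
  rw [h1, h]
  congr 1
  have e : {b : B // ∀ k, SS (F := Qm p 1) (s := s) (t := t) (V := stdV (Qm p 1) (fun i => m i k)) w (fun x => b x k)} ≃
      ∀ k, {c : FRep (Qm p 1) s t (stdV (Qm p 1) (fun i => m i k)) // SS w c} :=
    { toFun := fun b k => ⟨fun x => b.1 x k, b.2 k⟩
      invFun := fun c => ⟨fun x k => (c k).1 x, fun k => (c k).2⟩
      left_inv := fun b => rfl
      right_inv := fun c => rfl }
  rw [Nat.card_congr e, Nat.card_pi]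
  rfl

end CountTau


/-! ### Part C6: counting pairs -/

section Pairs

variable {F : Type} [Field F] {ι Ar : Type} [Fintype ι] {s t : Ar → ι} {V V' : ι → Type}
  [∀ i, AddCommGroup (V i)] [∀ i, Module F (V i)]
  [∀ i, AddCommGroup (V' i)] [∀ i, Module F (V' i)]

/-- endomorphisms of a representation -/
def Cmm (φ : ∀ i, V i →ₗ[F] V i) (σ : FRep F s t V) : Prop := ∀ x v, φ (t x) (σ x v) = σ x (φ (s x) v)

/-- transport of families of endomorphisms -/
def cjF (e : ∀ i, V i ≃ₗ[F] V' i) (φ : ∀ i, V i →ₗ[F] V i) : ∀ i, V' i →ₗ[F] V' i :=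
  fun i => (e i).conj (φ i)

@[simp] theorem cjF_apply (e : ∀ i, V i ≃ₗ[F] V' i) (φ : ∀ i, V i →ₗ[F] V i) (i) (v) :
    cjF e φ i v = e i (φ i ((e i).symm v)) := rfl

theorem Cmm_tr (e : ∀ i, V i ≃ₗ[F] V' i) (φ : ∀ i, V i →ₗ[F] V i) (σ : FRep F s t V) :
    Cmm (cjF e φ) (trF e σ) ↔ Cmm φ σ := by
  constructor
  · intro h x v
    have := h x (e (s x) v)
    simpa using this
  · intro h x v
    simp [h x]

variable (s t) in
/-- number of semistable representations with a `p`-primary endomorphism -/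
noncomputable def nT (F : Type) [Field F] {ι Ar : Type} [Fintype ι] (s t : Ar → ι) (w : ι → ℚ) (p : Polynomial F) (α : ι → ℕ) : ℕ :=
  Nat.card {z : (∀ i, stdV F α i →ₗ[F] stdV F α i) × FRep F s t (stdV F α) //
    SS w z.2 ∧ Cmm z.1 z.2 ∧ ∀ i, IsNilpotent (Polynomial.aeval (z.1 i) p)}

variable (p : Polynomial F) {N : ℕ} [hp : Fact (Irreducible p)]

/-- type of a family of endomorphisms -/
def Ty (m : ι → Fin N → ℕ) (φ : ∀ i, V i →ₗ[F] V i) : Prop :=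
  ∃ e : ∀ i, V i ≃ₗ[F] DD p (m i), ∀ i v, e i (φ i v) = (Polynomial.X : Polynomial F) • e i v

theorem Ty_unique [Fintype F] {m m' : ι → Fin N → ℕ} {φ : ∀ i, V i →ₗ[F] V i} (h : Ty p m φ) (h' : Ty p m' φ) : m = m' := by
  obtain ⟨e, he⟩ := h
  obtain ⟨e', he'⟩ := h'
  funext i
  let f := polyLin ((e i).symm.trans (e' i)).toLinearMap (fun v => by
    obtain ⟨u, rfl⟩ := (e i).surjective v
    rw [← he]
    simp [he'])
  refine type_unique p (LinearEquiv.ofBijective f ?_)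
  exact ((e i).symm.trans (e' i)).bijective

theorem Ty_nilp {m : ι → Fin N → ℕ} {φ : ∀ i, V i →ₗ[F] V i} (h : Ty p m φ) (i : ι) :
    IsNilpotent (Polynomial.aeval (φ i) p) := by
  obtain ⟨e, he⟩ := h
  have : φ i = LinearEquiv.conjAlgEquiv F (e i).symm (Xmul p (m i)) := by
    refine LinearMap.ext fun v => ?_
    change _ = (e i).symm (Xmul p (m i) (e i v))
    rw [Xmul_apply, ← he]; simp
  rw [this, Polynomial.aeval_algHom_apply]
  exact (nilp_Xmul p (m i)).map _

theorem Ty_exists [∀ i, Module.Finite F (V i)] (φ : ∀ i, V i →ₗ[F] V i)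
    (h : ∀ i, IsNilpotent (Polynomial.aeval (φ i) p)) (hN : ∀ i, Module.finrank F (V i) ≤ N) :
    ∃ m : ι → Fin N → ℕ, Ty p m φ := by
  choose m e he using fun i => exists_type p (φ i) (h i) (hN i)
  exact ⟨m, e, he⟩

theorem card_Ty [Fintype F] [Fintype Ar] [∀ i, Module.Finite F (V i)] (w : ι → ℚ) (m : ι → Fin N → ℕ)
    (e0 : ∀ i, V i ≃ₗ[F] DD p (m i)) :
    Nat.card {z : (∀ i, V i →ₗ[F] V i) × FRep F s t V // SS w z.2 ∧ Cmm z.1 z.2 ∧ Ty p m z.1} *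
      (∏ i, Nat.card (DD p (m i) ≃ₗ[Polynomial F] DD p (m i))) =
    Nat.card (∀ i, V i ≃ₗ[F] V i) * nTau p s t w m := by
  have hfin : ∀ i, Finite (V i →ₗ[F] V i) := fun i => Module.finite_of_finite F
  let φ0 : ∀ i, V i →ₗ[F] V i := cjF (fun i => (e0 i).symm) (fun i => Xmul p (m i))
  have hφ0 : ∀ i v, e0 i (φ0 i v) = (Polynomial.X : Polynomial F) • e0 i v := by
    intro i v; simp [φ0, Xmul_apply]
  let act : (∀ i, V i ≃ₗ[F] V i) → ((∀ i, V i →ₗ[F] V i) × FRep F s t V) → ((∀ i, V i →ₗ[F] V i) × FRep F s t V) :=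
    fun g z => (cjF g z.1, trF g z.2)
  have act_mul : ∀ g h x, act g (act h x) = act (g * h) x := fun _ _ _ => rfl
  have act_one : ∀ x, act 1 x = x := fun _ => rfl
  have key := groupoid_count act act_mul act_one
    {z | SS w z.2 ∧ Cmm z.1 z.2 ∧ Ty p m z.1} {z | SS w z.2 ∧ Cmm z.1 z.2 ∧ z.1 = φ0}
    {g | cjF g φ0 = φ0} ?_ ?_ ?_
  · have hY : Nat.card {z : (∀ i, V i →ₗ[F] V i) × FRep F s t V | SS w z.2 ∧ Cmm z.1 z.2 ∧ z.1 = φ0} = nTau p s t w m := by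
      have hc : ∀ z : {z : (∀ i, V i →ₗ[F] V i) × FRep F s t V | SS w z.2 ∧ Cmm z.1 z.2 ∧ z.1 = φ0}, ∀ x v,
          trF e0 z.1.2 x ((Polynomial.X : Polynomial F) • v) = (Polynomial.X : Polynomial F) • trF e0 z.1.2 x v := by
        rintro ⟨⟨φ, σ⟩, h1, h2, h3⟩ x v
        obtain ⟨u, rfl⟩ := (e0 (s x)).surjective v
        change φ = φ0 at h3
        subst h3
        change trF e0 σ x _ = _ • trF e0 σ x _
        rw [← hφ0, trF_apply, trF_apply, LinearEquiv.symm_apply_apply, LinearEquiv.symm_apply_apply, ← hφ0]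
        congr 1
        exact (h2 x u).symm
      refine Nat.card_congr
        { toFun := fun z => ⟨fun x => polyLin (trF e0 z.1.2 x) (hc z x), ?_⟩
          invFun := fun τ => ⟨(φ0, trF (fun i => (e0 i).symm) (fun x => (τ.1 x).restrictScalars F)), ?_, ?_, rfl⟩
          left_inv := ?_
          right_inv := ?_ }
      · exact (SS_trF w e0 z.1.2).2 z.2.1
      · exact (SS_trF w _ _).2 τ.2
      · intro x v
        apply (e0 (t x)).injective
        rw [hφ0]
        simp only [trF_apply, LinearEquiv.apply_symm_apply, LinearEquiv.symm_symm]
        rw [hφ0]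
        exact ((τ.1 x).map_smul _ _).symm
      · rintro ⟨⟨φ, σ⟩, h1, h2, h3⟩
        apply Subtype.ext
        refine Prod.ext h3.symm ?_
        funext x
        refine LinearMap.ext fun v => ?_
        change (e0 (t x)).symm (e0 (t x) (σ x ((e0 (s x)).symm (e0 (s x) v)))) = σ x v
        simp
      · rintro ⟨τ, hτ⟩
        apply Subtype.ext
        funext x
        refine LinearMap.ext fun v => ?_
        change e0 (t x) ((e0 (t x)).symm (τ x (e0 (s x) ((e0 (s x)).symm v)))) = τ x v
        simp
    have hH : Nat.card {g : (∀ i, V i ≃ₗ[F] V i) | cjF g φ0 = φ0} = ∏ i, Nat.card (DD p (m i) ≃ₗ[Polynomial F] DD p (m i)) := by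
      rw [← Nat.card_pi]
      have hc : ∀ g : {g : (∀ i, V i ≃ₗ[F] V i) | cjF g φ0 = φ0}, ∀ i v,
          ((e0 i).symm.trans ((g.1 i).trans (e0 i))).toLinearMap ((Polynomial.X : Polynomial F) • v) =
            (Polynomial.X : Polynomial F) • ((e0 i).symm.trans ((g.1 i).trans (e0 i))).toLinearMap v := by
        rintro ⟨g, hg⟩ i v
        obtain ⟨u, rfl⟩ := (e0 i).surjective v
        rw [← hφ0]
        have h3 := LinearMap.congr_fun (congrFun hg i) (g i u)
        rw [cjF_apply, LinearEquiv.symm_apply_apply] at h3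
        change e0 i (g i ((e0 i).symm (e0 i (φ0 i u)))) = _ • e0 i (g i ((e0 i).symm (e0 i u)))
        rw [LinearEquiv.symm_apply_apply, LinearEquiv.symm_apply_apply, h3, hφ0]
      refine Nat.card_congr
        { toFun := fun g i => LinearEquiv.ofBijective (polyLin ((e0 i).symm.trans ((g.1 i).trans (e0 i))).toLinearMap (hc g i)) ((e0 i).symm.trans ((g.1 i).trans (e0 i))).bijective
          invFun := fun h => ⟨fun i => (e0 i).trans (((h i).restrictScalars F).trans (e0 i).symm), ?_⟩
          left_inv := ?_
          right_inv := ?_ }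
      · funext i
        refine LinearMap.ext fun v => ?_
        apply (e0 i).injective
        rw [hφ0, cjF_apply]
        change e0 i ((e0 i).symm ((h i) (e0 i (φ0 i ((e0 i).symm ((h i).symm (e0 i v))))))) = _
        rw [hφ0, map_smul]; simp
      · rintro ⟨g, hg⟩
        apply Subtype.ext
        funext i
        refine LinearEquiv.ext fun v => ?_
        change (e0 i).symm (e0 i (g i ((e0 i).symm (e0 i v)))) = g i v
        simp
      · intro h
        funext i
        refine LinearEquiv.ext fun v => ?_
        change e0 i ((e0 i).symm ((h i) (e0 i ((e0 i).symm v)))) = h i v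
        simp
    rw [hH, hY] at key
    exact key
  · rintro ⟨φ, σ⟩ ⟨h1, h2, e, he⟩
    let g : ∀ i, V i ≃ₗ[F] V i := fun i => (e0 i).trans (e i).symm
    refine ⟨g, act g⁻¹ (φ, σ), ⟨(SS_trF w _ _).2 h1, (Cmm_tr _ _ _).2 h2, ?_⟩, by rw [act_mul, mul_inv_cancel, act_one]⟩
    funext i
    refine LinearMap.ext fun v => ?_
    apply (e0 i).injective
    rw [hφ0]
    change e0 i ((e0 i).symm (e i (φ i ((e i).symm (e0 i v))))) = _
    rw [LinearEquiv.apply_symm_apply, he, LinearEquiv.apply_symm_apply]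
  · rintro ⟨φ, σ⟩ ⟨h1, h2, h3⟩ g
    change φ = φ0 at h3
    subst h3
    refine ⟨(SS_trF w _ _).2 h1, (Cmm_tr _ _ _).2 h2, fun i => (g i).symm.trans (e0 i), fun i v => ?_⟩
    change e0 i ((g i).symm (g i (φ0 i ((g i).symm v)))) = _ • e0 i ((g i).symm v)
    rw [LinearEquiv.symm_apply_apply, hφ0]
  · rintro ⟨φ, σ⟩ ⟨h1, h2, h3⟩ g
    change φ = φ0 at h3
    subst h3
    constructor
    · rintro ⟨_, _, h⟩
      exact h
    · intro h
      exact ⟨(SS_trF w _ _).2 h1, (Cmm_tr _ _ _).2 h2, h⟩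

end Pairs


/-! ### Part C7: rationality of the count of pairs -/

theorem rat_T {ι Ar : Type} [Fintype ι] [Fintype Ar] (s t : Ar → ι) (w : ι → ℚ) (d : ℕ) (hd : 1 ≤ d) (α : ι → ℕ) :
    ∃ r ∈ ratS, ∀ (F : Type) [Field F] [Fintype F] (p : Polynomial F), Irreducible p → p.natDegree = d →
      (nT F s t w p α : ℚ) = r (Fintype.card F) := by
  let N := ∑ i, α i
  choose rS hrS hS using fun β : ι → ℕ => rat_SS s t w β
  let adm : Finset (ι → Fin N → ℕ) :=
    (Fintype.piFinset fun i => Fintype.piFinset fun k => Finset.range (α i + 1)).filter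
      fun m => ∀ i, ∑ k : Fin N, m i k * ((k.1 + 1) * d) = α i
  let hom : (Fin N → ℕ) → (Fin N → ℕ) → ℕ := fun a b => ∑ k : Fin N, ∑ l : Fin N, a k * b l * (min (k.1 + 1) (l.1 + 1) * d)
  let aut : (Fin N → ℕ) → ℕ → ℚ := fun a q => (q : ℚ) ^ (hom a a) * (∏ k, glq (q ^ d) (a k)) / (((q : ℚ) ^ d) ^ (∑ k, a k * a k))
  let tau : (ι → Fin N → ℕ) → ℕ → ℚ := fun m q => ((∏ x, (q : ℚ) ^ hom (m (s x)) (m (t x))) * ∏ k, rS (fun i => m i k) (q ^ d)) /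
    ((q : ℚ) ^ d) ^ (∑ x, ∑ k, m (s x) k * m (t x) k)
  have hq2 : ∀ q : ℕ, 2 ≤ q → (q : ℚ) ≠ 0 := fun q hq => by positivity
  have hpd : ∀ e : ℕ, (fun q : ℕ => ((q : ℚ) ^ d) ^ e) ∈ ratS := fun e => by
    simpa [← pow_mul] using ratS_pow (d * e)
  have hglq : ∀ a, (fun q => glq (q ^ d) a) ∈ ratS := fun a => ratS_comp (ratS_glq a) hd
  have hglq0 : ∀ q, 2 ≤ q → ∀ a, glq (q ^ d) a ≠ 0 := fun q hq a =>
    glq_ne_zero (hq.trans (Nat.le_self_pow (by omega) q)) a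
  have haut : ∀ a, aut a ∈ ratS := fun a => by
    refine ratS_div (ratS_mul (ratS_pow _) (ratS_prod _ fun k _ => hglq _)) (hpd _) fun q hq => ?_
    exact pow_ne_zero _ (pow_ne_zero _ (hq2 q hq))
  have haut0 : ∀ a q, 2 ≤ q → aut a q ≠ 0 := fun a q hq => by
    refine div_ne_zero (mul_ne_zero (pow_ne_zero _ (hq2 q hq)) (Finset.prod_ne_zero_iff.2 fun k _ => hglq0 q hq _)) ?_
    exact pow_ne_zero _ (pow_ne_zero _ (hq2 q hq))
  have htau : ∀ m, tau m ∈ ratS := fun m => by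
    refine ratS_div (ratS_mul (ratS_prod _ fun x _ => ratS_pow _) (ratS_prod _ fun k _ => ratS_comp (hrS _) hd)) (hpd _) fun q hq => ?_
    exact pow_ne_zero _ (pow_ne_zero _ (hq2 q hq))
  refine ⟨fun q => ∑ m ∈ adm, (∏ i, glq q (α i)) * tau m q / ∏ i, aut (m i) q, ?_, ?_⟩
  · refine ratS_sum _ fun m _ => ratS_div (ratS_mul (ratS_prod _ fun i _ => ratS_glq _) (htau m)) (ratS_prod _ fun i _ => haut _) fun q hq => ?_
    exact Finset.prod_ne_zero_iff.2 fun i _ => haut0 _ q hq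
  intro F _ _ p hp hpdeg
  have : Fact (Irreducible p) := ⟨hp⟩
  have hF2 : 2 ≤ Fintype.card F := Fintype.one_lt_card
  have hdim : ∀ m : ι → Fin N → ℕ, ∀ i, Module.finrank F (DD p (m i)) = ∑ k : Fin N, m i k * ((k.1 + 1) * d) := by
    intro m i; rw [DD_finrank, hpdeg]
  have hfin : ∀ i, Finite (stdV F α i →ₗ[F] stdV F α i) := fun i => Module.finite_of_finite F
  have hX := Fintype.ofFinite ((∀ i, stdV F α i →ₗ[F] stdV F α i) × FRep F s t (stdV F α))
  have hsplit : nT F s t w p α = ∑ m ∈ adm, Nat.card {z : (∀ i, stdV F α i →ₗ[F] stdV F α i) × FRep F s t (stdV F α) //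
      SS w z.2 ∧ Cmm z.1 z.2 ∧ Ty p m z.1} := by
    have hex : ∀ z : (∀ i, stdV F α i →ₗ[F] stdV F α i) × FRep F s t (stdV F α), (∀ i, IsNilpotent (Polynomial.aeval (z.1 i) p)) →
        ∃ m : ι → Fin N → ℕ, Ty p m z.1 := fun z hz => Ty_exists p z.1 hz fun i => by
      rw [Module.finrank_fin_fun]
      exact Finset.single_le_sum (f := α) (fun _ _ => Nat.zero_le _) (Finset.mem_univ i)
    let mm : (∀ i, stdV F α i →ₗ[F] stdV F α i) × FRep F s t (stdV F α) → (ι → Fin N → ℕ) := fun z =>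
      if h : (∀ i, IsNilpotent (Polynomial.aeval (z.1 i) p)) then (hex z h).choose else 0
    rw [nT, Nat.card_eq_fintype_card, Fintype.card_subtype,
      Finset.card_eq_sum_card_fiberwise (f := mm) (t := adm)]
    · refine Finset.sum_congr rfl fun m _ => ?_
      rw [Nat.card_eq_fintype_card, Fintype.card_subtype, Finset.filter_filter]
      congr 1
      ext z
      simp only [Finset.mem_filter, Finset.mem_univ, true_and]
      constructor
      · rintro ⟨⟨h1, h2, h3⟩, h4⟩
        refine ⟨h1, h2, ?_⟩
        simp only [mm, dif_pos h3] at h4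
        rw [← h4]; exact (hex z h3).choose_spec
      · rintro ⟨h1, h2, h3⟩
        have h4 := Ty_nilp p h3
        refine ⟨⟨h1, h2, h4⟩, ?_⟩
        simp only [mm, dif_pos h4]
        exact Ty_unique p (hex z h4).choose_spec h3
    · intro z hz
      have hz' := (Finset.mem_filter.1 hz).2.2.2
      simp only [mm, dif_pos hz']
      obtain ⟨e, he⟩ := (hex z hz').choose_spec
      set m := (hex z hz').choose
      have hm : ∀ i, ∑ k : Fin N, m i k * ((k.1 + 1) * d) = α i := fun i => by
        rw [← hdim, ← (e i).finrank_eq, Module.finrank_fin_fun]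
      refine Finset.mem_coe.2 (Finset.mem_filter.2 ⟨?_, hm⟩)
      rw [Fintype.mem_piFinset]; intro i
      rw [Fintype.mem_piFinset]; intro k
      rw [Finset.mem_range, Nat.lt_succ_iff, ← hm i]
      refine le_trans ?_ (Finset.single_le_sum (f := fun k : Fin N => m i k * ((k.1 + 1) * d)) (fun _ _ => Nat.zero_le _) (Finset.mem_univ k))
      exact Nat.le_mul_of_pos_right _ (by positivity)
  rw [hsplit]; push_cast
  refine Finset.sum_congr rfl fun m hm => ?_
  have hm' := (Finset.mem_filter.1 hm).2
  have e0 : ∀ i, stdV F α i ≃ₗ[F] DD p (m i) := fun i =>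
    (toStd F (DD p (m i)) (by rw [hdim, hm'])).symm
  have hcount := card_Ty (s := s) (t := t) p w m e0
  have hA : ∀ a : Fin N → ℕ, (Nat.card (DD p a ≃ₗ[Polynomial F] DD p a) : ℚ) = aut a (Fintype.card F) := by
    intro a
    rw [card_autDD, card_homDD, hpdeg]; push_cast; rfl
  have hT : (nTau p s t w m : ℚ) = tau m (Fintype.card F) := by
    have h1 := card_tau p s t w m
    have hz : (((Fintype.card F : ℚ) ^ d) ^ (∑ x, ∑ k, m (s x) k * m (t x) k)) ≠ 0 := pow_ne_zero _ (pow_ne_zero _ (hq2 _ hF2))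
    rw [eq_div_iff hz]
    have h2 := congrArg (Nat.cast : ℕ → ℚ) h1
    push_cast at h2
    rw [hpdeg] at h2
    rw [h2]
    congr 1
    · refine Finset.prod_congr rfl fun x _ => ?_
      rw [card_homDD, hpdeg]; push_cast; rfl
    · refine Finset.prod_congr rfl fun k _ => ?_
      rw [hS, Qm_fcard, hpdeg]
  have h3 := congrArg (Nat.cast : ℕ → ℚ) hcount
  push_cast at h3
  rw [hT, card_GLpi α (fun i => by simp), Finset.prod_congr rfl fun i _ => hA (m i)] at h3
  rw [eq_div_iff (Finset.prod_ne_zero_iff.2 fun i _ => haut0 _ _ hF2), h3]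


/-! ### Part D1: finite local rings and indecomposable finite modules -/

theorem exists_idem_pow {M : Type*} [Monoid M] [Finite M] (f : M) :
    ∃ n, 0 < n ∧ f ^ n * f ^ n = f ^ n := by
  have hni : ¬ Function.Injective (fun n : ℕ => f ^ n) := not_injective_infinite_finite _
  rw [Function.Injective] at hni
  push Not at hni
  obtain ⟨a, b, hab, hne⟩ := hni
  wlog hlt : a < b generalizing a b
  · exact this b a hab.symm hne.symm (lt_of_le_of_ne (not_lt.1 hlt) hne.symm)
  obtain ⟨c, rfl⟩ := Nat.exists_eq_add_of_lt hlt
  have h1 : ∀ k j, a ≤ k → f ^ (k + j * (c + 1)) = f ^ k := by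
    intro k j hk
    induction j with
    | zero => simp
    | succ j ih =>
      obtain ⟨l, rfl⟩ := Nat.exists_eq_add_of_le hk
      rw [← ih]
      have : a + l + (j + 1) * (c + 1) = (a + c + 1) + (l + j * (c + 1)) := by ring
      rw [this, pow_add, ← hab, ← pow_add]
      congr 1; ring
  refine ⟨(a + 1) * (c + 1), by positivity, ?_⟩
  rw [← pow_add]
  exact h1 _ _ (by nlinarith)

/-- indecomposable modules -/
def Indec (A X : Type) [Ring A] [AddCommGroup X] [Module A X] : Prop :=
  Nontrivial X ∧ ∀ e : Module.End A X, e * e = e → e = 0 ∨ e = 1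

section
variable {A : Type} [Ring A] {X Y : Type} [AddCommGroup X] [Module A X]
  [AddCommGroup Y] [Module A Y]

instance finLin [Finite X] [Finite Y] : Finite (X →ₗ[A] Y) :=
  Finite.of_injective (fun f => (f : X → Y)) DFunLike.coe_injective

theorem Indec.congr (e : X ≃ₗ[A] Y) (h : Indec A X) : Indec A Y := by
  refine ⟨haveI := h.1; e.symm.toEquiv.nontrivial, fun f hf => ?_⟩
  rcases h.2 (e.symm.conjRingEquiv f) (by rw [← map_mul, hf]) with h | h
  · left
    rwa [map_eq_zero_iff _ (RingEquiv.injective _)] at h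
  · right
    rwa [map_eq_one_iff _ (RingEquiv.injective _)] at h

theorem Indec.local [Finite X] (h : Indec A X) : IsLocalRing (Module.End A X) := by
  haveI := h.1
  refine IsLocalRing.of_isUnit_or_isUnit_one_sub_self fun f => ?_
  obtain ⟨n, hn, hf⟩ := exists_idem_pow f
  rcases h.2 _ hf with h0 | h1
  · right
    exact IsNilpotent.isUnit_one_sub ⟨n, h0⟩
  · left
    exact IsUnit.of_pow_eq_one h1 (by omega)

theorem Indec.isUnit_of_comp [Finite X] [Finite Y] (hX : Indec A X) (hY : Indec A Y)
    (f : X →ₗ[A] Y) (g : Y →ₗ[A] X) (h : IsUnit (g ∘ₗ f : Module.End A X)) :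
    Function.Bijective f := by
  obtain ⟨u, hu⟩ := h
  have hl : ∀ v, (↑u⁻¹ : Module.End A X) (g (f v)) = v := by
    intro v
    have : (↑u⁻¹ * ↑u : Module.End A X) v = v := by simp
    rwa [hu] at this
  have h1 := hY.2 (f ∘ₗ (↑u⁻¹ : Module.End A X) ∘ₗ g) (by
    refine LinearMap.ext fun v => ?_
    simp only [Module.End.mul_apply, LinearMap.comp_apply]
    rw [hl])
  refine ⟨fun a b hab => by rw [← hl a, hab, hl], ?_⟩
  rcases h1 with h1 | h1
  · exfalso
    haveI := hX.1
    obtain ⟨v, hv⟩ := exists_ne (0 : X)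
    have h2 := congrArg (fun φ => φ (f v)) h1
    simp only [LinearMap.comp_apply, LinearMap.zero_apply] at h2
    rw [hl] at h2
    apply hv
    rw [← hl v, h2]; simp
  · intro v
    exact ⟨_, congrArg (fun φ => φ v) h1⟩

end

theorem residue (F : Type) [Field F] [Fintype F] (R : Type) [Ring R] [Finite R] [IsLocalRing R]
    [Algebra F R] : ∃ (K : Type) (_ : Field K) (_ : Fintype K) (_ : Algebra F K) (π : R →ₐ[F] K),
      Function.Surjective π ∧ ∀ f, π f = 0 ↔ ¬ IsUnit f := by
  have hmul : ∀ a b : R, IsUnit (a * b) → IsUnit a ∧ IsUnit b := by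
    intro a b h
    rw [IsUnit.mul_iff] at h
    exact h
  let I : Ideal R :=
    { carrier := {f | ¬ IsUnit f}
      add_mem' := fun ha hb => IsLocalRing.nonunits_add ha hb
      zero_mem' := not_isUnit_zero
      smul_mem' := fun c x hx h => hx (hmul _ _ h).2 }
  haveI : I.IsTwoSided := ⟨fun b ha h => ha (hmul _ _ h).1⟩
  have hI : ∀ f, f ∈ I ↔ ¬ IsUnit f := fun f => Iff.rfl
  haveI : Finite (R ⧸ I) := Finite.of_surjective _ Ideal.Quotient.mk_surjective
  haveI : Nontrivial (R ⧸ I) := Ideal.Quotient.nontrivial_iff.2 (by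
    rw [Ideal.ne_top_iff_one, hI]; simp)
  have hdom : IsDomain (R ⧸ I) := by
    haveI : NoZeroDivisors (R ⧸ I) := by
      refine ⟨fun {a b} h => ?_⟩
      obtain ⟨a, rfl⟩ := Ideal.Quotient.mk_surjective a
      obtain ⟨b, rfl⟩ := Ideal.Quotient.mk_surjective b
      rw [← map_mul, Ideal.Quotient.eq_zero_iff_mem, hI, IsUnit.mul_iff] at h
      rw [Ideal.Quotient.eq_zero_iff_mem, Ideal.Quotient.eq_zero_iff_mem, hI, hI]
      tauto
    exact NoZeroDivisors.to_isDomain _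
  have hf : IsField (R ⧸ I) := Finite.isDomain_to_isField _
  refine ⟨R ⧸ I, hf.toField, Fintype.ofFinite _, ?_⟩
  letI : Field (R ⧸ I) := hf.toField
  refine ⟨(inferInstance : @Algebra F (R ⧸ I) _ (Ideal.Quotient.ring I).toSemiring), ?_⟩
  refine ⟨Ideal.Quotient.mkₐ F I, Ideal.Quotient.mkₐ_surjective F I, fun f => ?_⟩
  rw [← hI]
  exact Ideal.Quotient.eq_zero_iff_mem

/-- residue degree of a finite local algebra -/
noncomputable def rdeg (F R : Type) [Field F] [Fintype F] [Ring R] : ℕ :=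
  Nat.log (Fintype.card F) (Nat.card R / Nat.card {f : R // ¬ IsUnit f})

theorem rdeg_eq (F R : Type) [Field F] [Fintype F] [Ring R] [Finite R] [Algebra F R] (K : Type) [Field K] [Fintype K]
    [Algebra F K] (π : R →ₐ[F] K) (hs : Function.Surjective π) (h : ∀ f, π f = 0 ↔ ¬ IsUnit f) :
    Module.finrank F K = rdeg F R := by
  have h1 := card_preimage_surj (A := R) (B := K) π.toRingHom.toAddMonoidHom hs (fun k => k = 0)
  have h2 : Nat.card {k : K // k = 0} = 1 := by simp
  have h3 : Nat.card {a : R // π.toRingHom.toAddMonoidHom a = 0} = Nat.card {f : R // ¬ IsUnit f} :=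
    Nat.card_congr (Equiv.subtypeEquivRight h)
  rw [h2, h3, mul_one] at h1
  have h4 : 0 < Nat.card {f : R // ¬ IsUnit f} := by
    haveI : Nonempty {f : R // ¬ IsUnit f} := ⟨⟨0, (h 0).1 (map_zero _)⟩⟩
    exact Nat.card_pos
  rw [rdeg, ← h1, Nat.mul_div_cancel_left _ h4, Nat.card_eq_fintype_card, Module.card_eq_pow_finrank (K := F) (V := K),
    Nat.log_pow Fintype.one_lt_card]

/-- number of `φ` with `p(φ)` nilpotent -/
noncomputable def Tp {F : Type} [Field F] (p : Polynomial F) (E : Type) [Ring E] [Algebra F E] : ℕ :=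
  Nat.card {φ : E // IsNilpotent (Polynomial.aeval φ p)}

theorem Tp_congr {F : Type} [Field F] (p : Polynomial F) {E E' : Type} [Ring E] [Algebra F E]
    [Ring E'] [Algebra F E'] (e : E ≃ₐ[F] E') : Tp p E = Tp p E' := by
  refine Nat.card_congr (Equiv.subtypeEquiv e.toEquiv fun φ => ?_)
  have : Polynomial.aeval (e φ) p = e (Polynomial.aeval φ p) := by
    rw [Polynomial.aeval_algEquiv]; rfl
  change _ ↔ IsNilpotent (Polynomial.aeval (e φ) p)
  rw [this, IsNilpotent.map_iff e.injective]

theorem Tp_nil {F : Type} [Field F] (p : Polynomial F) {E E' : Type} [Ring E] [Algebra F E] [Finite E]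
    [Ring E'] [Algebra F E'] (Φ : E →ₐ[F] E') (hs : Function.Surjective Φ)
    (hk : ∀ f, Φ f = 0 → IsNilpotent f) :
    Tp p E * Nat.card E'ˣ = Tp p E' * Nat.card Eˣ := by
  haveI : Finite E' := Finite.of_surjective _ hs
  have h1 := card_preimage_surj (A := E) (B := E') Φ.toRingHom.toAddMonoidHom hs
    (fun φ => IsNilpotent (Polynomial.aeval φ p))
  have h2 := card_preimage_surj (A := E) (B := E') Φ.toRingHom.toAddMonoidHom hs
    (fun φ => IsUnit φ)
  have h3 : Nat.card {a : E // IsNilpotent (Polynomial.aeval (Φ.toRingHom.toAddMonoidHom a) p)} = Tp p E := by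
    refine Nat.card_congr (Equiv.subtypeEquivRight fun φ => ?_)
    change IsNilpotent (Polynomial.aeval (Φ φ) p) ↔ _
    rw [Polynomial.aeval_algHom_apply]
    constructor
    · rintro ⟨n, hn⟩
      rw [← map_pow] at hn
      obtain ⟨k, hk⟩ := hk _ hn
      exact ⟨n * k, by rw [pow_mul, hk]⟩
    · exact fun h => h.map Φ
  have hU : ∀ (R : Type) [Ring R], Nat.card {a : R // IsUnit a} = Nat.card Rˣ := by
    intro R _
    refine (Nat.card_congr (Equiv.ofBijective (fun u : Rˣ => (⟨u, u.isUnit⟩ : {a : R // IsUnit a})) ⟨?_, ?_⟩)).symm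
    · intro a b hab
      exact Units.ext (congrArg Subtype.val hab)
    · rintro ⟨a, u, rfl⟩
      exact ⟨u, rfl⟩
  have h4 : Nat.card {a : E // IsUnit (Φ.toRingHom.toAddMonoidHom a)} = Nat.card Eˣ := by
    rw [← hU]
    refine Nat.card_congr (Equiv.subtypeEquivRight fun φ => ?_)
    change IsUnit (Φ φ) ↔ _
    constructor
    · rintro ⟨u, hu⟩
      obtain ⟨g, hg⟩ := hs (↑u⁻¹ : E')
      have : IsUnit (1 - (1 - φ * g)) := IsNilpotent.isUnit_one_sub (hk _ (by
        rw [map_sub, map_one, map_mul, hg, ← hu]; simp))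
      rw [sub_sub_cancel, IsUnit.mul_iff] at this
      exact this.1
    · exact fun h => h.map Φ
  rw [h3] at h1
  rw [h4] at h2
  rw [hU E'] at h2
  have hE' : 0 < Nat.card E' := Nat.card_pos
  have hE : 0 < Nat.card E := Nat.card_pos
  have e1 : Tp p E' = Nat.card {φ : E' // IsNilpotent (Polynomial.aeval φ p)} := rfl
  rw [← e1] at h1
  apply Nat.eq_of_mul_eq_mul_left (Nat.mul_pos hE hE')
  calc Nat.card E * Nat.card E' * (Tp p E * Nat.card E'ˣ)
      = (Tp p E * Nat.card E') * (Nat.card E * Nat.card E'ˣ) := by ring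
    _ = _ := by rw [h1, ← h2]; ring


/-! ### Part D2: Krull-Schmidt -/
section KS
variable {F : Type} [Field F] [Fintype F] {A : Type} [Ring A] [Algebra F A]
  {𝒳 : Type} [Fintype 𝒳] {X : 𝒳 → Type} [∀ x, AddCommGroup (X x)] [∀ x, Module A (X x)]
  [∀ x, Module F (X x)] [∀ x, IsScalarTower F A (X x)] [∀ x, Finite (X x)]
  {K : 𝒳 → Type} [∀ x, Field (K x)] [∀ x, Fintype (K x)] [∀ x, Algebra F (K x)]

theorem ks_zero (hX : ∀ x, Indec A (X x)) (hne : ∀ x y, Nonempty (X x ≃ₗ[A] X y) → x = y)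
    (π : ∀ x, Module.End A (X x) →ₐ[F] K x) (h0 : ∀ x f, π x f = 0 ↔ ¬ IsUnit f)
    (x y : 𝒳) (hxy : y ≠ x) (f : X x →ₗ[A] X y) (g : X y →ₗ[A] X x) : π x (g ∘ₗ f) = 0 := by
  rw [h0]
  intro h
  exact hxy (hne x y ⟨LinearEquiv.ofBijective f ((hX x).isUnit_of_comp (hX y) f g h)⟩).symm

variable (m : 𝒳 → ℕ)

theorem ks_sum {Z W : Type} [AddCommGroup Z] [Module A Z] [AddCommGroup W] [Module A W]
    (f : Z →ₗ[A] (∀ a : (Σ x, Fin (m x)), X a.1)) (g : (∀ a : (Σ x, Fin (m x)), X a.1) →ₗ[A] W) :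
    g ∘ₗ f = ∑ a : (Σ x, Fin (m x)), (g ∘ₗ LinearMap.single A (fun a : (Σ x, Fin (m x)) => X a.1) a) ∘ₗ
      (LinearMap.proj a ∘ₗ f) := by
  refine LinearMap.ext fun v => ?_
  rw [LinearMap.sum_apply]
  simp only [LinearMap.comp_apply, LinearMap.proj_apply, LinearMap.coe_single]
  rw [← map_sum]
  congr 1
  exact (Finset.univ_sum_single (f v)).symm

/-- matrix coefficients -/
noncomputable def ksC (f : Module.End A (∀ a : (Σ x, Fin (m x)), X a.1)) (a b : (Σ x, Fin (m x))) : X b.1 →ₗ[A] X a.1 :=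
  (LinearMap.proj a ∘ₗ f) ∘ₗ LinearMap.single A (fun a : (Σ x, Fin (m x)) => X a.1) b

/-- the map to products of matrix algebras -/
noncomputable def ksPhi (hX : ∀ x, Indec A (X x)) (hne : ∀ x y, Nonempty (X x ≃ₗ[A] X y) → x = y)
    (π : ∀ x, Module.End A (X x) →ₐ[F] K x) (h0 : ∀ x f, π x f = 0 ↔ ¬ IsUnit f) :
    Module.End A (∀ a : (Σ x, Fin (m x)), X a.1) →ₐ[F] (∀ x, Matrix (Fin (m x)) (Fin (m x)) (K x)) :=
  AlgHom.ofLinearMap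
    { toFun := fun f x => Matrix.of fun i j => π x (ksC m f ⟨x, i⟩ ⟨x, j⟩)
      map_add' := by
        intro f g
        funext x
        ext i j
        change π x _ = π x _ + π x _
        rw [← map_add]
        rfl
      map_smul' := by
        intro c f
        funext x
        ext i j
        change π x _ = c • π x _
        rw [← map_smul]
        rfl }
    (by
      funext x
      ext i j
      change π x _ = (1 : Matrix (Fin (m x)) (Fin (m x)) (K x)) i j
      by_cases hij : i = j
      · subst hij
        rw [Matrix.one_apply_eq, ← map_one (π x)]
        congr 1
        refine LinearMap.ext fun v => ?_
        simp [ksC]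
      · rw [Matrix.one_apply_ne hij, ← map_zero (π x)]
        congr 1
        refine LinearMap.ext fun v => ?_
        simp only [ksC, LinearMap.comp_apply, LinearMap.proj_apply, Module.End.one_apply, LinearMap.coe_single, LinearMap.zero_apply]
        have hne' : (⟨x, i⟩ : (Σ x, Fin (m x))) ≠ ⟨x, j⟩ := fun h => hij (by simpa using h)
        exact Pi.single_eq_of_ne (M := fun a : (Σ x, Fin (m x)) => X a.1) hne' v)
    (by
      intro f g
      funext x
      ext i j
      change π x _ = ((Matrix.of fun i j => π x (ksC m f ⟨x, i⟩ ⟨x, j⟩)) * (Matrix.of fun i j => π x (ksC m g ⟨x, i⟩ ⟨x, j⟩)) :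
        Matrix (Fin (m x)) (Fin (m x)) (K x)) i j
      rw [Matrix.mul_apply]
      simp only [Matrix.of_apply]
      have h1 : ksC m (f * g) ⟨x, i⟩ ⟨x, j⟩ = ∑ c : (Σ x, Fin (m x)), (ksC m f ⟨x, i⟩ c) ∘ₗ (ksC m g c ⟨x, j⟩) := by
        have := ks_sum m (g ∘ₗ LinearMap.single A (fun a : (Σ x, Fin (m x)) => X a.1) ⟨x, j⟩)
          (LinearMap.proj (⟨x, i⟩ : (Σ x, Fin (m x))) ∘ₗ f)
        exact this
      rw [h1, map_sum, Fintype.sum_sigma, Finset.sum_eq_single x]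
      · refine Finset.sum_congr rfl fun k _ => ?_
        rw [← map_mul]; rfl
      · intro y _ hy
        refine Finset.sum_eq_zero fun k _ => ?_
        exact ks_zero hX hne π h0 x y hy _ _
      · simp)

theorem ksPhi_apply (hX : ∀ x, Indec A (X x)) (hne : ∀ x y, Nonempty (X x ≃ₗ[A] X y) → x = y)
    (π : ∀ x, Module.End A (X x) →ₐ[F] K x) (h0 : ∀ x f, π x f = 0 ↔ ¬ IsUnit f) f x i j :
    ksPhi m hX hne π h0 f x i j = π x (ksC m f ⟨x, i⟩ ⟨x, j⟩) := rfl

theorem ksPhi_surj (hX : ∀ x, Indec A (X x)) (hne : ∀ x y, Nonempty (X x ≃ₗ[A] X y) → x = y)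
    (π : ∀ x, Module.End A (X x) →ₐ[F] K x) (h0 : ∀ x f, π x f = 0 ↔ ¬ IsUnit f)
    (hs : ∀ x, Function.Surjective (π x)) :
    Function.Surjective (ksPhi m hX hne π h0) := by
  intro N
  choose f hf using fun x (i j : Fin (m x)) => hs x (N x i j)
  refine ⟨LinearMap.pi (fun a => ∑ j, (f a.1 a.2 j) ∘ₗ LinearMap.proj (⟨a.1, j⟩ : (Σ x, Fin (m x)))), ?_⟩
  funext x
  ext i j
  rw [ksPhi_apply, ← hf x i j]
  congr 1
  refine LinearMap.ext fun v => ?_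
  simp only [ksC, LinearMap.comp_apply, LinearMap.proj_apply, LinearMap.pi_apply, LinearMap.coe_single,
    LinearMap.sum_apply]
  rw [Finset.sum_eq_single j]
  · rw [Pi.single_eq_same]
  · intro k _ hk
    rw [Pi.single_eq_of_ne, map_zero]
    intro h
    exact hk (by simpa using h)
  · simp

theorem ksPhi_ker (hX : ∀ x, Indec A (X x)) (hne : ∀ x y, Nonempty (X x ≃ₗ[A] X y) → x = y)
    (π : ∀ x, Module.End A (X x) →ₐ[F] K x) (h0 : ∀ x f, π x f = 0 ↔ ¬ IsUnit f) (f)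
    (hf : ksPhi m hX hne π h0 f = 0) : IsNilpotent f := by
  set M := (∀ a : (Σ x, Fin (m x)), X a.1)
  suffices H : ∀ e : Module.End A M, e * e = e → ksPhi m hX hne π h0 e = 0 → e = 0 by
    obtain ⟨n, hn, h⟩ := exists_idem_pow f
    exact ⟨n, H _ h (by rw [map_pow, hf, zero_pow (by omega)])⟩
  by_contra hcon
  push Not at hcon
  obtain ⟨e, ⟨he, hPe, hne0⟩, hmin⟩ := Set.Finite.exists_minimalFor
    (fun e : Module.End A M => Nat.card (LinearMap.range e))
    {e | e * e = e ∧ ksPhi m hX hne π h0 e = 0 ∧ e ≠ 0} (Set.toFinite _) hcon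
  have hee : ∀ v, e (e v) = e v := fun v => congrArg (fun φ => φ v) he
  have heN : ∀ v ∈ LinearMap.range e, e v = v := by
    rintro _ ⟨v, rfl⟩; exact hee v
  have hN : Indec A (LinearMap.range e) := by
    constructor
    · rw [Submodule.nontrivial_iff_ne_bot, Ne, LinearMap.range_eq_bot]
      exact hne0
    · intro g hg
      by_cases hg0 : g = 0
      · exact Or.inl hg0
      right
      have hgg : ∀ v, g (g v) = g v := fun v => congrArg (fun φ => φ v) hg
      let e' : Module.End A M := (LinearMap.range e).subtype ∘ₗ g ∘ₗ e.rangeRestrict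
      have her : ∀ v : LinearMap.range e, e.rangeRestrict v = v := fun v =>
        Subtype.ext (heN v.1 v.2)
      have he' : ∀ v, e' v = g (e.rangeRestrict v) := fun v => rfl
      have h1 : e' * e' = e' := by
        refine LinearMap.ext fun v => ?_
        rw [Module.End.mul_apply, he', he', her, hgg]
      have h2 : ksPhi m hX hne π h0 e' = 0 := by
        have : e' = e' * e := by
          refine LinearMap.ext fun v => ?_
          rw [Module.End.mul_apply, he', he']
          congr 2
          exact Subtype.ext (hee v).symm
        rw [this, map_mul, hPe, mul_zero]
      have h3 : e' ≠ 0 := by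
        intro h
        apply hg0
        refine LinearMap.ext fun v => ?_
        have := congrArg (fun φ => φ v.1) h
        rw [he', her] at this
        exact Subtype.ext this
      have hle : LinearMap.range e' ≤ LinearMap.range e := by
        rintro _ ⟨v, rfl⟩
        rw [he']; exact (g _).2
      have h4 := hmin (j := e') ⟨h1, h2, h3⟩
        (Nat.card_le_card_of_injective (Submodule.inclusion hle) (Submodule.inclusion_injective hle))
      have h5 : (LinearMap.range e' : Set M) = (LinearMap.range e : Set M) := by
        apply Set.eq_of_subset_of_ncard_le hle
        · exact h4
      refine LinearMap.ext fun v => ?_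
      have : v.1 ∈ (LinearMap.range e' : Set M) := by rw [h5]; exact v.2
      obtain ⟨u, hu⟩ := this
      rw [he'] at hu
      have hu' : g (e.rangeRestrict u) = v := Subtype.ext hu
      rw [← hu', hgg]; rfl
  haveI := hN.local
  let i : LinearMap.range e →ₗ[A] M := (LinearMap.range e).subtype
  let p : M →ₗ[A] LinearMap.range e := e.rangeRestrict
  have h1 : (p ∘ₗ e) ∘ₗ i = (1 : Module.End A (LinearMap.range e)) := by
    refine LinearMap.ext fun v => ?_
    refine Subtype.ext ?_
    change e (e v) = v
    rw [hee, heN _ v.2]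
  have h2 : IsUnit ((p ∘ₗ e) ∘ₗ i : Module.End A (LinearMap.range e)) := by rw [h1]; exact isUnit_one
  rw [ks_sum m] at h2
  obtain ⟨b, -, hb⟩ := IsLocalRing.exists_of_isUnit_sum h2
  have h3 : (p ∘ₗ e) ∘ₗ LinearMap.single A (fun a : (Σ x, Fin (m x)) => X a.1) b =
      p ∘ₗ (e ∘ₗ LinearMap.single A (fun a : (Σ x, Fin (m x)) => X a.1) b) := rfl
  have h4 : ∀ (g : (Σ x, Fin (m x)) → (X b.1 →ₗ[A] LinearMap.range e)) (f : LinearMap.range e →ₗ[A] X b.1),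
      (∑ a, g a) ∘ₗ f = ∑ a, g a ∘ₗ f := by
    intro g f
    refine LinearMap.ext fun v => ?_
    simp only [LinearMap.sum_apply, LinearMap.comp_apply]
  rw [h3, ks_sum m, h4] at hb
  obtain ⟨a, -, ha⟩ := IsLocalRing.exists_of_isUnit_sum hb
  have hb1 : Function.Bijective (LinearMap.proj b ∘ₗ i) := hN.isUnit_of_comp (hX b.1) _ _ ha
  have hb2 : Function.Bijective ((ksC m e a b) ∘ₗ (LinearMap.proj b ∘ₗ i)) :=
    hN.isUnit_of_comp (hX a.1) _ (p ∘ₗ LinearMap.single A (fun a : (Σ x, Fin (m x)) => X a.1) a) ha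
  have hb3 : Function.Bijective (ksC m e a b) := by
    rw [LinearMap.coe_comp] at hb2
    exact (Function.Bijective.of_comp_iff _ hb1).1 hb2
  obtain ⟨x, ia⟩ := a
  obtain ⟨y, ib⟩ := b
  obtain rfl : y = x := hne y x ⟨LinearEquiv.ofBijective _ hb3⟩
  have h5 : IsUnit (ksC m e ⟨y, ia⟩ ⟨y, ib⟩ : Module.End A (X y)) := by
    rw [Module.End.isUnit_iff]; exact hb3
  have h6 := congrFun (congrFun (congrFun hPe y) ia) ib
  rw [ksPhi_apply] at h6
  exact (h0 _ _).1 h6 h5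

theorem ks_count (hX : ∀ x, Indec A (X x)) (hne : ∀ x y, Nonempty (X x ≃ₗ[A] X y) → x = y)
    (π : ∀ x, Module.End A (X x) →ₐ[F] K x) (h0 : ∀ x f, π x f = 0 ↔ ¬ IsUnit f)
    (hs : ∀ x, Function.Surjective (π x)) (p : Polynomial F) :
    (Tp p (Module.End A (∀ a : (Σ x, Fin (m x)), X a.1)) : ℚ) /
      Nat.card (Module.End A (∀ a : (Σ x, Fin (m x)), X a.1))ˣ =
    ∏ x, (Tp p (Matrix (Fin (m x)) (Fin (m x)) (K x)) : ℚ) / glq (Fintype.card (K x)) (m x) := by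
  have h1 := Tp_nil p (ksPhi m hX hne π h0) (ksPhi_surj m hX hne π h0 hs) (ksPhi_ker m hX hne π h0)
  have h2 : Nat.card (∀ x, Matrix (Fin (m x)) (Fin (m x)) (K x))ˣ =
      ∏ x, Nat.card (Matrix (Fin (m x)) (Fin (m x)) (K x))ˣ := by
    rw [Nat.card_congr MulEquiv.piUnits.toEquiv, Nat.card_pi]
  have h3 : Tp p (∀ x, Matrix (Fin (m x)) (Fin (m x)) (K x)) =
      ∏ x, Tp p (Matrix (Fin (m x)) (Fin (m x)) (K x)) := by
    simp only [Tp]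
    rw [← Nat.card_pi]
    have : ∀ (φ : ∀ x, Matrix (Fin (m x)) (Fin (m x)) (K x)), IsNilpotent (Polynomial.aeval φ p) ↔
        ∀ x, IsNilpotent (Polynomial.aeval (φ x) p) := by
      intro φ
      have h4 : ∀ x, (Polynomial.aeval φ p) x = Polynomial.aeval (φ x) p := by
        intro x
        exact (Polynomial.aeval_algHom_apply (Pi.evalAlgHom F (fun x => Matrix (Fin (m x)) (Fin (m x)) (K x)) x) φ p).symm
      constructor
      · rintro ⟨n, hn⟩ x
        exact ⟨n, by rw [← h4]; exact congrFun hn x⟩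
      · intro h
        choose n hn using h
        refine ⟨∑ x, n x, ?_⟩
        funext x
        rw [Pi.pow_apply, h4]
        exact pow_eq_zero_of_le (Finset.single_le_sum (fun _ _ => Nat.zero_le _) (Finset.mem_univ x)) (hn x)
    rw [Nat.card_congr (Equiv.subtypeEquivRight this)]
    exact Nat.card_congr (Equiv.subtypePiEquivPi (β := fun x => Matrix (Fin (m x)) (Fin (m x)) (K x))
      (p := fun x φ => IsNilpotent (Polynomial.aeval φ p)))
  rw [h2, h3] at h1
  rw [Finset.prod_div_distrib]
  have h5 : ∏ x, glq (Fintype.card (K x)) (m x) = ((∏ x, Nat.card (Matrix (Fin (m x)) (Fin (m x)) (K x))ˣ : ℕ) : ℚ) := by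
    rw [Nat.cast_prod]
    exact Finset.prod_congr rfl fun x _ => (card_GL_eq _ _).symm
  rw [h5, div_eq_div_iff, ← Nat.cast_prod]
  · exact_mod_cast h1
  · haveI : Finite (Module.End A (∀ a : (Σ x, Fin (m x)), X a.1)) := inferInstance
    exact_mod_cast Nat.card_pos.ne'
  · rw [← h5]
    exact Finset.prod_ne_zero_iff.2 fun x _ => glq_ne_zero Fintype.one_lt_card _

/-- multiplicities are determined -/
theorem ks_mult (hX : ∀ x, Indec A (X x)) (hne : ∀ x y, Nonempty (X x ≃ₗ[A] X y) → x = y)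
    (π : ∀ x, Module.End A (X x) →ₐ[F] K x) (h0 : ∀ x f, π x f = 0 ↔ ¬ IsUnit f)
    (hs : ∀ x, Function.Surjective (π x)) (x : 𝒳) :
    Nat.card {f : X x →ₗ[A] (∀ a : (Σ x, Fin (m x)), X a.1) // ∀ g : (∀ a : (Σ x, Fin (m x)), X a.1) →ₗ[A] X x, ¬ IsUnit (g ∘ₗ f : Module.End A (X x))} *
      (Fintype.card (K x)) ^ (m x) = Nat.card (X x →ₗ[A] (∀ a : (Σ x, Fin (m x)), X a.1)) := by
  let δ : (X x →ₗ[A] (∀ a : (Σ x, Fin (m x)), X a.1)) →+ (Fin (m x) → K x) :=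
    { toFun := fun f i => π x (LinearMap.proj (⟨x, i⟩ : (Σ x, Fin (m x))) ∘ₗ f)
      map_zero' := by
        funext i
        change π x 0 = 0
        exact map_zero _
      map_add' := by
        intro f g
        funext i
        change π x _ = π x _ + π x _
        rw [← map_add]; rfl }
  have hδ : Function.Surjective δ := by
    intro c
    choose f hf using fun i => hs x (c i)
    refine ⟨∑ i, LinearMap.single A (fun a : (Σ x, Fin (m x)) => X a.1) ⟨x, i⟩ ∘ₗ f i, ?_⟩
    funext i
    rw [← hf i]
    change π x _ = _
    congr 1
    refine LinearMap.ext fun v => ?_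
    simp only [LinearMap.comp_apply, LinearMap.proj_apply, LinearMap.coe_single,
      LinearMap.sum_apply, Finset.sum_apply]
    rw [Finset.sum_eq_single i]
    · rw [Pi.single_eq_same]
    · intro k _ hk
      rw [Pi.single_eq_of_ne]
      intro h
      exact hk (by simpa using h.symm)
    · simp
  have h1 := card_preimage_surj (A := X x →ₗ[A] (∀ a : (Σ x, Fin (m x)), X a.1)) (B := Fin (m x) → K x) δ hδ (fun c => c = 0)
  have h2 : Nat.card {c : Fin (m x) → K x // c = 0} = 1 := by simp
  have h3 : Nat.card (Fin (m x) → K x) = (Fintype.card (K x)) ^ (m x) := by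
    simp [Nat.card_eq_fintype_card]
  rw [h2, h3, mul_one] at h1
  rw [← h1]
  congr 1
  refine Nat.card_congr (Equiv.subtypeEquivRight fun f => ?_)
  constructor
  · intro h
    funext i
    exact (h0 _ _).2 (h _)
  · intro h g
    rw [← h0, ks_sum m, map_sum, Fintype.sum_sigma]
    refine Finset.sum_eq_zero fun y _ => Finset.sum_eq_zero fun k _ => ?_
    by_cases hy : y = x
    · subst hy
      have h4 := congrFun h k
      change π y (LinearMap.proj (⟨y, k⟩ : (Σ x, Fin (m x))) ∘ₗ f) = 0 at h4
      have := map_mul (π y) (g ∘ₗ LinearMap.single A (fun a : (Σ x, Fin (m x)) => X a.1) ⟨y, k⟩) (LinearMap.proj (⟨y, k⟩ : (Σ x, Fin (m x))) ∘ₗ f)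
      rw [h4, mul_zero] at this
      exact this
    · exact ks_zero hX hne π h0 x y hy _ _

theorem ks_unique (hX : ∀ x, Indec A (X x)) (hne : ∀ x y, Nonempty (X x ≃ₗ[A] X y) → x = y)
    (π : ∀ x, Module.End A (X x) →ₐ[F] K x) (h0 : ∀ x f, π x f = 0 ↔ ¬ IsUnit f)
    (hs : ∀ x, Function.Surjective (π x)) (m m' : 𝒳 → ℕ)
    (e : (∀ a : (Σ x, Fin (m x)), X a.1) ≃ₗ[A] (∀ a : (Σ x, Fin (m' x)), X a.1)) : m = m' := by
  funext x
  have h1 := ks_mult m hX hne π h0 hs x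
  have h2 := ks_mult m' hX hne π h0 hs x
  have e1 : (X x →ₗ[A] (∀ a : (Σ x, Fin (m x)), X a.1)) ≃ (X x →ₗ[A] (∀ a : (Σ x, Fin (m' x)), X a.1)) :=
    { toFun := fun f => e.toLinearMap ∘ₗ f
      invFun := fun f => e.symm.toLinearMap ∘ₗ f
      left_inv := fun f => LinearMap.ext fun v => by simp
      right_inv := fun f => LinearMap.ext fun v => by simp }
  have e2 : Nat.card {f : X x →ₗ[A] (∀ a : (Σ x, Fin (m x)), X a.1) // ∀ g : (∀ a : (Σ x, Fin (m x)), X a.1) →ₗ[A] X x, ¬ IsUnit (g ∘ₗ f : Module.End A (X x))} =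
    Nat.card {f : X x →ₗ[A] (∀ a : (Σ x, Fin (m' x)), X a.1) // ∀ g : (∀ a : (Σ x, Fin (m' x)), X a.1) →ₗ[A] X x, ¬ IsUnit (g ∘ₗ f : Module.End A (X x))} := by
    refine Nat.card_congr
      { toFun := fun f => ⟨e.toLinearMap ∘ₗ f.1, fun g => f.2 (g ∘ₗ e.toLinearMap)⟩
        invFun := fun f => ⟨e.symm.toLinearMap ∘ₗ f.1, fun g => f.2 (g ∘ₗ e.symm.toLinearMap)⟩
        left_inv := fun f => Subtype.ext (LinearMap.ext fun v => by simp)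
        right_inv := fun f => Subtype.ext (LinearMap.ext fun v => by simp) }
  rw [e2, Nat.card_congr e1, ← h2] at h1
  haveI := (hX x).local
  have hpos : 0 < Nat.card {f : X x →ₗ[A] (∀ a : (Σ x, Fin (m' x)), X a.1) // ∀ g : (∀ a : (Σ x, Fin (m' x)), X a.1) →ₗ[A] X x, ¬ IsUnit (g ∘ₗ f : Module.End A (X x))} := by
    haveI : Nonempty {f : X x →ₗ[A] (∀ a : (Σ x, Fin (m' x)), X a.1) // ∀ g : (∀ a : (Σ x, Fin (m' x)), X a.1) →ₗ[A] X x, ¬ IsUnit (g ∘ₗ f : Module.End A (X x))} :=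
      ⟨⟨0, fun g => by rw [LinearMap.comp_zero]; exact not_isUnit_zero⟩⟩
    exact Nat.card_pos
  exact Nat.pow_right_injective Fintype.one_lt_card (Nat.eq_of_mul_eq_mul_left hpos h1)
end KS


/-! ### Part D3: representations as modules over a free algebra -/
section TMsec

/-- the algebra acting -/
abbrev QA (F : Type) [Field F] (ι Ar : Type) := FreeAlgebra F (ι ⊕ Ar)

variable {F : Type} [Field F] {ι Ar : Type} [Fintype ι] {s t : Ar → ι} {V V' : ι → Type}
  [∀ i, AddCommGroup (V i)] [∀ i, Module F (V i)]
  [∀ i, AddCommGroup (V' i)] [∀ i, Module F (V' i)]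

/-- total space of a representation -/
def TM (σ : FRep F s t V) : Type := ∀ i, V i

instance (σ : FRep F s t V) : AddCommGroup (TM σ) := inferInstanceAs (AddCommGroup (∀ i, V i))
instance (σ : FRep F s t V) : Module F (TM σ) := inferInstanceAs (Module F (∀ i, V i))
instance (σ : FRep F s t V) [∀ i, Finite (V i)] : Finite (TM σ) := inferInstanceAs (Finite (∀ i, V i))

/-- the action -/
noncomputable def TMact (σ : FRep F s t V) : QA F ι Ar →ₐ[F] Module.End F (TM σ) :=
  FreeAlgebra.lift F (Sum.elim
    (fun i => (LinearMap.single F V i ∘ₗ LinearMap.proj i : Module.End F (∀ i, V i)))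
    (fun x => (LinearMap.single F V (t x) ∘ₗ σ x ∘ₗ LinearMap.proj (s x) : Module.End F (∀ i, V i))))

noncomputable instance (σ : FRep F s t V) : Module (QA F ι Ar) (TM σ) :=
  Module.compHom _ (TMact σ).toRingHom

theorem TM_smul (σ : FRep F s t V) (a : QA F ι Ar) (v : TM σ) : a • v = TMact σ a v := rfl

instance (σ : FRep F s t V) : IsScalarTower F (QA F ι Ar) (TM σ) :=
  ⟨fun c a v => by rw [TM_smul, TM_smul, map_smul]; rfl⟩

/-- vectors supported at one vertex -/
noncomputable def sg (σ : FRep F s t V) (i : ι) (u : V i) : TM σ := (Pi.single i u : ∀ i, V i)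

theorem sg_same (σ : FRep F s t V) (i : ι) (u : V i) : sg σ i u i = u := Pi.single_eq_same i u
theorem sg_ne (σ : FRep F s t V) {i j : ι} (h : j ≠ i) (u : V i) : sg σ i u j = 0 := Pi.single_eq_of_ne h u

theorem TM_smul_e (σ : FRep F s t V) (i : ι) (v : TM σ) :
    (FreeAlgebra.ι F (Sum.inl i : ι ⊕ Ar)) • v = sg σ i (v i) := by
  rw [TM_smul, TMact, FreeAlgebra.lift_ι_apply]; rfl

theorem TM_smul_a (σ : FRep F s t V) (x : Ar) (v : TM σ) :
    (FreeAlgebra.ι F (Sum.inr x : ι ⊕ Ar)) • v = sg σ (t x) (σ x (v (s x))) := by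
  rw [TM_smul, TMact, FreeAlgebra.lift_ι_apply]; rfl

/-- a morphism of representations induces a linear map -/
noncomputable def famLin {σ : FRep F s t V} {σ' : FRep F s t V'} (φ : ∀ i, V i →ₗ[F] V' i)
    (h : ∀ x v, φ (t x) (σ x v) = σ' x (φ (s x) v)) : TM σ →ₗ[QA F ι Ar] TM σ' :=
  let f : TM σ →ₗ[F] TM σ' := LinearMap.pi (fun i => φ i ∘ₗ LinearMap.proj i)
  { toFun := f
    map_add' := f.map_add
    map_smul' := by
      intro a
      rw [RingHom.id_apply]
      have hf : ∀ (i : ι) (u : V i), f (sg σ i u) = sg σ' i (φ i u) := by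
        intro i u
        funext j
        change φ j (sg σ i u j) = _
        by_cases hj : j = i
        · subst hj; rw [sg_same, sg_same]
        · rw [sg_ne _ hj, sg_ne _ hj, map_zero]
      induction a using FreeAlgebra.induction with
      | grade0 r =>
        intro v
        rw [algebraMap_smul, algebraMap_smul]
        exact f.map_smul r v
      | grade1 g =>
        intro v
        rcases g with i | x
        · rw [TM_smul_e, TM_smul_e, hf]; rfl
        · rw [TM_smul_a, TM_smul_a, hf, h]; rfl
      | mul a b ha hb =>
        intro v
        rw [mul_smul, ha, hb, mul_smul]
      | add a b ha hb =>
        intro v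
        rw [add_smul, map_add, ha, hb, add_smul] }

theorem famLin_apply {σ : FRep F s t V} {σ' : FRep F s t V'} (φ : ∀ i, V i →ₗ[F] V' i)
    (h : ∀ x v, φ (t x) (σ x v) = σ' x (φ (s x) v)) (v : TM σ) (i : ι) : famLin φ h v i = φ i (v i) := rfl

/-- the components of a module map -/
noncomputable def famOf {σ : FRep F s t V} {σ' : FRep F s t V'} (f : TM σ →ₗ[QA F ι Ar] TM σ') (i : ι) : V i →ₗ[F] V' i where
  toFun u := f (sg σ i u) i
  map_add' u v := by
    have : sg σ i (u + v) = sg σ i u + sg σ i v := Pi.single_add i u v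
    rw [this]
    exact congrFun (f.map_add _ _) i
  map_smul' c u := by
    have h : sg σ i (c • u) = c • sg σ i u := Pi.single_smul i c u
    rw [h, RingHom.id_apply]
    have := f.map_smul_of_tower c (sg σ i u)
    exact congrFun this i

theorem famOf_apply {σ : FRep F s t V} {σ' : FRep F s t V'} (f : TM σ →ₗ[QA F ι Ar] TM σ') (v : TM σ) (i : ι) :
    famOf f i (v i) = f v i := by
  have h := f.map_smul (FreeAlgebra.ι F (Sum.inl i : ι ⊕ Ar)) v
  rw [TM_smul_e, TM_smul_e] at h
  have h2 := congrFun h i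
  rw [sg_same] at h2
  exact h2

theorem f_single {σ : FRep F s t V} {σ' : FRep F s t V'} (f : TM σ →ₗ[QA F ι Ar] TM σ') (i : ι) (u : V i) :
    f (sg σ i u) = sg σ' i (famOf f i u) := by
  funext j
  rw [← famOf_apply]
  by_cases hj : j = i
  · subst hj; rw [sg_same, sg_same]
  · rw [sg_ne _ hj, sg_ne _ hj, map_zero]

theorem famOf_comm {σ : FRep F s t V} {σ' : FRep F s t V'} (f : TM σ →ₗ[QA F ι Ar] TM σ') (x : Ar) (u : V (s x)) :
    famOf f (t x) (σ x u) = σ' x (famOf f (s x) u) := by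
  have h := f.map_smul (FreeAlgebra.ι F (Sum.inr x : ι ⊕ Ar)) (sg σ (s x) u)
  rw [TM_smul_a, TM_smul_a, sg_same, f_single, f_single] at h
  have h2 := congrFun h (t x)
  rw [sg_same, sg_same, sg_same] at h2
  exact h2

theorem famLin_famOf {σ : FRep F s t V} {σ' : FRep F s t V'} (f : TM σ →ₗ[QA F ι Ar] TM σ') :
    famLin (famOf f) (famOf_comm f) = f :=
  LinearMap.ext fun v => by funext i; rw [famLin_apply, famOf_apply]

theorem famOf_famLin {σ : FRep F s t V} {σ' : FRep F s t V'} (φ : ∀ i, V i →ₗ[F] V' i)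
    (h : ∀ x v, φ (t x) (σ x v) = σ' x (φ (s x) v)) : famOf (famLin φ h) = φ := by
  funext i
  refine LinearMap.ext fun u => ?_
  have := famOf_apply (famLin φ h) (sg σ i u) i
  rw [sg_same] at this
  rw [this, famLin_apply, sg_same]

/-- the components of endomorphisms, as an algebra map -/
noncomputable def famAlg (σ : FRep F s t V) : Module.End (QA F ι Ar) (TM σ) →ₐ[F] (∀ i, Module.End F (V i)) :=
  AlgHom.ofLinearMap
    { toFun := fun f => famOf f
      map_add' := fun f g => rfl
      map_smul' := fun c f => rfl }
    (by
      funext i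
      refine LinearMap.ext fun u => ?_
      change sg σ i u i = u
      rw [sg_same])
    (by
      intro f g
      funext i
      refine LinearMap.ext fun u => ?_
      change f (g (sg σ i u)) i = famOf f i (famOf g i u)
      rw [f_single, f_single, sg_same])

theorem famAlg_apply (σ : FRep F s t V) (f) : famAlg σ f = famOf f := rfl

theorem famAlg_inj (σ : FRep F s t V) : Function.Injective (famAlg σ) := by
  intro f g h
  refine LinearMap.ext fun v => ?_
  funext i
  rw [← famOf_apply, ← famOf_apply]
  exact congrArg (fun φ => φ (v i)) (congrFun h i)

theorem nilp_pi {κ : Type} [Fintype κ] {R : κ → Type} [∀ x, Ring (R x)] [∀ x, Algebra F (R x)] (p : Polynomial F)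
    (φ : ∀ x, R x) : IsNilpotent (Polynomial.aeval φ p) ↔ ∀ x, IsNilpotent (Polynomial.aeval (φ x) p) := by
  have h4 : ∀ x, (Polynomial.aeval φ p) x = Polynomial.aeval (φ x) p := by
    intro x
    exact (Polynomial.aeval_algHom_apply (Pi.evalAlgHom F R x) φ p).symm
  constructor
  · rintro ⟨n, hn⟩ x
    exact ⟨n, by rw [← h4]; exact congrFun hn x⟩
  · intro h
    choose n hn using h
    refine ⟨∑ x, n x, ?_⟩
    funext x
    rw [Pi.pow_apply, h4]
    exact pow_eq_zero_of_le (Finset.single_le_sum (fun _ _ => Nat.zero_le _) (Finset.mem_univ x)) (hn x)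

theorem Tp_TM (σ : FRep F s t V) (p : Polynomial F) :
    Nat.card {φ : ∀ i, V i →ₗ[F] V i // Cmm φ σ ∧ ∀ i, IsNilpotent (Polynomial.aeval (φ i) p)} =
      Tp p (Module.End (QA F ι Ar) (TM σ)) := by
  refine Nat.card_congr
    { toFun := fun φ => ⟨famLin φ.1 (fun x v => φ.2.1 x v), ?_⟩
      invFun := fun f => ⟨famOf f.1, fun x v => famOf_comm f.1 x v, ?_⟩
      left_inv := fun φ => Subtype.ext (famOf_famLin φ.1 (fun x v => φ.2.1 x v))
      right_inv := fun f => Subtype.ext (famLin_famOf _) }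
  · rw [← IsNilpotent.map_iff (famAlg_inj σ), ← Polynomial.aeval_algHom_apply, famAlg_apply,
      famOf_famLin, nilp_pi]
    exact φ.2.2
  · have := (nilp_pi p (famAlg σ f.1)).1
    rw [Polynomial.aeval_algHom_apply, IsNilpotent.map_iff (famAlg_inj σ)] at this
    exact this f.2

/-- isomorphisms -/
noncomputable def famIso (σ : FRep F s t V) (σ' : FRep F s t V') :
    {e : ∀ i, V i ≃ₗ[F] V' i // trF e σ = σ'} ≃ (TM σ ≃ₗ[QA F ι Ar] TM σ') where
  toFun e := LinearEquiv.ofLinear (famLin (fun i => (e.1 i).toLinearMap) (fun x v => by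
        have := congrArg (fun τ : FRep F s t V' => τ x (e.1 (s x) v)) e.2
        simp only [trF_apply, LinearEquiv.symm_apply_apply] at this
        exact this)) (famLin (fun i => (e.1 i).symm.toLinearMap) (fun x v => by
        have := congrArg (fun τ : FRep F s t V' => (e.1 (t x)).symm (τ x v)) e.2
        simp only [trF_apply, LinearEquiv.symm_apply_apply] at this
        exact this.symm)) (LinearMap.ext fun v => by
          funext i; rw [LinearMap.comp_apply, famLin_apply, famLin_apply]; simp)
        (LinearMap.ext fun v => by
          funext i; rw [LinearMap.comp_apply, famLin_apply, famLin_apply]; simp)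
  invFun f := ⟨fun i => LinearEquiv.ofLinear (famOf f.toLinearMap i) (famOf f.symm.toLinearMap i)
      (LinearMap.ext fun u => by
        have h := f_single f.symm.toLinearMap i u
        have h2 := congrFun (congrArg f h) i
        change f (f.symm _) i = f.toLinearMap _ i at h2
        rw [f_single, f.apply_symm_apply, sg_same, sg_same] at h2
        exact h2.symm)
      (LinearMap.ext fun u => by
        have h := f_single f.toLinearMap i u
        have h2 := congrFun (congrArg f.symm h) i
        change f.symm (f _) i = f.symm.toLinearMap _ i at h2
        rw [f_single, f.symm_apply_apply, sg_same, sg_same] at h2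
        exact h2.symm), by
      funext x
      refine LinearMap.ext fun u => ?_
      rw [trF_apply]
      change famOf f.toLinearMap (t x) _ = _
      rw [famOf_comm]
      congr 1
      exact LinearEquiv.apply_symm_apply (LinearEquiv.ofLinear (famOf f.toLinearMap (s x)) (famOf f.symm.toLinearMap (s x)) _ _) u⟩
  left_inv e := by
    refine Subtype.ext ?_
    funext i
    refine LinearEquiv.ext fun u => ?_
    change e.1 i (sg σ i u i) = _
    rw [sg_same]
  right_inv f := by
    refine LinearEquiv.ext fun v => ?_
    funext i
    exact famOf_apply f.toLinearMap v i

theorem card_units_TM (σ : FRep F s t V) :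
    Nat.card (Module.End (QA F ι Ar) (TM σ))ˣ = Nat.card {e : ∀ i, V i ≃ₗ[F] V i // trF e σ = σ} := by
  rw [Nat.card_congr (famIso σ σ)]
  exact Nat.card_congr (LinearMap.GeneralLinearGroup.generalLinearEquiv _ _).toEquiv

/-- product of representations -/
def prodR {J : Type} {G : J → ι → Type} [∀ j i, AddCommGroup (G j i)] [∀ j i, Module F (G j i)]
    (σ : ∀ j, FRep F s t (G j)) : FRep F s t (fun i => ∀ j, G j i) :=
  fun x => LinearMap.pi (fun j => σ j x ∘ₗ LinearMap.proj j)

noncomputable def prodIso {J : Type} {G : J → ι → Type} [∀ j i, AddCommGroup (G j i)] [∀ j i, Module F (G j i)]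
    (σ : ∀ j, FRep F s t (G j)) : TM (prodR σ) ≃ₗ[QA F ι Ar] ∀ j, TM (σ j) :=
  let f : TM (prodR σ) →ₗ[QA F ι Ar] ∀ j, TM (σ j) :=
    LinearMap.pi (fun j => famLin (σ := prodR σ) (σ' := σ j) (fun i => LinearMap.proj j) (fun x v => rfl))
  LinearEquiv.ofBijective f ⟨fun u v h => by
      funext i j
      exact congrFun (congrFun h j) i, fun v => ⟨fun i j => v j i, rfl⟩⟩

/-- restriction to a stable family -/
def resR (σ : FRep F s t V) (W : ∀ i, Submodule F (V i)) (h : Stb σ W) : FRep F s t (fun i => W i) :=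
  fun x => (σ x).restrict (fun v hv => h x v hv)

noncomputable def splitIso (σ : FRep F s t V) (W W' : ∀ i, Submodule F (V i)) (h : Stb σ W) (h' : Stb σ W')
    (hc : ∀ i, IsCompl (W i) (W' i)) :
    (TM (resR σ W h) × TM (resR σ W' h')) ≃ₗ[QA F ι Ar] TM σ :=
  LinearEquiv.ofBijective (LinearMap.coprod
      (famLin (σ := resR σ W h) (σ' := σ) (fun i => (W i).subtype) (fun x v => rfl))
      (famLin (σ := resR σ W' h') (σ' := σ) (fun i => (W' i).subtype) (fun x v => rfl))) (by
    constructor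
    · rw [injective_iff_map_eq_zero]
      rintro ⟨u, v⟩ huv
      have key : ∀ i, (u i : V i) = 0 ∧ (v i : V i) = 0 := by
        intro i
        have h1 := congrFun huv i
        change (u i : V i) + (v i : V i) = 0 at h1
        have h2 : (u i : V i) ∈ W i ⊓ W' i := ⟨(u i).2, by
          rw [eq_neg_of_add_eq_zero_left h1]; exact (W' i).neg_mem (v i).2⟩
        rw [(hc i).inf_eq_bot, Submodule.mem_bot] at h2
        exact ⟨h2, by rwa [h2, zero_add] at h1⟩
      refine Prod.ext ?_ ?_
      · funext i; exact Subtype.ext (key i).1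
      · funext i; exact Subtype.ext (key i).2
    · intro v
      have : ∀ i, ∃ a : W i, ∃ b : W' i, (a : V i) + b = v i := by
        intro i
        have : v i ∈ W i ⊔ W' i := by rw [(hc i).sup_eq_top]; trivial
        obtain ⟨a, ha, b, hb, hab⟩ := Submodule.mem_sup.1 this
        exact ⟨⟨a, ha⟩, ⟨b, hb⟩, hab⟩
      choose a b hab using this
      exact ⟨⟨a, b⟩, funext hab⟩)

/-- decomposable means splitting -/
theorem indec_iff (σ : FRep F s t V) : Indec (QA F ι Ar) (TM σ) ↔ Nontrivial (TM σ) ∧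
    ∀ W W' : ∀ i, Submodule F (V i), Stb σ W → Stb σ W' → (∀ i, IsCompl (W i) (W' i)) →
      W = ⊥ ∨ W' = ⊥ := by
  constructor
  · rintro ⟨h1, h2⟩
    refine ⟨h1, fun W W' hW hW' hc => ?_⟩
    let φ : ∀ i, V i →ₗ[F] V i := fun i => (W i).subtype ∘ₗ (W i).projectionOnto (W' i) (hc i)
    have hφ1 : ∀ i (v : V i), v ∈ W i → φ i v = v := by
      intro i v hv
      change ((W i).projectionOnto (W' i) (hc i) v : V i) = v
      rw [Submodule.projectionOnto_apply_of_mem_left (hc i) hv]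
    have hφ2 : ∀ i (v : V i), v ∈ W' i → φ i v = 0 := by
      intro i v hv
      change ((W i).projectionOnto (W' i) (hc i) v : V i) = 0
      rw [Submodule.projectionOnto_apply_of_mem_right (hc i) hv]; rfl
    have hdec : ∀ i (v : V i), ∃ a ∈ W i, ∃ b ∈ W' i, a + b = v := by
      intro i v
      have : v ∈ W i ⊔ W' i := by rw [(hc i).sup_eq_top]; trivial
      exact Submodule.mem_sup.1 this
    have hcm : ∀ x v, φ (t x) (σ x v) = σ x (φ (s x) v) := by
      intro x v
      obtain ⟨a, ha, b, hb, rfl⟩ := hdec _ v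
      rw [map_add, map_add, map_add, hφ1 _ a ha, hφ2 _ b hb, hφ1 _ _ (hW x a ha), hφ2 _ _ (hW' x b hb), add_zero,
        add_zero]
    have h3 := h2 (famLin φ hcm) (by
      refine LinearMap.ext fun v => ?_
      funext i
      rw [Module.End.mul_apply, famLin_apply, famLin_apply]
      obtain ⟨a, ha, b, hb, hab⟩ := hdec _ (v i)
      rw [← hab, map_add, hφ1 _ a ha, hφ2 _ b hb, add_zero, hφ1 _ a ha])
    rcases h3 with h3 | h3
    · left
      funext i
      rw [Pi.bot_apply, eq_bot_iff]
      intro u hu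
      have := congrArg (fun ψ => famOf ψ i u) h3
      simp only [famOf_famLin] at this
      rw [hφ1 i u hu] at this
      exact this
    · right
      funext i
      rw [Pi.bot_apply, eq_bot_iff]
      intro u hu
      have := congrArg (fun ψ => famAlg σ ψ i u) h3
      simp only [famAlg_apply, famOf_famLin] at this
      rw [hφ2 i u hu, ← famAlg_apply, map_one] at this
      exact this.symm
  · rintro ⟨h1, h2⟩
    refine ⟨h1, fun e he => ?_⟩
    have hei : ∀ i, famOf e i * famOf e i = famOf e i := by
      intro i
      have := congrFun (congrArg (famAlg σ) he) i
      rwa [map_mul] at this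
    have h3 := h2 (fun i => LinearMap.range (famOf e i)) (fun i => LinearMap.ker (famOf e i)) (by
        rintro x _ ⟨v, rfl⟩
        exact ⟨σ x v, famOf_comm e x v⟩) (by
        intro x v hv
        rw [LinearMap.mem_ker] at hv ⊢
        rw [famOf_comm, hv, map_zero]) (fun i => LinearMap.IsIdempotentElem.isCompl (hei i))
    have hz : ∀ ψ : Module.End (QA F ι Ar) (TM σ), (∀ i, famOf ψ i = 0) → ψ = 0 := by
      intro ψ hψ
      apply famAlg_inj σ
      rw [map_zero]
      funext i; exact hψ i
    rcases h3 with h3 | h3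
    · left
      apply hz
      intro i
      exact LinearMap.range_eq_bot.1 (congrFun h3 i)
    · right
      rw [← sub_eq_zero, ← neg_eq_zero, neg_sub]
      apply hz
      intro i
      have h4 := LinearMap.ker_eq_bot.1 (congrFun h3 i)
      refine LinearMap.ext fun u => ?_
      apply h4
      rw [LinearMap.zero_apply, map_zero]
      have h5 : famOf (1 - e) i u = u - famOf e i u := by
        rw [← famAlg_apply, map_sub, map_one]; rfl
      rw [h5, map_sub, sub_eq_zero]
      exact (congrArg (fun ψ => ψ u) (hei i)).symm
end TMsec


/-! ### Part D4: decomposition into indecomposables -/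
section Decomp
variable {F : Type} [Field F] {ι Ar : Type} [Fintype ι] {s t : Ar → ι} {V V' : ι → Type}
  [∀ i, AddCommGroup (V i)] [∀ i, Module F (V i)]
  [∀ i, AddCommGroup (V' i)] [∀ i, Module F (V' i)]

theorem SS_iso (w : ι → ℚ) {σ : FRep F s t V} {σ' : FRep F s t V'} (e : TM σ ≃ₗ[QA F ι Ar] TM σ') :
    SS w σ ↔ SS w σ' := by
  obtain ⟨g, hg⟩ := (famIso σ σ').symm e
  rw [← hg, SS_trF]

theorem finrank_iso {σ : FRep F s t V} {σ' : FRep F s t V'} (e : TM σ ≃ₗ[QA F ι Ar] TM σ') (i : ι) :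
    Module.finrank F (V i) = Module.finrank F (V' i) := by
  obtain ⟨g, hg⟩ := (famIso σ σ').symm e
  exact LinearEquiv.finrank_eq (g i)

theorem SS_prodFin {B : ℕ} {G : Fin B → ι → Type} [∀ k i, AddCommGroup (G k i)] [∀ k i, Module F (G k i)]
    [∀ k i, Module.Finite F (G k i)] (w : ι → ℚ) (σ : ∀ k, FRep F s t (G k)) (h : ∀ k, SS w (σ k)) :
    SS w (prodR σ) := by
  have := (triSS w (prodR σ) σ (by
      intro j x v hv
      rw [mem_KK] at hv ⊢
      intro k hk
      change σ k x (v k) = 0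
      rw [hv k hk, map_zero]) (fun k x v hv => rfl)).1 h
  refine ⟨?_, this.2⟩
  rw [← KK_zero]
  exact this.1 0

theorem SS_prod {J : Type} [Fintype J] {G : J → ι → Type} [∀ k i, AddCommGroup (G k i)] [∀ k i, Module F (G k i)]
    [∀ k i, Module.Finite F (G k i)] (w : ι → ℚ) (σ : ∀ k, FRep F s t (G k)) (h : ∀ k, SS w (σ k)) :
    SS w (prodR σ) := by
  let e := (Fintype.equivFin J).symm
  have h1 := SS_prodFin w (fun k => σ (e k)) (fun k => h (e k))
  refine (SS_iso w ?_).1 h1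
  have e1 : (∀ k, TM (σ (e k))) ≃ₗ[QA F ι Ar] ∀ j, TM (σ j) :=
    LinearEquiv.piCongrLeft (QA F ι Ar) (fun j => TM (σ j)) e
  exact (prodIso (fun k => σ (e k))).trans (e1.trans (prodIso σ).symm)

theorem SS_res [∀ i, Module.Finite F (V i)] (w : ι → ℚ) (σ : FRep F s t V) (W : ∀ i, Submodule F (V i)) (h : Stb σ W) (hs : SS w σ)
    (h0 : dg w W = 0) : SS w (resR σ W h) := by
  constructor
  · rw [dg_top, ← h0]; rfl
  · intro U hU
    have h1 := dg_map_inj w (fun i => (W i).subtype) (fun i => Subtype.val_injective) U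
    rw [← h1]
    exact hs.2 _ (Stb.map (σ' := σ) (fun i => (W i).subtype) (fun x v => rfl) hU)

/-- decomposition -/
theorem decomp (w : ι → ℚ) : ∀ (N : ℕ) (α : ι → ℕ), ∑ i, α i ≤ N → ∀ σ : FRep F s t (stdV F α), SS w σ →
    ∃ (J : Type) (_ : Fintype J) (l : J → Σ β : ι → ℕ, FRep F s t (stdV F β)),
      (∀ j, SS w (l j).2 ∧ Indec (QA F ι Ar) (TM (l j).2)) ∧ Nonempty (TM σ ≃ₗ[QA F ι Ar] ∀ j, TM (l j).2) := by
  intro N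
  induction N with
  | zero =>
    intro α hα σ hσ
    have h0 : ∀ i, α i = 0 := by
      intro i
      have := Finset.single_le_sum (f := α) (fun _ _ => Nat.zero_le _) (Finset.mem_univ i)
      omega
    have : Subsingleton (TM σ) := ⟨fun u v => by
      funext i j
      have := h0 i
      exact (Nat.not_lt_zero j.1 (by rw [← this]; exact j.2)).elim⟩
    refine ⟨Empty, inferInstance, fun j => j.elim, fun j => j.elim, ⟨?_⟩⟩
    exact LinearEquiv.ofBijective 0 ⟨fun u v _ => Subsingleton.elim u v, fun v => ⟨0, funext fun j => j.elim⟩⟩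
  | succ N ih =>
    intro α hα σ hσ
    by_cases hI : Indec (QA F ι Ar) (TM σ)
    · refine ⟨Unit, inferInstance, fun _ => ⟨α, σ⟩, fun _ => ⟨hσ, hI⟩, ⟨?_⟩⟩
      exact (LinearEquiv.funUnique Unit (QA F ι Ar) (TM σ)).symm
    · by_cases hn : Nontrivial (TM σ)
      · rw [indec_iff] at hI
        push Not at hI
        obtain ⟨W, W', hW, hW', hc, hb, hb'⟩ := hI hn
        have hsi : dg w W + dg w W' = 0 := by
          rw [← dg_sup_inf]
          have h1 : W ⊔ W' = ⊤ := funext fun i => (hc i).sup_eq_top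
          have h2 : W ⊓ W' = ⊥ := funext fun i => (hc i).inf_eq_bot
          rw [h1, h2, hσ.1, dg_bot, add_zero]
        have h1 := hσ.2 W hW
        have h2 := hσ.2 W' hW'
        have key : ∀ (U U' : ∀ i, Submodule F (stdV F α i)) (hU : Stb σ U), (∀ i, IsCompl (U i) (U' i)) → U' ≠ ⊥ → dg w U = 0 →
            ∃ (J : Type) (_ : Fintype J) (l : J → Σ β : ι → ℕ, FRep F s t (stdV F β)),
              (∀ j, SS w (l j).2 ∧ Indec (QA F ι Ar) (TM (l j).2)) ∧
                Nonempty (TM (resR σ U hU) ≃ₗ[QA F ι Ar] ∀ j, TM (l j).2) := by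
          intro U U' hU hc hU' h0
          let e : ∀ i, U i ≃ₗ[F] stdV F (fun i => Module.finrank F (U i)) i := fun i => toStd F (U i) rfl
          have hlt : ∑ i, Module.finrank F (U i) < ∑ i, α i := by
            have hf : ∀ i, Module.finrank F (U i) + Module.finrank F (U' i) = α i := by
              intro i
              have := Submodule.finrank_add_eq_of_isCompl (hc i)
              rw [this]; simp
            obtain ⟨i, hi⟩ : ∃ i, U' i ≠ ⊥ := by
              by_contra hcon
              push Not at hcon
              exact hU' (funext hcon)
            apply Finset.sum_lt_sum
            · intro i _; have := hf i; omega
            · refine ⟨i, Finset.mem_univ i, ?_⟩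
              have := hf i
              have h3 : Module.finrank F (U' i) ≠ 0 := by
                rw [ne_eq, Submodule.finrank_eq_zero]; exact hi
              omega
          obtain ⟨J, hJ, l, hl, ⟨g⟩⟩ := ih (fun i => Module.finrank F (U i)) (by omega) (trF e (resR σ U hU))
            ((SS_trF w e _).2 (SS_res w σ U hU hσ h0))
          exact ⟨J, hJ, l, hl, ⟨(famIso (resR σ U hU) (trF e (resR σ U hU)) ⟨e, rfl⟩).trans g⟩⟩
        obtain ⟨J, hJ, l, hl, ⟨g⟩⟩ := key W W' hW hc hb' (by linarith)
        obtain ⟨J', hJ', l', hl', ⟨g'⟩⟩ := key W' W hW' (fun i => (hc i).symm) hb (by linarith)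
        refine ⟨J ⊕ J', inferInstance, Sum.elim l l', ?_, ⟨?_⟩⟩
        · rintro (j | j)
          · exact hl j
          · exact hl' j
        · have e1 : (∀ j, TM (Sum.elim l l' j).2) ≃ₗ[QA F ι Ar] ((∀ j, TM (l j).2) × (∀ j, TM (l' j).2)) :=
            LinearEquiv.sumPiEquivProdPi (QA F ι Ar) J J' (fun j => TM (Sum.elim l l' j).2)
          exact (splitIso σ W W' hW hW' hc).symm.trans ((LinearEquiv.prodCongr g g').trans e1.symm)
      · have : Subsingleton (TM σ) := not_nontrivial_iff_subsingleton.1 hn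
        refine ⟨Empty, inferInstance, fun j => j.elim, fun j => j.elim, ⟨?_⟩⟩
        exact LinearEquiv.ofBijective 0 ⟨fun u v _ => Subsingleton.elim u v, fun v => ⟨0, funext fun j => j.elim⟩⟩
end Decomp


/-! ### Part D5: Hua-type formula -/
section Hua
variable {F : Type} [Field F] [Fintype F] {ι Ar : Type} [Fintype ι] [Fintype Ar] {s t : Ar → ι}

theorem orbit_count (α : ι → ℕ) (σ0 : FRep F s t (stdV F α)) :
    (Nat.card {σ : FRep F s t (stdV F α) // Nonempty (TM σ0 ≃ₗ[QA F ι Ar] TM σ)} : ℚ) *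
      Nat.card (Module.End (QA F ι Ar) (TM σ0))ˣ = ∏ i, glq (Fintype.card F) (α i) := by
  have h := groupoid_count (G := ∀ i, stdV F α i ≃ₗ[F] stdV F α i) (X := FRep F s t (stdV F α)) (fun g σ => trF g σ)
    (fun g h x => rfl) (fun x => rfl) {σ | Nonempty (TM σ0 ≃ₗ[QA F ι Ar] TM σ)} {σ0} {g | trF g σ0 = σ0}
    (by
      rintro σ ⟨e⟩
      exact ⟨((famIso σ0 σ).symm e).1, σ0, rfl, ((famIso σ0 σ).symm e).2⟩)
    (by
      rintro _ rfl g
      exact ⟨famIso _ _ ⟨g, rfl⟩⟩)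
    (by
      rintro _ rfl g
      rfl)
  rw [Nat.card_coe_set_eq {σ0}, Set.ncard_singleton, mul_one] at h
  rw [← card_GLpi (V := stdV F α) α (fun i => by simp), ← h, card_units_TM]
  push_cast
  rfl

variable (w : ι → ℚ) {𝒳 : Type} [Fintype 𝒳] (b : 𝒳 → ι → ℕ) (r : ∀ x, FRep F s t (stdV F (b x)))

theorem finrank_pi_std {J : Type} [Fintype J] (c : J → ι → ℕ) (i : ι) :
    Module.finrank F (∀ j, stdV F (c j) i) = ∑ j, c j i := by
  rw [Module.finrank_pi_fintype]
  exact Finset.sum_congr rfl fun j _ => by simp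

theorem real_m (hr : ∀ x, SS w (r x)) (m : 𝒳 → ℕ) (α : ι → ℕ) (hm : ∀ i, ∑ x, m x * b x i = α i) :
    ∃ σ0 : FRep F s t (stdV F α), SS w σ0 ∧
      Nonempty (TM σ0 ≃ₗ[QA F ι Ar] ∀ a : (Σ x, Fin (m x)), TM (r a.1)) := by
  let ρ := prodR (fun a : (Σ x, Fin (m x)) => r a.1)
  have hρ : SS w ρ := SS_prod w _ (fun a => hr a.1)
  have hfr : ∀ i, Module.finrank F (∀ a : (Σ x, Fin (m x)), stdV F (b a.1) i) = α i := by
    intro i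
    rw [finrank_pi_std, ← hm i, Fintype.sum_sigma]
    simp
  let e : ∀ i, (∀ a : (Σ x, Fin (m x)), stdV F (b a.1) i) ≃ₗ[F] stdV F α i := fun i => toStd F _ (hfr i)
  refine ⟨trF e ρ, (SS_trF w e ρ).2 hρ, ⟨?_⟩⟩
  exact (famIso ρ (trF e ρ) ⟨e, rfl⟩).symm.trans (prodIso _)

theorem dim_m (m : 𝒳 → ℕ) (α : ι → ℕ) (σ : FRep F s t (stdV F α))
    (e : TM σ ≃ₗ[QA F ι Ar] ∀ a : (Σ x, Fin (m x)), TM (r a.1)) (i : ι) : ∑ x, m x * b x i = α i := by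
  have h := finrank_iso (e.trans (prodIso (fun a : (Σ x, Fin (m x)) => r a.1)).symm) i
  rw [finrank_pi_std, Fintype.sum_sigma] at h
  simp at h
  exact h.symm

theorem exists_m (α : ι → ℕ)
    (hcov : ∀ β ≤ α, ∀ σ : FRep F s t (stdV F β), SS w σ → Indec (QA F ι Ar) (TM σ) → ∃ x, Nonempty (TM σ ≃ₗ[QA F ι Ar] TM (r x)))
    (σ : FRep F s t (stdV F α)) (hσ : SS w σ) :
    ∃ m : 𝒳 → ℕ, Nonempty (TM σ ≃ₗ[QA F ι Ar] ∀ a : (Σ x, Fin (m x)), TM (r a.1)) := by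
  obtain ⟨J, hJ, l, hl, ⟨e⟩⟩ := decomp w _ α le_rfl σ hσ
  have hle : ∀ j, (l j).1 ≤ α := by
    intro j i
    have h := finrank_iso (e.trans (prodIso (fun j => (l j).2)).symm) i
    rw [finrank_pi_std (fun j => (l j).1)] at h
    simp at h
    rw [h]
    exact Finset.single_le_sum (f := fun j => (l j).1 i) (fun _ _ => Nat.zero_le _) (Finset.mem_univ j)
  choose c hc using fun j => hcov (l j).1 (hle j) (l j).2 (hl j).1 (hl j).2
  let m : 𝒳 → ℕ := fun x => Fintype.card {j // c j = x}
  let E : (Σ x, Fin (m x)) ≃ J := (Equiv.sigmaCongrRight fun x => (Fintype.equivFin {j // c j = x}).symm).trans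
    (Equiv.sigmaFiberEquiv c)
  have hE : ∀ a, c (E a) = a.1 := fun a => ((Fintype.equivFin {j // c j = a.1}).symm a.2).2
  have hi : ∀ a : (Σ x, Fin (m x)), Nonempty (TM (l (E a)).2 ≃ₗ[QA F ι Ar] TM (r a.1)) := by
    intro a
    have := hc (E a)
    rwa [hE a] at this
  have e1 : (∀ a, TM (l (E a)).2) ≃ₗ[QA F ι Ar] ∀ j, TM (l j).2 :=
    LinearEquiv.piCongrLeft (QA F ι Ar) (fun j => TM (l j).2) E
  exact ⟨m, ⟨e.trans (e1.symm.trans (LinearEquiv.piCongrRight fun a => (hi a).some))⟩⟩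

theorem nT_sum (p : Polynomial F) (α : ι → ℕ) [Fintype {σ : FRep F s t (stdV F α) // SS w σ}] :
    nT F s t w p α = ∑ σ : {σ : FRep F s t (stdV F α) // SS w σ}, Tp p (Module.End (QA F ι Ar) (TM σ.1)) := by
  have e : {z : (∀ i, stdV F α i →ₗ[F] stdV F α i) × FRep F s t (stdV F α) //
      SS w z.2 ∧ Cmm z.1 z.2 ∧ ∀ i, IsNilpotent (Polynomial.aeval (z.1 i) p)} ≃
      Σ σ : {σ : FRep F s t (stdV F α) // SS w σ}, {φ : ∀ i, stdV F α i →ₗ[F] stdV F α i //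
        Cmm φ σ.1 ∧ ∀ i, IsNilpotent (Polynomial.aeval (φ i) p)} :=
    { toFun := fun z => ⟨⟨z.1.2, z.2.1⟩, ⟨z.1.1, z.2.2⟩⟩
      invFun := fun y => ⟨(y.2.1, y.1.1), y.1.2, y.2.2⟩
      left_inv := fun z => rfl
      right_inv := fun z => rfl }
  rw [nT, Nat.card_congr e, Nat.card_sigma]
  exact Finset.sum_congr rfl fun σ _ => Tp_TM σ.1 p

theorem Tp_iso {A : Type} [Ring A] [Algebra F A] {M M' : Type} [AddCommGroup M] [Module A M] [Module F M] [IsScalarTower F A M]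
    [AddCommGroup M'] [Module A M'] [Module F M'] [IsScalarTower F A M'] (p : Polynomial F) (e : M ≃ₗ[A] M') :
    Tp p (Module.End A M) = Tp p (Module.End A M') := Tp_congr p (LinearEquiv.conjAlgEquiv F e)

theorem card_units_iso {A : Type} [Ring A] [Algebra F A] {M M' : Type} [AddCommGroup M] [Module A M] [Module F M] [IsScalarTower F A M]
    [AddCommGroup M'] [Module A M'] [Module F M'] [IsScalarTower F A M'] (e : M ≃ₗ[A] M') :
    Nat.card (Module.End A M)ˣ = Nat.card (Module.End A M')ˣ :=
  Nat.card_congr (Units.mapEquiv (LinearEquiv.conjAlgEquiv F e).toMulEquiv).toEquiv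

theorem hua (hr : ∀ x, SS w (r x)) (hI : ∀ x, Indec (QA F ι Ar) (TM (r x)))
    (hne : ∀ x y, Nonempty (TM (r x) ≃ₗ[QA F ι Ar] TM (r y)) → x = y) (α : ι → ℕ)
    (hcov : ∀ β ≤ α, ∀ σ : FRep F s t (stdV F β), SS w σ → Indec (QA F ι Ar) (TM σ) → ∃ x, Nonempty (TM σ ≃ₗ[QA F ι Ar] TM (r x)))
    (p : Polynomial F) (T : ℕ → ℕ → ℚ)
    (hT : ∀ (K : Type) [Field K] [Fintype K] [Algebra F K] (m : ℕ),
      (Tp p (Matrix (Fin m) (Fin m) K) : ℚ) / glq (Fintype.card K) m = T (Module.finrank F K) m)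
    (S : Finset (𝒳 → ℕ)) (hS : ∀ m, m ∈ S ↔ ∀ i, ∑ x, m x * b x i = α i) :
    (nT F s t w p α : ℚ) / ∏ i, glq (Fintype.card F) (α i) =
      ∑ m ∈ S, ∏ x, T (rdeg F (Module.End (QA F ι Ar) (TM (r x)))) (m x) := by
  have hloc : ∀ x, IsLocalRing (Module.End (QA F ι Ar) (TM (r x))) := fun x => (hI x).local
  choose K iK iK2 iK3 π hs h0 using fun x => residue F (Module.End (QA F ι Ar) (TM (r x)))
  have : Fintype {σ : FRep F s t (stdV F α) // SS w σ} := Fintype.ofFinite _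
  choose M hM using fun σ : {σ : FRep F s t (stdV F α) // SS w σ} => exists_m w b r α hcov σ.1 σ.2
  have hMS : ∀ σ, M σ ∈ S := fun σ => (hS _).2 (dim_m b r _ α σ.1 (hM σ).some)
  rw [nT_sum, Nat.cast_sum, ← Finset.sum_fiberwise_of_maps_to (s := Finset.univ) (t := S) (g := M) (fun σ _ => hMS σ),
    Finset.sum_div]
  refine Finset.sum_congr rfl fun m hm => ?_
  obtain ⟨σ0, hσ0, ⟨e0⟩⟩ := real_m w b r hr m α ((hS m).1 hm)
  have h1 : ∀ σ, M σ = m ↔ Nonempty (TM σ0 ≃ₗ[QA F ι Ar] TM σ.1) := by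
    intro σ
    constructor
    · rintro rfl
      exact ⟨e0.trans (hM σ).some.symm⟩
    · rintro ⟨e⟩
      exact ks_unique hI hne π h0 hs _ _ ((hM σ).some.symm.trans (e.symm.trans e0))
  have h2 : ∀ σ ∈ Finset.univ.filter (fun σ => M σ = m), ((Tp p (Module.End (QA F ι Ar) (TM σ.1)) : ℕ) : ℚ) =
      Tp p (Module.End (QA F ι Ar) (TM σ0)) := by
    intro σ hσ
    rw [Finset.mem_filter] at hσ
    rw [Tp_iso p ((h1 σ).1 hσ.2).some]
  rw [Finset.sum_congr rfl h2, Finset.sum_const, nsmul_eq_mul]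
  have h3 : ((Finset.univ.filter (fun σ => M σ = m)).card : ℚ) =
      Nat.card {σ : FRep F s t (stdV F α) // Nonempty (TM σ0 ≃ₗ[QA F ι Ar] TM σ)} := by
    rw [← Fintype.card_subtype, ← Nat.card_eq_fintype_card]
    congr 1
    refine Nat.card_congr
      { toFun := fun σ => ⟨σ.1.1, (h1 σ.1).1 σ.2⟩
        invFun := fun σ => ⟨⟨σ.1, (SS_iso w σ.2.some).1 hσ0⟩, (h1 _).2 σ.2⟩
        left_inv := fun σ => rfl
        right_inv := fun σ => rfl }
  rw [h3, ← orbit_count α σ0]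
  have h4 := ks_count m hI hne π h0 hs p
  rw [← Tp_iso p e0, ← card_units_iso (F := F) e0] at h4
  have h5 : (Nat.card (Module.End (QA F ι Ar) (TM σ0))ˣ : ℚ) ≠ 0 := by
    have : Nat.card (Module.End (QA F ι Ar) (TM σ0))ˣ ≠ 0 := Nat.card_ne_zero.2 ⟨⟨1⟩, inferInstance⟩
    exact_mod_cast this
  have h6 : (Nat.card {σ : FRep F s t (stdV F α) // Nonempty (TM σ0 ≃ₗ[QA F ι Ar] TM σ)} : ℚ) ≠ 0 := by
    have : Nat.card {σ : FRep F s t (stdV F α) // Nonempty (TM σ0 ≃ₗ[QA F ι Ar] TM σ)} ≠ 0 :=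
      Nat.card_ne_zero.2 ⟨⟨⟨σ0, ⟨LinearEquiv.refl _ _⟩⟩⟩, inferInstance⟩
    exact_mod_cast this
  rw [mul_div_mul_left _ _ h6, h4]
  refine Finset.prod_congr rfl fun x _ => ?_
  rw [hT, rdeg_eq F _ (K x) (π x) (hs x) (h0 x)]
end Hua


/-! ### Part E1: splitting for coprime polynomials -/
section Split
variable {K : Type} [Field K] [Fintype K]

theorem nil_finrank {V : Type} [AddCommGroup V] [Module K V] [Module.Finite K V] (x : Module.End K V) (h : IsNilpotent x)
    (n : ℕ) (hn : Module.finrank K V ≤ n) : x ^ n = 0 := by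
  obtain ⟨k, hk⟩ := h
  have h1 := Module.End.ker_pow_le_ker_pow_finrank x k
  rw [hk, LinearMap.ker_zero, top_le_iff, LinearMap.ker_eq_top] at h1
  exact pow_eq_zero_of_le hn h1

/-- primary component -/
noncomputable def prm {V : Type} [AddCommGroup V] [Module K V] (n : ℕ) (f : Polynomial K) (φ : Module.End K V) : Submodule K V :=
  LinearMap.ker (Polynomial.aeval φ (f ^ n))

theorem prm_compl {V : Type} [AddCommGroup V] [Module K V] [Module.Finite K V] (n : ℕ) (hn : Module.finrank K V ≤ n)
    {f g : Polynomial K} (hfg : IsCoprime f g) (φ : Module.End K V) :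
    IsNilpotent (Polynomial.aeval φ (f * g)) ↔ IsCompl (prm n f φ) (prm n g φ) := by
  have hc : IsCoprime (f ^ n) (g ^ n) := hfg.pow
  have hd := Polynomial.disjoint_ker_aeval_of_isCoprime φ hc
  have hs := Polynomial.sup_ker_aeval_eq_ker_aeval_mul_of_coprime φ hc
  constructor
  · intro h
    refine ⟨hd, codisjoint_iff.2 ?_⟩
    have h1 := nil_finrank _ h n hn
    rw [← map_pow, mul_pow] at h1
    rw [prm, prm, hs, h1, LinearMap.ker_zero]
  · intro h
    have h1 := h.sup_eq_top
    rw [prm, prm, hs, LinearMap.ker_eq_top, ← mul_pow, map_pow] at h1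
    exact ⟨n, h1⟩

theorem prm_conj {V V' : Type} [AddCommGroup V] [Module K V] [AddCommGroup V'] [Module K V'] (n : ℕ) (f : Polynomial K)
    (φ : Module.End K V) (e : V ≃ₗ[K] V') :
    prm n f (LinearEquiv.conjAlgEquiv K e φ) = (prm n f φ).map e.toLinearMap := by
  rw [prm]
  have h : Polynomial.aeval (LinearEquiv.conjAlgEquiv K e φ) (f ^ n) = LinearEquiv.conjAlgEquiv K e (Polynomial.aeval φ (f ^ n)) :=
    Polynomial.aeval_algHom_apply (LinearEquiv.conjAlgEquiv K e) φ (f ^ n)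
  rw [h]
  ext v
  constructor
  · intro hv
    refine ⟨e.symm v, ?_, by simp⟩
    have h2 : e (Polynomial.aeval φ (f ^ n) (e.symm v)) = 0 := hv
    have h3 := (LinearEquiv.map_eq_zero_iff e).1 h2
    exact h3
  · rintro ⟨u, hu, rfl⟩
    change e (Polynomial.aeval φ (f ^ n) (e.symm (e u))) = 0
    rw [e.symm_apply_apply]
    have : Polynomial.aeval φ (f ^ n) u = 0 := hu
    rw [this, map_zero]

theorem prm_stable {V : Type} [AddCommGroup V] [Module K V] (n : ℕ) (f : Polynomial K)
    (φ : Module.End K V) (v : V) (hv : v ∈ prm n f φ) : φ v ∈ prm n f φ := by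
  have h1 : Polynomial.aeval φ (f ^ n) v = 0 := hv
  have h2 : Polynomial.aeval φ (f ^ n) * φ = φ * Polynomial.aeval φ (f ^ n) := by
    have h3 := congrArg (Polynomial.aeval φ) (mul_comm (f ^ n) Polynomial.X)
    rwa [map_mul, map_mul, Polynomial.aeval_X] at h3
  change (Polynomial.aeval φ (f ^ n) * φ) v = 0
  rw [h2, Module.End.mul_apply, h1, map_zero]

variable (A B : Type) [AddCommGroup A] [Module K A] [Module.Finite K A] [AddCommGroup B] [Module K B] [Module.Finite K B]

variable (K) in
abbrev PA : Submodule K (A × B) := LinearMap.ker (LinearMap.snd K A B)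
variable (K) in
abbrev PB : Submodule K (A × B) := LinearMap.ker (LinearMap.fst K A B)

theorem PAB_compl : IsCompl (PA K A B) (PB K A B) := by
  rw [isCompl_iff, disjoint_iff, codisjoint_iff]
  constructor
  · ext ⟨u, v⟩; simp [and_comm]
  · rw [eq_top_iff]
    rintro ⟨u, v⟩ -
    exact Submodule.mem_sup.2 ⟨(u, 0), by simp, (0, v), by simp, by simp⟩

theorem finrank_PA : Module.finrank K (PA K A B) = Module.finrank K A := by
  rw [PA, LinearMap.ker_snd]
  exact LinearMap.finrank_range_of_inj LinearMap.inl_injective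
theorem finrank_PB : Module.finrank K (PB K A B) = Module.finrank K B := by
  rw [PB, LinearMap.ker_fst]
  exact LinearMap.finrank_range_of_inj LinearMap.inr_injective

theorem card_HPQ : Nat.card {g : (A × B) ≃ₗ[K] (A × B) | (PA K A B).map g.toLinearMap = PA K A B ∧ (PB K A B).map g.toLinearMap = PB K A B} =
    Nat.card (A ≃ₗ[K] A) * Nat.card (B ≃ₗ[K] B) := by
  rw [← Nat.card_prod]
  symm
  refine Nat.card_congr (Equiv.ofBijective (fun g : (A ≃ₗ[K] A) × (B ≃ₗ[K] B) => ⟨LinearEquiv.prodCongr g.1 g.2, ?_, ?_⟩) ⟨?_, ?_⟩)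
  · ext ⟨u, v⟩
    constructor
    · rintro ⟨⟨x, y⟩, hy, h⟩
      simp at hy h ⊢
      rw [← h.2, hy, map_zero]
    · intro h
      simp at h
      exact ⟨(g.1.symm u, 0), by simp, by simp [h]⟩
  · ext ⟨u, v⟩
    constructor
    · rintro ⟨⟨x, y⟩, hy, h⟩
      simp at hy h ⊢
      rw [← h.1, hy, map_zero]
    · intro h
      simp at h
      exact ⟨(0, g.2.symm v), by simp, by simp [h]⟩
  · rintro ⟨g1, g2⟩ ⟨k1, k2⟩ h
    have h1 := congrArg Subtype.val h
    refine Prod.ext ?_ ?_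
    · refine LinearEquiv.ext fun u => ?_
      exact congrArg (fun e : (A × B) ≃ₗ[K] (A × B) => (e (u, 0)).1) h1
    · refine LinearEquiv.ext fun u => ?_
      exact congrArg (fun e : (A × B) ≃ₗ[K] (A × B) => (e (0, u)).2) h1
  · rintro ⟨g, h1, h2⟩
    have hA : ∀ u, (g (u, 0)).2 = 0 := by
      intro u
      have : g (u, 0) ∈ (PA K A B).map g.toLinearMap := ⟨(u, 0), by simp, rfl⟩
      rw [h1] at this
      simpa using this
    have hB : ∀ u, (g (0, u)).1 = 0 := by
      intro u
      have : g (0, u) ∈ (PB K A B).map g.toLinearMap := ⟨(0, u), by simp, rfl⟩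
      rw [h2] at this
      simpa using this
    have hA' : ∀ u, (g.symm (u, 0)).2 = 0 := by
      intro u
      have : ((u, 0) : A × B) ∈ (PA K A B).map g.toLinearMap := by rw [h1]; simp
      obtain ⟨y, hy, hyu⟩ := this
      rw [← hyu]
      simpa using hy
    have hB' : ∀ u, (g.symm (0, u)).1 = 0 := by
      intro u
      have : ((0, u) : A × B) ∈ (PB K A B).map g.toLinearMap := by rw [h2]; simp
      obtain ⟨y, hy, hyu⟩ := this
      rw [← hyu]
      simpa using hy
    have e1 : ∀ u, g (u, 0) = ((g (u, 0)).1, 0) := fun u => Prod.ext rfl (hA u)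
    have e2 : ∀ u, g (0, u) = (0, (g (0, u)).2) := fun u => Prod.ext (hB u) rfl
    have e1' : ∀ u, g.symm (u, 0) = ((g.symm (u, 0)).1, 0) := fun u => Prod.ext rfl (hA' u)
    have e2' : ∀ u, g.symm (0, u) = (0, (g.symm (0, u)).2) := fun u => Prod.ext (hB' u) rfl
    refine ⟨(LinearEquiv.ofLinear (LinearMap.fst K A B ∘ₗ g.toLinearMap ∘ₗ LinearMap.inl K A B)
        (LinearMap.fst K A B ∘ₗ g.symm.toLinearMap ∘ₗ LinearMap.inl K A B) ?_ ?_,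
      LinearEquiv.ofLinear (LinearMap.snd K A B ∘ₗ g.toLinearMap ∘ₗ LinearMap.inr K A B)
        (LinearMap.snd K A B ∘ₗ g.symm.toLinearMap ∘ₗ LinearMap.inr K A B) ?_ ?_), ?_⟩
    · refine LinearMap.ext fun u => ?_
      change (g ((g.symm (u, 0)).1, 0)).1 = u
      rw [← e1', g.apply_symm_apply]
    · refine LinearMap.ext fun u => ?_
      change (g.symm ((g (u, 0)).1, 0)).1 = u
      rw [← e1, g.symm_apply_apply]
    · refine LinearMap.ext fun u => ?_
      change (g (0, (g.symm (0, u)).2)).2 = u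
      rw [← e2', g.apply_symm_apply]
    · refine LinearMap.ext fun u => ?_
      change (g.symm (0, (g (0, u)).2)).2 = u
      rw [← e2, g.symm_apply_apply]
    · refine Subtype.ext (LinearEquiv.ext ?_)
      rintro ⟨u, v⟩
      change ((g (u, 0)).1, (g (0, v)).2) = g (u, v)
      have : ((u, v) : A × B) = (u, 0) + (0, v) := by simp
      rw [this, map_add, e1, e2]
      simp

theorem aeval_prodMap (φ : Module.End K A) (ψ : Module.End K B) (f : Polynomial K) :
    Polynomial.aeval (LinearMap.prodMap φ ψ : Module.End K (A × B)) f =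
      LinearMap.prodMap (Polynomial.aeval φ f) (Polynomial.aeval ψ f) := by
  have h := Polynomial.aeval_algHom_apply (LinearMap.prodMapAlgHom K A B) (φ, ψ) f
  have h1 : Polynomial.aeval (φ, ψ) f = (Polynomial.aeval φ f, Polynomial.aeval ψ f) := by
    refine Prod.ext ?_ ?_
    · exact (Polynomial.aeval_algHom_apply (AlgHom.fst K (Module.End K A) (Module.End K B)) (φ, ψ) f).symm
    · exact (Polynomial.aeval_algHom_apply (AlgHom.snd K (Module.End K A) (Module.End K B)) (φ, ψ) f).symm
  rw [h1] at h
  exact h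

theorem card_YPQ (n : ℕ) (hn : Module.finrank K (A × B) ≤ n) {f g : Polynomial K} (hfg : IsCoprime f g) :
    Nat.card {φ : Module.End K (A × B) | prm n f φ = PA K A B ∧ prm n g φ = PB K A B} =
      Tp f (Module.End K A) * Tp g (Module.End K B) := by
  rw [Tp, Tp, ← Nat.card_prod]
  symm
  have hnn : Module.finrank K A ≤ n ∧ Module.finrank K B ≤ n := by
    rw [Module.finrank_prod] at hn; omega
  have aux : ∀ {C : Type} [AddCommGroup C] [Module K C] [Module.Finite K C], Module.finrank K C ≤ n → ∀ {f g : Polynomial K}, IsCoprime f g →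
      ∀ φ : Module.End K C, IsNilpotent (Polynomial.aeval φ f) → ∀ u, Polynomial.aeval φ (g ^ n) u = 0 → u = 0 := by
    intro C _ _ _ hC f g hfg φ hφ u hu
    have h1 := nil_finrank _ hφ n hC
    have hd := Polynomial.disjoint_ker_aeval_of_isCoprime φ (hfg.pow (m := n) (n := n))
    rw [map_pow, h1, LinearMap.ker_zero, top_disjoint] at hd
    have : u ∈ LinearMap.ker (Polynomial.aeval φ (g ^ n)) := hu
    rwa [hd, Submodule.mem_bot] at this
  refine Nat.card_congr (Equiv.ofBijective (fun y : {φ : Module.End K A // IsNilpotent (Polynomial.aeval φ f)} ×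
      {φ : Module.End K B // IsNilpotent (Polynomial.aeval φ g)} => ⟨LinearMap.prodMap y.1.1 y.2.1, ?_, ?_⟩) ⟨?_, ?_⟩)
  · ext ⟨u, v⟩
    rw [prm, LinearMap.mem_ker, aeval_prodMap, LinearMap.prodMap_apply, map_pow, nil_finrank _ y.1.2 n hnn.1, ]
    rw [LinearMap.mem_ker, LinearMap.snd_apply, LinearMap.zero_apply, Prod.mk_eq_zero]
    constructor
    · intro h
      exact aux hnn.2 hfg.symm y.2.1 y.2.2 v h.2
    · rintro h
      have : v = 0 := h
      rw [this, map_zero]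
      exact ⟨rfl, rfl⟩
  · ext ⟨u, v⟩
    have h3 := nil_finrank _ y.2.2 n hnn.2
    rw [← map_pow] at h3
    rw [prm, LinearMap.mem_ker, aeval_prodMap, LinearMap.prodMap_apply, h3]
    rw [LinearMap.mem_ker, LinearMap.fst_apply, LinearMap.zero_apply, Prod.mk_eq_zero]
    constructor
    · intro h
      exact aux hnn.1 hfg y.1.1 y.1.2 u h.1
    · rintro h
      have : u = 0 := h
      rw [this, map_zero]
      exact ⟨rfl, rfl⟩
  · rintro ⟨⟨φ, h1⟩, ⟨ψ, h2⟩⟩ ⟨⟨φ', h1'⟩, ⟨ψ', h2'⟩⟩ h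
    have h1 := congrArg Subtype.val h
    refine Prod.ext (Subtype.ext ?_) (Subtype.ext ?_)
    · refine LinearMap.ext fun u => ?_
      exact congrArg (fun e : Module.End K (A × B) => (e (u, 0)).1) h1
    · refine LinearMap.ext fun u => ?_
      exact congrArg (fun e : Module.End K (A × B) => (e (0, u)).2) h1
  · rintro ⟨φ, h1, h2⟩
    have hA : ∀ u, (φ (u, 0)).2 = 0 := by
      intro u
      have := prm_stable n f φ (u, 0) (by rw [h1]; simp)
      rw [h1] at this
      simpa using this
    have hB : ∀ u, (φ (0, u)).1 = 0 := by
      intro u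
      have := prm_stable n g φ (0, u) (by rw [h2]; simp)
      rw [h2] at this
      simpa using this
    let φ1 : Module.End K A := LinearMap.fst K A B ∘ₗ φ ∘ₗ LinearMap.inl K A B
    let φ2 : Module.End K B := LinearMap.snd K A B ∘ₗ φ ∘ₗ LinearMap.inr K A B
    have hφ : LinearMap.prodMap φ1 φ2 = φ := by
      refine LinearMap.ext ?_
      rintro ⟨u, v⟩
      change ((φ (u, 0)).1, (φ (0, v)).2) = φ (u, v)
      have : ((u, v) : A × B) = (u, 0) + (0, v) := by simp
      rw [this, map_add]
      refine Prod.ext ?_ ?_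
      · simp [hB]
      · simp [hA]
    refine ⟨(⟨φ1, n, ?_⟩, ⟨φ2, n, ?_⟩), Subtype.ext hφ⟩
    · rw [← map_pow]
      refine LinearMap.ext fun u => ?_
      have h3 : ((u, 0) : A × B) ∈ prm n f φ := by rw [h1]; simp
      rw [prm, LinearMap.mem_ker, ← hφ, aeval_prodMap] at h3
      exact congrArg Prod.fst h3
    · rw [← map_pow]
      refine LinearMap.ext fun u => ?_
      have h3 : ((0, u) : A × B) ∈ prm n g φ := by rw [h2]; simp
      rw [prm, LinearMap.mem_ker, ← hφ, aeval_prodMap] at h3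
      exact congrArg Prod.snd h3

theorem split_orbit (n : ℕ) (hn : Module.finrank K (A × B) ≤ n) {f g : Polynomial K} (hfg : IsCoprime f g) :
    Nat.card {φ : Module.End K (A × B) | IsNilpotent (Polynomial.aeval φ (f * g)) ∧ Module.finrank K (prm n f φ) = Module.finrank K A} *
      (Nat.card (A ≃ₗ[K] A) * Nat.card (B ≃ₗ[K] B)) =
    Nat.card ((A × B) ≃ₗ[K] (A × B)) * (Tp f (Module.End K A) * Tp g (Module.End K B)) := by
  have : Finite (Module.End K (A × B)) := Module.finite_of_finite K
  rw [← card_HPQ, ← card_YPQ A B n hn hfg]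
  refine groupoid_count (fun e φ => LinearEquiv.conjAlgEquiv K e φ) (fun _ _ _ => rfl) (fun _ => rfl) _ _ _ ?_ ?_ ?_
  · rintro φ ⟨h1, h2⟩
    have hc := (prm_compl n hn hfg φ).1 h1
    have h3 := Submodule.finrank_add_eq_of_isCompl hc
    rw [h2, Module.finrank_prod] at h3
    have h4 : Module.finrank K (prm n g φ) = Module.finrank K B := by omega
    let eA : A ≃ₗ[K] prm n f φ := LinearEquiv.ofFinrankEq _ _ h2.symm
    let eB : B ≃ₗ[K] prm n g φ := LinearEquiv.ofFinrankEq _ _ h4.symm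
    let e : (A × B) ≃ₗ[K] (A × B) := (LinearEquiv.prodCongr eA eB).trans (Submodule.prodEquivOfIsCompl _ _ hc)
    have he : ∀ u v, e (u, v) = (eA u : A × B) + (eB v : A × B) := fun u v => rfl
    have hφ : LinearEquiv.conjAlgEquiv K e (LinearEquiv.conjAlgEquiv K e.symm φ) = φ := by
      refine LinearMap.ext fun v => ?_
      change e (e.symm (φ (e (e.symm v)))) = φ v
      simp
    refine ⟨e, LinearEquiv.conjAlgEquiv K e.symm φ, ⟨?_, ?_⟩, hφ⟩
    · apply Submodule.map_injective_of_injective (f := e.toLinearMap) e.injective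
      rw [← prm_conj, hφ]
      ext v
      constructor
      · intro hv
        refine ⟨(eA.symm ⟨v, hv⟩, 0), by simp, ?_⟩
        change e _ = v
        rw [he]; simp
      · rintro ⟨⟨u, v⟩, hv, rfl⟩
        have : v = 0 := hv
        subst this
        change e _ ∈ _
        rw [he, map_zero, Submodule.coe_zero, add_zero]
        exact (eA u).2
    · apply Submodule.map_injective_of_injective (f := e.toLinearMap) e.injective
      rw [← prm_conj, hφ]
      ext v
      constructor
      · intro hv
        refine ⟨(0, eB.symm ⟨v, hv⟩), by simp, ?_⟩
        change e _ = v
        rw [he]; simp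
      · rintro ⟨⟨u, v⟩, hv, rfl⟩
        have : u = 0 := hv
        subst this
        change e _ ∈ _
        rw [he, map_zero, Submodule.coe_zero, zero_add]
        exact (eB v).2
  · rintro y ⟨h1, h2⟩ e
    have hc : IsNilpotent (Polynomial.aeval y (f * g)) := by
      rw [prm_compl n hn hfg, h1, h2]; exact PAB_compl A B
    refine ⟨?_, ?_⟩
    · have := Polynomial.aeval_algHom_apply (LinearEquiv.conjAlgEquiv K e) y (f * g)
      rw [show Polynomial.aeval (LinearEquiv.conjAlgEquiv K e y) (f * g) = LinearEquiv.conjAlgEquiv K e (Polynomial.aeval y (f * g)) from this]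
      exact hc.map _
    · rw [prm_conj, h1, ← finrank_PA A B]
      exact LinearEquiv.finrank_map_eq e _
  · rintro y ⟨h1, h2⟩ e
    change (prm n f _ = _ ∧ prm n g _ = _) ↔ _
    rw [prm_conj, prm_conj, h1, h2]
    rfl

theorem Tp_endstd (f : Polynomial K) {V : Type} [AddCommGroup V] [Module K V] [Module.Finite K V] {m : ℕ}
    (h : Module.finrank K V = m) : Tp f (Module.End K V) = Tp f (Module.End K (Fin m → K)) :=
  Tp_congr f (LinearEquiv.conjAlgEquiv K (toStd K V h))

/-- convolution formula -/
theorem split_count {f g : Polynomial K} (hfg : IsCoprime f g) (m : ℕ) :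
    (Tp (f * g) (Module.End K (Fin m → K)) : ℚ) / glq (Fintype.card K) m =
      ∑ ab ∈ Finset.HasAntidiagonal.antidiagonal m, ((Tp f (Module.End K (Fin ab.1 → K)) : ℚ) / glq (Fintype.card K) ab.1) *
        ((Tp g (Module.End K (Fin ab.2 → K)) : ℚ) / glq (Fintype.card K) ab.2) := by
  have : Finite (Module.End K (Fin m → K)) := Module.finite_of_finite K
  let S := {φ : Module.End K (Fin m → K) // IsNilpotent (Polynomial.aeval φ (f * g))}
  have : Fintype S := Fintype.ofFinite _
  have h0 : (Tp (f * g) (Module.End K (Fin m → K)) : ℚ) = ∑ ab ∈ Finset.HasAntidiagonal.antidiagonal m,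
      ((Finset.univ.filter (fun φ : S => (Module.finrank K (prm m f φ.1), m - Module.finrank K (prm m f φ.1)) = ab)).card : ℚ) := by
    rw [Tp, Nat.card_eq_fintype_card, ← Finset.card_univ, Finset.card_eq_sum_card_fiberwise (f := fun φ : S =>
      (Module.finrank K (prm m f φ.1), m - Module.finrank K (prm m f φ.1))) (t := Finset.HasAntidiagonal.antidiagonal m)]
    · push_cast; rfl
    · intro φ _
      have : Module.finrank K (prm m f φ.1) ≤ m := by
        have := Submodule.finrank_le (prm m f φ.1)
        simpa using this
      simp; omega
  rw [h0, Finset.sum_div]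
  refine Finset.sum_congr rfl ?_
  rintro ⟨a, b⟩ hab
  rw [Finset.HasAntidiagonal.mem_antidiagonal] at hab
  simp only at hab
  subst hab
  have hfr : Module.finrank K ((Fin a → K) × (Fin b → K)) = a + b := by simp
  let e : ((Fin a → K) × (Fin b → K)) ≃ₗ[K] (Fin (a + b) → K) := toStd K _ hfr
  have h1 : (Finset.univ.filter (fun φ : S => (Module.finrank K (prm (a + b) f φ.1), (a + b) - Module.finrank K (prm (a + b) f φ.1)) = (a, b))).card =
      Nat.card {φ : Module.End K ((Fin a → K) × (Fin b → K)) | IsNilpotent (Polynomial.aeval φ (f * g)) ∧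
        Module.finrank K (prm (a + b) f φ) = Module.finrank K (Fin a → K)} := by
    rw [← Fintype.card_subtype, ← Nat.card_eq_fintype_card]
    symm
    have hE : ∀ φ : Module.End K ((Fin a → K) × (Fin b → K)), (IsNilpotent (Polynomial.aeval φ (f * g)) ∧
        Module.finrank K (prm (a + b) f φ) = Module.finrank K (Fin a → K)) ↔
        (IsNilpotent (Polynomial.aeval (LinearEquiv.conjAlgEquiv K e φ) (f * g)) ∧
          Module.finrank K (prm (a + b) f (LinearEquiv.conjAlgEquiv K e φ)) = a) := by
      intro φ
      have h2 : Polynomial.aeval (LinearEquiv.conjAlgEquiv K e φ) (f * g) = LinearEquiv.conjAlgEquiv K e (Polynomial.aeval φ (f * g)) :=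
        Polynomial.aeval_algHom_apply (LinearEquiv.conjAlgEquiv K e) φ (f * g)
      rw [h2, IsNilpotent.map_iff (LinearEquiv.conjAlgEquiv K e).injective, prm_conj]
      have h3 : Module.finrank K ((prm (a + b) f φ).map e.toLinearMap) = Module.finrank K (prm (a + b) f φ) := LinearEquiv.finrank_map_eq e _
      rw [h3]; simp
    refine Nat.card_congr ((Equiv.subtypeEquiv (q := fun φ => IsNilpotent (Polynomial.aeval φ (f * g)) ∧
          Module.finrank K (prm (a + b) f φ) = a) (LinearEquiv.conjAlgEquiv K e).toEquiv hE).trans ?_)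
    exact
      { toFun := fun φ => ⟨⟨φ.1, φ.2.1⟩, by rw [φ.2.2]; simp⟩
        invFun := fun φ => ⟨φ.1.1, φ.1.2, (Prod.ext_iff.1 φ.2).1⟩
        left_inv := fun φ => rfl
        right_inv := fun φ => rfl }
  rw [h1]
  have h2 := split_orbit (Fin a → K) (Fin b → K) (a + b) hfr.le hfg
  have h3 := congrArg (Nat.cast : ℕ → ℚ) h2
  push_cast at h3
  rw [natCard_equiv_gl K (Fin a → K) (m := a) (by simp), natCard_equiv_gl K (Fin b → K) (m := b) (by simp),
    natCard_equiv_gl K _ hfr] at h3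
  have hq : 2 ≤ Fintype.card K := Fintype.one_lt_card
  have ha := glq_ne_zero hq a
  have hb := glq_ne_zero hq b
  have hc := glq_ne_zero hq (a + b)
  rw [div_mul_div_comm, div_eq_div_iff hc (mul_ne_zero ha hb), h3]
  ring
end Split


/-! ### Part E2: rationality over extensions -/
section Tau

theorem nT_point (K : Type) [Field K] [Fintype K] (f : Polynomial K) (m : ℕ) :
    nT K (fun x : Empty => ()) (fun x : Empty => ()) 0 f (fun _ => m) = Tp f (Module.End K (Fin m → K)) := by
  rw [nT, Tp]
  refine Nat.card_congr
    { toFun := fun z => ⟨z.1.1 (), z.2.2.2 ()⟩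
      invFun := fun φ => ⟨(fun _ => φ.1, fun x => x.elim), ⟨?_, ?_⟩, fun x => x.elim, fun _ => φ.2⟩
      left_inv := fun z => Subtype.ext (Prod.ext rfl (funext fun x => x.elim))
      right_inv := fun z => rfl }
  · simp [dg]
  · intro W _; simp [dg]

theorem Tp_assoc {K : Type} [Field K] {p p' : Polynomial K} (h : Associated p p') (E : Type) [Ring E] [Algebra K E] :
    Tp p E = Tp p' E := by
  have key : ∀ {p p' : Polynomial K}, Associated p p' → ∀ φ : E, IsNilpotent (Polynomial.aeval φ p) → IsNilpotent (Polynomial.aeval φ p') := by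
    rintro p _ ⟨u, rfl⟩ φ ⟨n, hn⟩
    refine ⟨n, ?_⟩
    rw [← map_pow, mul_pow, map_mul, map_pow, hn, zero_mul]
  exact Nat.card_congr (Equiv.subtypeEquivRight fun φ => ⟨key h φ, key h.symm φ⟩)

theorem rat_pow (d : ℕ) (hd : 1 ≤ d) (k : ℕ) : ∀ m : ℕ, ∃ r ∈ ratS, ∀ (K : Type) [Field K] [Fintype K] (l : List (Polynomial K)),
    l.length = k → (∀ f ∈ l, Irreducible f ∧ f.natDegree = d) → Squarefree l.prod →
    (Tp l.prod (Module.End K (Fin m → K)) : ℚ) / glq (Fintype.card K) m = r (Fintype.card K) := by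
  induction k with
  | zero =>
    intro m
    refine ⟨fun q => (if m = 0 then 1 else 0) / glq q m, ratS_div (ratS_const _) (ratS_glq m) (fun q hq => glq_ne_zero hq m), ?_⟩
    intro K _ _ l hl _ _
    rw [List.length_eq_zero_iff] at hl
    subst hl
    congr 1
    rw [Tp]
    simp only [List.prod_nil, map_one]
    split_ifs with hm
    · subst hm
      have : Subsingleton (Module.End K (Fin 0 → K)) := ⟨fun a b => LinearMap.ext fun v => Subsingleton.elim _ _⟩
      have : Nat.card {φ : Module.End K (Fin 0 → K) // IsNilpotent (1 : Module.End K (Fin 0 → K))} = 1 := by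
        rw [Nat.card_eq_one_iff_unique]
        exact ⟨⟨fun a b => Subtype.ext (Subsingleton.elim _ _)⟩, ⟨⟨0, 1, Subsingleton.elim _ _⟩⟩⟩
      rw [this, Nat.cast_one]
    · have : NeZero m := ⟨hm⟩
      have hnt : Nontrivial (Module.End K (Fin m → K)) := inferInstance
      have : IsEmpty {φ : Module.End K (Fin m → K) // IsNilpotent (1 : Module.End K (Fin m → K))} := ⟨by
        rintro ⟨φ, n, hn⟩
        rw [one_pow] at hn
        exact one_ne_zero hn⟩
      rw [Nat.card_of_isEmpty, Nat.cast_zero]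
  | succ k ih =>
    intro m
    choose r hr hr' using ih
    choose r1 hr1 hr1' using fun a : ℕ => rat_T (fun x : Empty => ()) (fun x : Empty => ()) 0 d hd (fun _ => a)
    refine ⟨fun q => ∑ ab ∈ Finset.HasAntidiagonal.antidiagonal m, (r1 ab.1 q / glq q ab.1) * r ab.2 q,
      ratS_sum _ (fun ab _ => ratS_mul (ratS_div (hr1 _) (ratS_glq _) (fun q hq => glq_ne_zero hq _)) (hr _)), ?_⟩
    intro K _ _ l hl h1 h2
    rcases l with _ | ⟨f, l⟩
    · simp at hl
    · rw [List.prod_cons] at h2 ⊢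
      have h3 := squarefree_mul_iff.1 h2
      rw [split_count h3.1.isCoprime]
      refine Finset.sum_congr rfl fun ab _ => ?_
      rw [hr' ab.2 K l (by simpa using hl) (fun g hg => h1 g (List.mem_cons_of_mem _ hg)) h3.2.2, ← nT_point,
        hr1' ab.1 K f (h1 f List.mem_cons_self).1 (h1 f List.mem_cons_self).2]

/-- degrees of factors over an extension -/
theorem factor_degree (F K : Type) [Field F] [Fintype F] [Field K] [Fintype K] [Algebra F K] (p : Polynomial F) (hp : Irreducible p)
    (f : Polynomial K) (hf : Irreducible f) (hfp : f ∣ p.map (algebraMap F K)) :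
    Module.finrank F K * f.natDegree = Nat.lcm p.natDegree (Module.finrank F K) := by
  have hcard : Nat.card K = Nat.card F ^ Module.finrank F K := Module.natCard_eq_pow_finrank
  have he : 0 < Module.finrank F K := Module.finrank_pos
  have hmap : ∀ n, ((Polynomial.X ^ n - Polynomial.X : Polynomial F)).map (algebraMap F K) = Polynomial.X ^ n - Polynomial.X := by
    intro n; simp
  apply Nat.dvd_antisymm
  · obtain ⟨c, hc⟩ := Nat.dvd_lcm_right p.natDegree (Module.finrank F K)
    rw [hc]
    apply Nat.mul_dvd_mul_left
    rw [hf.natDegree_dvd_iff_dvd_X_pow_card_pow_sub_X, hcard, ← pow_mul, ← hc]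
    have h1 := hp.natDegree_dvd_iff_dvd_X_pow_card_pow_sub_X.1 (Nat.dvd_lcm_left p.natDegree (Module.finrank F K))
    have h2 := Polynomial.map_dvd (algebraMap F K) h1
    rw [hmap] at h2
    exact hfp.trans h2
  · apply Nat.lcm_dvd _ (Dvd.intro _ rfl)
    rw [hp.natDegree_dvd_iff_dvd_X_pow_card_pow_sub_X]
    by_contra hnd
    have hco := (hp.coprime_iff_not_dvd).2 hnd
    have h3 := hco.map (Polynomial.mapRingHom (algebraMap F K))
    rw [Polynomial.coe_mapRingHom, hmap] at h3
    have h4 := hf.natDegree_dvd_iff_dvd_X_pow_card_pow_sub_X.1 (dvd_refl f.natDegree)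
    rw [hcard, ← pow_mul] at h4
    exact hf.not_isUnit (h3.isUnit_of_dvd' hfp h4)

theorem Tp_map (F K : Type) [Field F] [Field K] [Algebra F K] (p : Polynomial F) (m : ℕ) :
    Tp p (Matrix (Fin m) (Fin m) K) = Tp (p.map (algebraMap F K)) (Module.End K (Fin m → K)) := by
  rw [← Tp_congr (p.map (algebraMap F K)) (Matrix.toLinAlgEquiv' (R := K) (n := Fin m)), Tp, Tp]
  refine Nat.card_congr (Equiv.subtypeEquivRight fun φ => ?_)
  rw [Polynomial.aeval_map_algebraMap]

theorem rat_tau (d : ℕ) (hd : 1 ≤ d) (e m : ℕ) : ∃ r ∈ ratS, ∀ (F : Type) [Field F] [Fintype F] (p : Polynomial F),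
    Irreducible p → p.natDegree = d → ∀ (K : Type) [Field K] [Fintype K] [Algebra F K], Module.finrank F K = e →
    (Tp p (Matrix (Fin m) (Fin m) K) : ℚ) / glq (Fintype.card K) m = r (Fintype.card F) := by
  rcases Nat.eq_zero_or_pos e with rfl | he
  · refine ⟨fun _ => 0, ratS_const 0, ?_⟩
    intro F _ _ p hp hpd K _ _ _ hK
    have : 0 < Module.finrank F K := Module.finrank_pos
    omega
  let d' := Nat.lcm d e / e
  have hd' : 1 ≤ d' := by
    have h1 : 0 < Nat.lcm d e := Nat.lcm_pos hd he
    have h2 := Nat.le_of_dvd h1 (Nat.dvd_lcm_right d e)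
    exact (Nat.one_le_div_iff he).2 h2
  obtain ⟨r, hr, hr'⟩ := rat_pow d' hd' (d / d') m
  refine ⟨fun q => r (q ^ e), ratS_comp hr he, ?_⟩
  intro F _ _ p hp hpd K _ _ _ hK
  have hp0 : p.map (algebraMap F K) ≠ 0 := (Polynomial.map_ne_zero_iff (algebraMap F K).injective).2 hp.ne_zero
  have hsq : Squarefree (p.map (algebraMap F K)) :=
    ((PerfectField.separable_of_irreducible hp).map (f := algebraMap F K)).squarefree
  let l := (UniqueFactorizationMonoid.normalizedFactors (p.map (algebraMap F K))).toList
  have hl : Associated l.prod (p.map (algebraMap F K)) := by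
    have h1 := UniqueFactorizationMonoid.prod_normalizedFactors hp0
    rwa [← Multiset.prod_toList] at h1
  have hmem : ∀ f ∈ l, Irreducible f ∧ f.natDegree = d' := by
    intro f hf
    have h1 := Multiset.mem_toList.1 hf
    have h2 := UniqueFactorizationMonoid.irreducible_of_normalized_factor f h1
    refine ⟨h2, ?_⟩
    have h3 := factor_degree F K p hp f h2 (UniqueFactorizationMonoid.dvd_of_mem_normalizedFactors h1)
    rw [hpd, hK] at h3
    exact (Nat.div_eq_of_eq_mul_right he h3.symm).symm
  have hlen : l.length = d / d' := by
    have h1 : l.prod.natDegree = d := by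
      rw [Polynomial.natDegree_eq_of_degree_eq (Polynomial.degree_eq_degree_of_associated hl), Polynomial.natDegree_map, hpd]
    have h2 : (0 : Polynomial K) ∉ l := fun h => (hmem 0 h).1.ne_zero rfl
    rw [← Multiset.prod_coe, Polynomial.natDegree_multiset_prod _ (by simpa using h2)] at h1
    have h3 : (Multiset.map Polynomial.natDegree (l : Multiset (Polynomial K))) = Multiset.replicate l.length d' := by
      rw [Multiset.eq_replicate]
      refine ⟨by simp, ?_⟩
      intro n hn
      rw [Multiset.mem_map] at hn
      obtain ⟨f, hf, rfl⟩ := hn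
      exact (hmem f (by simpa using hf)).2
    rw [h3, Multiset.sum_replicate, smul_eq_mul] at h1
    exact (Nat.div_eq_of_eq_mul_left hd' h1.symm).symm
  rw [Tp_map, ← Tp_assoc hl, hr' K l hlen hmem (hl.squarefree_iff.2 hsq)]
  congr 1
  rw [← hK, Module.card_eq_pow_finrank (K := F) (V := K)]

theorem tau_zero (F : Type) [Field F] [Fintype F] (p : Polynomial F) (K : Type) [Field K] [Fintype K] [Algebra F K] :
    (Tp p (Matrix (Fin 0) (Fin 0) K) : ℚ) / glq (Fintype.card K) 0 = 1 := by
  have : Tp p (Matrix (Fin 0) (Fin 0) K) = 1 := by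
    rw [Tp, Nat.card_eq_one_iff_unique]
    exact ⟨⟨fun a b => Subtype.ext (Subsingleton.elim _ _)⟩, ⟨⟨0, 1, Subsingleton.elim _ _⟩⟩⟩
  rw [this, glq]
  simp

theorem tau_one (F : Type) [Field F] [Fintype F] (p : Polynomial F) (hp : Irreducible p) (K : Type) [Field K] [Fintype K] [Algebra F K] :
    (Tp p (Matrix (Fin 1) (Fin 1) K) : ℚ) / glq (Fintype.card K) 1 =
      (if p.natDegree ∣ Module.finrank F K then (p.natDegree : ℚ) else 0) / ((Fintype.card F : ℚ) ^ Module.finrank F K - 1) := by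
  have hcard : Nat.card K = Nat.card F ^ Module.finrank F K := Module.natCard_eq_pow_finrank
  have h1 : glq (Fintype.card K) 1 = (Fintype.card F : ℚ) ^ Module.finrank F K - 1 := by
    rw [glq, Module.card_eq_pow_finrank (K := F) (V := K)]
    simp
  rw [h1]
  congr 1
  have h2 : Tp p (Matrix (Fin 1) (Fin 1) K) = Nat.card (p.rootSet K) := by
    have e : Matrix (Fin 1) (Fin 1) K ≃ₐ[F] K := by
      convert Matrix.uniqueAlgEquiv (R := F) (A := K) (m := Fin 1)
    rw [Tp_congr p e, Tp]
    refine Nat.card_congr (Equiv.subtypeEquivRight fun x => ?_)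
    rw [isNilpotent_iff_eq_zero, Polynomial.mem_rootSet]
    simp [hp.ne_zero]
  rw [h2]
  split_ifs with hdv
  · have hs : (p.map (algebraMap F K)).Splits := by
      have h3 := hp.natDegree_dvd_iff_dvd_X_pow_card_pow_sub_X.1 hdv
      have h4 := Polynomial.map_dvd (algebraMap F K) h3
      rw [← hcard] at h4
      have h5 : (Polynomial.X ^ Nat.card K - Polynomial.X : Polynomial F).map (algebraMap F K) = Polynomial.X ^ Nat.card K - Polynomial.X := by simp
      rw [h5] at h4
      refine Polynomial.Splits.of_dvd ?_ ?_ h4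
      · rw [Nat.card_eq_fintype_card]
        rw [Polynomial.splits_iff_card_roots, FiniteField.roots_X_pow_card_sub_X, FiniteField.X_pow_card_sub_X_natDegree_eq _ Fintype.one_lt_card]
        simp
      · exact FiniteField.X_pow_card_sub_X_ne_zero _ Finite.one_lt_card
    rw [Nat.card_eq_fintype_card, Polynomial.card_rootSet_eq_natDegree (PerfectField.separable_of_irreducible hp) hs]
  · have : IsEmpty (p.rootSet K) := ⟨by
      rintro ⟨x, hx⟩
      rw [Polynomial.mem_rootSet] at hx
      have h3 : (Polynomial.X - Polynomial.C x) ∣ p.map (algebraMap F K) := by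
        rw [Polynomial.dvd_iff_isRoot, Polynomial.IsRoot, Polynomial.eval_map_algebraMap]
        exact hx.2
      have h4 := factor_degree F K p hp _ (Polynomial.irreducible_X_sub_C x) h3
      rw [Polynomial.natDegree_X_sub_C, mul_one] at h4
      exact hdv (h4 ▸ Nat.dvd_lcm_left _ _)⟩
    rw [Nat.card_of_isEmpty, Nat.cast_zero]
end Tau


/-! ### Part F1: abstract solution of the recursion -/
section Recur

universe u
variable {Ω : Type u} (q : Ω → ℕ)

/-- functions of the parameter that are rational in `q` -/
noncomputable def RtS : Subalgebra ℚ (Ω → ℚ) :=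
  ratS.map (Pi.algHom ℚ (fun _ : Ω => ℚ) fun ω => Pi.evalAlgHom ℚ (fun _ : ℕ => ℚ) (q ω))

theorem mem_RtS {f : Ω → ℚ} : f ∈ RtS q ↔ ∃ r ∈ ratS, ∀ ω, f ω = r (q ω) := by
  rw [RtS, Subalgebra.mem_map]
  constructor
  · rintro ⟨r, hr, rfl⟩
    exact ⟨r, hr, fun _ => rfl⟩
  · rintro ⟨r, hr, h⟩
    exact ⟨r, hr, funext fun ω => (h ω).symm⟩

theorem RtS_sum {κ : Type*} (s : Finset κ) (f : κ → Ω → ℚ) (h : ∀ k ∈ s, f k ∈ RtS q) :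
    (fun ω => ∑ k ∈ s, f k ω) ∈ RtS q := by
  have := Subalgebra.sum_mem (RtS q) h
  convert this using 1
  funext ω
  simp

theorem RtS_prod {κ : Type*} (s : Finset κ) (f : κ → Ω → ℚ) (h : ∀ k ∈ s, f k ∈ RtS q) :
    (fun ω => ∏ k ∈ s, f k ω) ∈ RtS q := by
  have := Subalgebra.prod_mem (RtS q) h
  convert this using 1
  funext ω
  simp

theorem RtS_choose (I : Ω → ℕ) (h : (fun ω => (I ω : ℚ)) ∈ RtS q) (j : ℕ) : (fun ω => ((I ω).choose j : ℚ)) ∈ RtS q := by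
  have e : (fun ω => ((I ω).choose j : ℚ)) = (fun _ => ((j.factorial : ℚ))⁻¹) * (fun ω => ∏ i ∈ Finset.range j, ((I ω : ℚ) - i)) := by
    funext ω
    exact cast_choose_prod _ _
  rw [e]
  refine Subalgebra.mul_mem _ (Subalgebra.algebraMap_mem (RtS q) _) (RtS_prod q _ (fun (i : ℕ) ω => ((I ω : ℚ) - i)) fun i _ => ?_)
  exact Subalgebra.sub_mem _ h (Subalgebra.algebraMap_mem (RtS q) _)

variable {ι : Type} [Fintype ι]

/-- families of power series with rational coefficients -/
def RtP (P : Ω → MvPowerSeries ι ℚ) : Prop := ∀ γ, (fun ω => MvPowerSeries.coeff γ (P ω)) ∈ RtS q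

theorem RtP.mul {P Q : Ω → MvPowerSeries ι ℚ} (hP : RtP q P) (hQ : RtP q Q) : RtP q (fun ω => P ω * Q ω) := by
  intro γ
  simp only [MvPowerSeries.coeff_mul]
  exact RtS_sum q _ _ fun x _ => Subalgebra.mul_mem _ (hP x.1) (hQ x.2)

theorem RtP.const (P : MvPowerSeries ι ℚ) : RtP q (fun _ : Ω => P) := fun γ => Subalgebra.algebraMap_mem (RtS q) _

theorem RtP.prod {κ : Type*} (s : Finset κ) (P : κ → Ω → MvPowerSeries ι ℚ) (h : ∀ k ∈ s, RtP q (P k)) :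
    RtP q (fun ω => ∏ k ∈ s, P k ω) := by
  induction s using Finset.induction_on with
  | empty => simpa using RtP.const q 1
  | insert a s ha ih =>
    simp only [Finset.prod_insert ha]
    exact (h a (by simp)).mul q (ih fun k hk => h k (by simp [hk]))

theorem RtP.pow {P : Ω → MvPowerSeries ι ℚ} (h : RtP q P) (j : ℕ) : RtP q (fun ω => P ω ^ j) := by
  simpa using RtP.prod q (Finset.range j) (fun _ => P) (fun _ _ => h)

theorem RtP.powI {P : Ω → MvPowerSeries ι ℚ} (h : RtP q P) (I : Ω → ℕ) (hI : (fun ω => (I ω : ℚ)) ∈ RtS q)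
    (h0 : ∀ ω, MvPowerSeries.coeff 0 (P ω) = 1) : RtP q (fun ω => P ω ^ I ω) := by
  intro γ
  have hR : RtP q (fun ω => P ω - 1) := by
    intro γ
    simp only [map_sub]
    exact Subalgebra.sub_mem _ (h γ) (Subalgebra.algebraMap_mem (RtS q) _)
  have hc : ∀ ω, MvPowerSeries.constantCoeff (P ω - 1) = 0 := by
    intro ω
    rw [map_sub, ← MvPowerSeries.coeff_zero_eq_constantCoeff_apply, h0]
    simp
  have e : (fun ω => MvPowerSeries.coeff γ (P ω ^ I ω)) = fun ω => ∑ j ∈ Finset.range (γ.degree + 1),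
      ((I ω).choose j : ℚ) * MvPowerSeries.coeff γ ((P ω - 1) ^ j) := by
    funext ω
    have hz : ∀ j, γ.degree < j → MvPowerSeries.coeff γ ((P ω - 1) ^ j) = 0 := by
      intro j hj
      refine MvPowerSeries.coeff_eq_zero_of_constantCoeff_nilpotent (m := 1) (by rw [hc, pow_one]) (by omega)
    have hs : P ω = (P ω - 1) + 1 := by ring
    conv_lhs => rw [hs, add_pow]
    rw [map_sum]
    have h1 : ∀ j, MvPowerSeries.coeff γ ((P ω - 1) ^ j * 1 ^ (I ω - j) * ((I ω).choose j : MvPowerSeries ι ℚ)) =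
        ((I ω).choose j : ℚ) * MvPowerSeries.coeff γ ((P ω - 1) ^ j) := by
      intro j
      rw [one_pow, mul_one, mul_comm, ← nsmul_eq_mul, map_nsmul, nsmul_eq_mul]
    simp only [h1]
    rcases le_total (I ω) γ.degree with hle | hle
    · refine Finset.sum_subset (by intro x; simp; omega) ?_
      intro x _ hx
      rw [Finset.mem_range] at hx
      rw [Nat.choose_eq_zero_of_lt (by omega)]
      simp
    · symm
      refine Finset.sum_subset (by intro x; simp; omega) ?_
      intro x _ hx
      rw [Finset.mem_range] at hx
      rw [hz x (by omega), mul_zero]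
  rw [e]
  exact RtS_sum q _ (fun j ω => ((I ω).choose j : ℚ) * MvPowerSeries.coeff γ ((P ω - 1) ^ j)) fun j _ =>
    Subalgebra.mul_mem _ (RtS_choose q I hI j) (hR.pow q j γ)

/-- power series `1 + c x^α + …` -/
def Gd (α : ι →₀ ℕ) (c : ℚ) (Q : MvPowerSeries ι ℚ) : Prop :=
  MvPowerSeries.coeff 0 Q = 1 ∧ MvPowerSeries.coeff α Q = c ∧ ∀ γ ≤ α, γ ≠ 0 → γ ≠ α → MvPowerSeries.coeff γ Q = 0

theorem Gd.coeff {α : ι →₀ ℕ} (hα : α ≠ 0) {c : ℚ} {Q : MvPowerSeries ι ℚ} (h : Gd α c Q) (P : MvPowerSeries ι ℚ) :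
    MvPowerSeries.coeff α (P * Q) = MvPowerSeries.coeff α P + MvPowerSeries.coeff 0 P * c := by
  rw [MvPowerSeries.coeff_mul]
  have hsub : ({(α, 0), (0, α)} : Finset ((ι →₀ ℕ) × (ι →₀ ℕ))) ⊆ Finset.HasAntidiagonal.antidiagonal α := by
    intro x hx
    simp only [Finset.mem_insert, Finset.mem_singleton] at hx
    rcases hx with rfl | rfl <;> simp [Finset.HasAntidiagonal.mem_antidiagonal]
  rw [← Finset.sum_subset hsub]
  · rw [Finset.sum_pair (by simp [hα]), h.1, h.2.1, mul_one]
  · rintro ⟨x, y⟩ hx hn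
    rw [Finset.HasAntidiagonal.mem_antidiagonal] at hx
    simp only at hx
    simp only [Finset.mem_insert, Finset.mem_singleton, Prod.mk.injEq, not_or, not_and] at hn
    rw [h.2.2 y (hx ▸ le_add_self), mul_zero]
    · rintro rfl
      exact hn.1 (by simpa using hx) rfl
    · rintro rfl
      exact hn.2 (by simpa using hx) rfl

theorem Gd.mul {α : ι →₀ ℕ} (hα : α ≠ 0) {c c' : ℚ} {Q Q' : MvPowerSeries ι ℚ} (h : Gd α c Q) (h' : Gd α c' Q') :
    Gd α (c + c') (Q * Q') := by
  refine ⟨?_, ?_, ?_⟩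
  · have := h.1
    have := h'.1
    simp only [MvPowerSeries.coeff_zero_eq_constantCoeff_apply] at *
    simp_all
  · rw [h'.coeff hα, h.2.1, h.1, one_mul]
  · intro γ hγ h0 hne
    rw [MvPowerSeries.coeff_mul]
    refine Finset.sum_eq_zero ?_
    rintro ⟨x, y⟩ hx
    rw [Finset.HasAntidiagonal.mem_antidiagonal] at hx
    simp only at hx ⊢
    have hxg : x ≤ γ := hx ▸ le_self_add
    have hyg : y ≤ γ := hx ▸ le_add_self
    have hlt : γ < α := lt_of_le_of_ne hγ hne
    by_cases hx0 : x = 0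
    · subst hx0
      rw [zero_add] at hx
      subst hx
      rw [h'.2.2 y hγ h0 hne, mul_zero]
    · rw [h.2.2 x (hxg.trans hγ) hx0 (hxg.trans_lt hlt).ne, zero_mul]

theorem Gd.one {α : ι →₀ ℕ} (hα : α ≠ 0) : Gd α 0 (1 : MvPowerSeries ι ℚ) :=
  ⟨by simp, by rw [MvPowerSeries.coeff_one, if_neg hα], fun γ _ h _ => by rw [MvPowerSeries.coeff_one, if_neg h]⟩

theorem Gd.pow {α : ι →₀ ℕ} (hα : α ≠ 0) {c : ℚ} {Q : MvPowerSeries ι ℚ} (h : Gd α c Q) (n : ℕ) :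
    Gd α (n * c) (Q ^ n) := by
  induction n with
  | zero => simpa using Gd.one hα
  | succ n ih =>
    rw [pow_succ]
    convert ih.mul hα h using 1
    push_cast
    ring

theorem Gd.prod {α : ι →₀ ℕ} (hα : α ≠ 0) {κ : Type*} (s : Finset κ) (c : κ → ℚ) (Q : κ → MvPowerSeries ι ℚ)
    (h : ∀ k ∈ s, Gd α (c k) (Q k)) : Gd α (∑ k ∈ s, c k) (∏ k ∈ s, Q k) := by
  induction s using Finset.induction_on with
  | empty => simpa using Gd.one hα
  | insert a s ha ih =>
    rw [Finset.prod_insert ha, Finset.sum_insert ha]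
    exact (h a (by simp)).mul hα (ih fun k hk => h k (by simp [hk]))

/-- the generating series of one indecomposable -/
noncomputable def QS (N : ℕ) (β : ι →₀ ℕ) (T : ℕ → ℚ) : MvPowerSeries ι ℚ :=
  ∑ k ∈ Finset.range (N + 1), MvPowerSeries.monomial (k • β) (T k)

theorem coeff_QS (N : ℕ) (β γ : ι →₀ ℕ) (T : ℕ → ℚ) :
    MvPowerSeries.coeff γ (QS N β T) = ∑ k ∈ Finset.range (N + 1), if γ = k • β then T k else 0 := by
  rw [QS, map_sum]
  refine Finset.sum_congr rfl fun k _ => ?_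
  rw [MvPowerSeries.coeff_monomial]

theorem smul_inj_ne {β : ι →₀ ℕ} (hβ : β ≠ 0) {k l : ℕ} (h : k • β = l • β) : k = l := by
  obtain ⟨i, hi⟩ := Finsupp.ne_iff.1 hβ
  have := DFunLike.congr_fun h i
  simp only [Finsupp.smul_apply, smul_eq_mul] at this
  exact Nat.eq_of_mul_eq_mul_right (Nat.pos_of_ne_zero hi) this

theorem coeff_QS_smul (N : ℕ) (β : ι →₀ ℕ) (hβ : β ≠ 0) (T : ℕ → ℚ) (k : ℕ) (hk : k ≤ N) :
    MvPowerSeries.coeff (k • β) (QS N β T) = T k := by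
  rw [coeff_QS, Finset.sum_eq_single k]
  · simp
  · intro l _ hl
    rw [if_neg fun h => hl (smul_inj_ne hβ h).symm]
  · intro h
    simp at h
    omega

theorem Gd_QS (N : ℕ) (hN : 1 ≤ N) (β : ι →₀ ℕ) (hβ : β ≠ 0) (T : ℕ → ℚ) (h0 : T 0 = 1) : Gd β (T 1) (QS N β T) := by
  refine ⟨?_, ?_, ?_⟩
  · have := coeff_QS_smul N β hβ T 0 (by omega)
    rwa [zero_smul, h0] at this
  · have := coeff_QS_smul N β hβ T 1 (by omega)
    rwa [one_smul] at this
  · intro γ hγ h1 h2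
    rw [coeff_QS]
    refine Finset.sum_eq_zero fun k _ => if_neg ?_
    rintro rfl
    rcases k with _ | _ | k
    · simp at h1
    · simp at h2
    · obtain ⟨i, hi⟩ := Finsupp.ne_iff.1 hβ
      have := hγ i
      simp only [Finsupp.smul_apply, smul_eq_mul, Finsupp.zero_apply] at this hi
      have h3 : 0 < β i := Nat.pos_of_ne_zero hi
      nlinarith

theorem RtP_QS (N : ℕ) (β : ι →₀ ℕ) (T : Ω → ℕ → ℚ) (hT : ∀ m, (fun ω => T ω m) ∈ RtS q) : RtP q (fun ω => QS N β (T ω)) := by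
  intro γ
  simp only [coeff_QS]
  refine RtS_sum q _ (fun k ω => if γ = k • β then T ω k else 0) fun k _ => ?_
  by_cases h : γ = k • β
  · simpa [h] using hT k
  · simp only [h, if_false]
    exact Subalgebra.zero_mem (RtS q)

end Recur


section Recur2
universe u
variable {Ω : Type u} (q : Ω → ℕ) {ι : Type} [Fintype ι]

theorem RtS_qpow (hq : ∀ ω, 2 ≤ q ω) (e : ℕ) : (fun ω => (q ω : ℚ) ^ e) ∈ RtS q :=
  (mem_RtS q).2 ⟨_, ratS_pow e, fun _ => rfl⟩

theorem RtS_qinv (hq : ∀ ω, 2 ≤ q ω) (e : ℕ) : (fun ω => ((q ω : ℚ) ^ e - 1)⁻¹) ∈ RtS q := by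
  rcases Nat.eq_zero_or_pos e with rfl | he
  · simp only [pow_zero, sub_self, _root_.inv_zero]
    exact Subalgebra.zero_mem (RtS q)
  · refine (mem_RtS q).2 ⟨_, ratS_inv (ratS_sub (ratS_pow e) (ratS_const 1)) ?_, fun _ => rfl⟩
    intro k hk
    have : (1 : ℚ) < (k : ℚ) ^ e := one_lt_pow₀ (by exact_mod_cast hk) (by omega)
    linarith

theorem solve_prod (I : Ω → (ι →₀ ℕ) → ℕ → ℕ) (hI0 : ∀ ω e, I ω 0 e = 0)
    (T : Ω → ℕ → ℕ → ℚ) (hT : ∀ e m, (fun ω => T ω e m) ∈ RtS q)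
    (hT0 : ∀ ω e, T ω e 0 = 1) (N : ℕ) (hN : 1 ≤ N) (S : Finset ((ι →₀ ℕ) × ℕ))
    (ih : ∀ x ∈ S, (fun ω => (I ω x.1 x.2 : ℚ)) ∈ RtS q) :
    RtP q (fun ω => ∏ x ∈ S, QS N x.1 (T ω x.2) ^ I ω x.1 x.2) := by
  refine RtP.prod q S (fun x ω => QS N x.1 (T ω x.2) ^ I ω x.1 x.2) ?_
  intro x hx
  by_cases h0 : x.1 = 0
  · have : (fun ω => QS N x.1 (T ω x.2) ^ I ω x.1 x.2) = fun ω => 1 := by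
      funext ω
      rw [h0, hI0, pow_zero]
    rw [this]
    exact RtP.const q 1
  · exact RtP.powI q (RtP_QS q N x.1 (fun ω => T ω x.2) (hT x.2)) _ (ih x hx)
      (fun ω => (Gd_QS _ hN _ h0 _ (hT0 ω _)).1)

theorem solve_prod0 (I : (ι →₀ ℕ) → ℕ → ℕ) (hI0 : ∀ e, I 0 e = 0)
    (T : ℕ → ℕ → ℚ) (hT0 : ∀ e, T e 0 = 1) (N : ℕ) (hN : 1 ≤ N) (S : Finset ((ι →₀ ℕ) × ℕ)) :
    MvPowerSeries.coeff 0 (∏ x ∈ S, QS N x.1 (T x.2) ^ I x.1 x.2) = 1 := by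
  rw [MvPowerSeries.coeff_zero_eq_constantCoeff_apply, map_prod]
  refine Finset.prod_eq_one ?_
  intro x hx
  by_cases h0 : x.1 = 0
  · rw [h0, hI0, pow_zero, map_one]
  · have := (Gd_QS _ hN _ h0 _ (hT0 x.2)).1
    rw [MvPowerSeries.coeff_zero_eq_constantCoeff_apply] at this
    rw [map_pow, this, one_pow]

theorem solve_key (I : (ι →₀ ℕ) → ℕ → ℕ) (hI0 : ∀ e, I 0 e = 0)
    (T : ℕ → ℕ → ℚ) (hT0 : ∀ e, T e 0 = 1) (N : ℕ) (hN : 1 ≤ N) (α : ι →₀ ℕ) (hα : α ≠ 0) (R : Finset ℕ) :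
    MvPowerSeries.coeff α (∏ x ∈ Finset.Iic α ×ˢ R, QS N x.1 (T x.2) ^ I x.1 x.2) =
      MvPowerSeries.coeff α (∏ x ∈ Finset.Iio α ×ˢ R, QS N x.1 (T x.2) ^ I x.1 x.2) + ∑ e ∈ R, (I α e : ℚ) * T e 1 := by
  have hG := Gd.prod hα R (fun e => (I α e : ℚ) * T e 1) (fun e => QS N α (T e) ^ I α e)
    (fun e _ => (Gd_QS N hN α hα (T e) (hT0 e)).pow hα (I α e))
  have h1 : ∏ x ∈ Finset.Iic α ×ˢ R, QS N x.1 (T x.2) ^ I x.1 x.2 =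
      (∏ x ∈ Finset.Iio α ×ˢ R, QS N x.1 (T x.2) ^ I x.1 x.2) * ∏ e ∈ R, QS N α (T e) ^ I α e := by
    rw [Finset.prod_product, Finset.prod_product]
    have : Finset.Iic α = insert α (Finset.Iio α) := by
      ext x
      simp [le_iff_eq_or_lt]
    rw [this, Finset.prod_insert (by simp), mul_comm]
  rw [h1, hG.coeff hα, solve_prod0 I hI0 T hT0 N hN, one_mul]

theorem solve (hq : ∀ ω, 2 ≤ q ω) (I : Ω → (ι →₀ ℕ) → ℕ → ℕ) (B : (ι →₀ ℕ) → ℕ)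
    (hB : ∀ ω α β e, β ≤ α → B α < e → I ω β e = 0) (hI0 : ∀ ω e, I ω 0 e = 0) (hIe : ∀ ω β, I ω β 0 = 0)
    (T : ℕ → Ω → ℕ → ℕ → ℚ) (hT : ∀ d, 1 ≤ d → ∀ e m, (fun ω => T d ω e m) ∈ RtS q)
    (hT0 : ∀ d ω e, T d ω e 0 = 1)
    (hT1 : ∀ d ω e, T d ω e 1 = (if d ∣ e then (d : ℚ) else 0) * ((q ω : ℚ) ^ e - 1)⁻¹)
    (hH : ∀ α d, 1 ≤ d → (fun ω => MvPowerSeries.coeff α (∏ x ∈ Finset.Iic α ×ˢ Finset.range (B α + 1),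
      QS α.degree x.1 (T d ω x.2) ^ I ω x.1 x.2)) ∈ RtS q) :
    ∀ β e, (fun ω => (I ω β e : ℚ)) ∈ RtS q := by
  intro α
  induction α using WellFoundedLT.induction with
  | ind α ih =>
  by_cases hα : α = 0
  · subst hα
    intro e
    simp only [hI0, Nat.cast_zero]
    exact Subalgebra.zero_mem (RtS q)
  have hdeg : 1 ≤ α.degree := by
    by_contra h
    have : α.degree = 0 := by omega
    exact hα ((Finsupp.degree_eq_zero_iff α).1 this)
  have hsum : ∀ d, 1 ≤ d → (fun ω => ∑ e ∈ Finset.range (B α + 1), (I ω α e : ℚ) * ((if d ∣ e then (d : ℚ) else 0) * ((q ω : ℚ) ^ e - 1)⁻¹)) ∈ RtS q := by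
    intro d hd
    have hP := solve_prod q I hI0 (T d) (hT d hd) (hT0 d) α.degree hdeg (Finset.Iio α ×ˢ Finset.range (B α + 1))
      (fun x hx => ih x.1 (Finset.mem_Iio.1 (Finset.mem_product.1 hx).1) x.2) α
    have h2 := Subalgebra.sub_mem _ (hH α d hd) hP
    refine Set.mem_of_eq_of_mem ?_ h2
    funext ω
    rw [Pi.sub_apply, solve_key (I ω) (hI0 ω) (T d ω) (hT0 d ω) _ hdeg α hα, add_sub_cancel_left]
    exact Finset.sum_congr rfl fun e _ => by rw [hT1]
  have hdown : ∀ k d, 1 ≤ d → B α < d + k → (fun ω => (I ω α d : ℚ)) ∈ RtS q := by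
    intro k
    induction k with
    | zero =>
      intro d hd hlt
      simp only [fun ω => hB ω α α d le_rfl hlt, Nat.cast_zero]
      exact Subalgebra.zero_mem (RtS q)
    | succ k ihk =>
      intro d hd hlt
      by_cases hdB : B α < d
      · simp only [fun ω => hB ω α α d le_rfl hdB, Nat.cast_zero]
        exact Subalgebra.zero_mem (RtS q)
      have hr : (fun ω => ∑ e ∈ (Finset.range (B α + 1)).erase d, (I ω α e : ℚ) * ((if d ∣ e then (d : ℚ) else 0) * ((q ω : ℚ) ^ e - 1)⁻¹)) ∈ RtS q := by
        refine RtS_sum q _ (fun e ω => (I ω α e : ℚ) * ((if d ∣ e then (d : ℚ) else 0) * ((q ω : ℚ) ^ e - 1)⁻¹)) ?_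
        intro e he
        rw [Finset.mem_erase] at he
        by_cases hde : d ∣ e
        · rcases Nat.eq_zero_or_pos e with rfl | hpos
          · simp only [hIe, Nat.cast_zero, zero_mul]
            exact Subalgebra.zero_mem (RtS q)
          · have := Nat.le_of_dvd hpos hde
            refine Subalgebra.mul_mem _ (ihk e (by omega) (by have := he.1; omega))
              (Subalgebra.mul_mem _ (Subalgebra.algebraMap_mem (RtS q) _) (RtS_qinv q hq e))
        · simp only [hde, if_false, zero_mul, mul_zero]
          exact Subalgebra.zero_mem (RtS q)
      have h3 := Subalgebra.sub_mem _ (hsum d hd) hr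
      have h4 : (fun ω => (I ω α d : ℚ)) = (fun ω => ((d : ℚ))⁻¹ * ((q ω : ℚ) ^ d - 1)) *
         ((fun ω => ∑ e ∈ Finset.range (B α + 1), (I ω α e : ℚ) * ((if d ∣ e then (d : ℚ) else 0) * ((q ω : ℚ) ^ e - 1)⁻¹)) -
          fun ω => ∑ e ∈ (Finset.range (B α + 1)).erase d, (I ω α e : ℚ) * ((if d ∣ e then (d : ℚ) else 0) * ((q ω : ℚ) ^ e - 1)⁻¹)) := by
        funext ω
        rw [Pi.mul_apply, Pi.sub_apply, ← Finset.add_sum_erase _ _ (show d ∈ Finset.range (B α + 1) by simp; omega), add_sub_cancel_right,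
          if_pos dvd_rfl]
        have hd0 : (d : ℚ) ≠ 0 := by positivity
        have : (1 : ℚ) < (q ω : ℚ) ^ d := one_lt_pow₀ (by exact_mod_cast hq ω) (by omega)
        have h5 : (q ω : ℚ) ^ d - 1 ≠ 0 := by linarith
        field_simp
      rw [h4]
      exact Subalgebra.mul_mem _ (Subalgebra.mul_mem _ (Subalgebra.algebraMap_mem (RtS q) _)
        (Subalgebra.sub_mem _ (RtS_qpow q hq d) (Subalgebra.one_mem _))) h3
  intro e
  rcases Nat.eq_zero_or_pos e with rfl | he
  · simp only [hIe, Nat.cast_zero]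
    exact Subalgebra.zero_mem (RtS q)
  · exact hdown (B α + 1) e he (by omega)

end Recur2


section Cls
variable (F : Type) [Field F] [Fintype F] {ι Ar : Type} [Fintype ι] [Fintype Ar] (s t : Ar → ι) (w : ι → ℚ)

/-- indecomposable semistable representations -/
def IndS (β : ι → ℕ) : Type := {σ : FRep F s t (stdV F β) // SS w σ ∧ Indec (QA F ι Ar) (TM σ)}

instance (β : ι → ℕ) : Finite (IndS F s t w β) := inferInstanceAs (Finite {σ : FRep F s t (stdV F β) // _})

instance clsS (β : ι → ℕ) : Setoid (IndS F s t w β) where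
  r σ σ' := Nonempty (TM σ.1 ≃ₗ[QA F ι Ar] TM σ'.1)
  iseqv := ⟨fun σ => ⟨LinearEquiv.refl _ _⟩, fun ⟨e⟩ => ⟨e.symm⟩, fun ⟨e⟩ ⟨e'⟩ => ⟨e.trans e'⟩⟩

/-- isomorphism classes -/
def Cls (β : ι → ℕ) : Type := Quotient (clsS F s t w β)

instance (β : ι → ℕ) : Finite (Cls F s t w β) := inferInstanceAs (Finite (Quotient _))

variable {F s t w}
/-- a representative -/
noncomputable def rep (β : ι → ℕ) (c : Cls F s t w β) : FRep F s t (stdV F β) := (Quotient.out c).1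

theorem rep_SS {β : ι → ℕ} (c : Cls F s t w β) : SS w (rep β c) := (Quotient.out c).2.1
theorem rep_Indec {β : ι → ℕ} (c : Cls F s t w β) : Indec (QA F ι Ar) (TM (rep β c)) := (Quotient.out c).2.2

theorem rep_inj {β : ι → ℕ} (c c' : Cls F s t w β) (h : Nonempty (TM (rep β c) ≃ₗ[QA F ι Ar] TM (rep β c'))) : c = c' := by
  rw [← Quotient.out_eq c, ← Quotient.out_eq c']
  exact Quotient.sound h

theorem rep_mk {β : ι → ℕ} (σ : IndS F s t w β) : Nonempty (TM σ.1 ≃ₗ[QA F ι Ar] TM (rep β (Quotient.mk _ σ : Cls F s t w β))) :=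
  ((Quotient.mk_out (s := clsS F s t w β) σ : Nonempty _).map fun e => e.symm)

/-- residue degree -/
noncomputable def edeg {β : ι → ℕ} (c : Cls F s t w β) : ℕ := rdeg F (Module.End (QA F ι Ar) (TM (rep β c)))

theorem rdeg_bound {β : ι → ℕ} (σ : FRep F s t (stdV F β)) (h : Indec (QA F ι Ar) (TM σ)) :
    1 ≤ rdeg F (Module.End (QA F ι Ar) (TM σ)) ∧ rdeg F (Module.End (QA F ι Ar) (TM σ)) ≤ ∑ i, β i ^ 2 := by
  haveI := h.local
  obtain ⟨K, _, _, _, π, hs, h0⟩ := residue F (Module.End (QA F ι Ar) (TM σ))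
  rw [← rdeg_eq F _ K π hs h0]
  haveI : Module.Finite F K := Module.Finite.of_finite
  refine ⟨Module.finrank_pos, ?_⟩
  haveI : Module.Finite F (Module.End (QA F ι Ar) (TM σ)) := Module.Finite.of_finite
  have h1 : Module.finrank F K ≤ Module.finrank F (Module.End (QA F ι Ar) (TM σ)) := by
    exact LinearMap.finrank_le_finrank_of_surjective (f := π.toLinearMap) hs
  have h2 : Module.finrank F (Module.End (QA F ι Ar) (TM σ)) ≤ Module.finrank F (∀ i, Module.End F (stdV F β i)) :=
    LinearMap.finrank_le_finrank_of_injective (f := (famAlg σ).toLinearMap) (famAlg_inj σ)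
  refine h1.trans (h2.trans (le_of_eq ?_))
  rw [Module.finrank_pi_fintype]
  refine Finset.sum_congr rfl fun i _ => ?_
  rw [Module.finrank_linearMap]
  simp [stdV, sq]

variable (F s t w) in
/-- number of classes -/
noncomputable def Icnt (β : ι → ℕ) (e : ℕ) : ℕ := Nat.card {c : Cls F s t w β // edeg c = e}

theorem Icnt_bound (α β : ι → ℕ) (e : ℕ) (h : β ≤ α) (he : ∑ i, α i ^ 2 < e) : Icnt F s t w β e = 0 := by
  haveI : IsEmpty {c : Cls F s t w β // edeg c = e} := ⟨by
    rintro ⟨c, rfl⟩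
    have h1 := (rdeg_bound (rep β c) (rep_Indec c)).2
    have h2 : ∑ i, β i ^ 2 ≤ ∑ i, α i ^ 2 := Finset.sum_le_sum fun i _ => Nat.pow_le_pow_left (h i) 2
    have : edeg c ≤ ∑ i, β i ^ 2 := h1
    omega⟩
  rw [Icnt, Nat.card_of_isEmpty]

theorem Icnt_e0 (β : ι → ℕ) : Icnt F s t w β 0 = 0 := by
  haveI : IsEmpty {c : Cls F s t w β // edeg c = 0} := ⟨by
    rintro ⟨c, hc⟩
    have h1 : 1 ≤ edeg c := (rdeg_bound (rep β c) (rep_Indec c)).1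
    omega⟩
  rw [Icnt, Nat.card_of_isEmpty]

theorem Indec_ne_zero {β : ι → ℕ} (σ : FRep F s t (stdV F β)) (h : Indec (QA F ι Ar) (TM σ)) : β ≠ 0 := by
  rintro rfl
  have h1 := h.1
  haveI : Subsingleton (TM σ) := inferInstanceAs (Subsingleton (∀ i, Fin 0 → F))
  exact not_subsingleton (TM σ) inferInstance

theorem Icnt_00 (e : ℕ) : Icnt F s t w (0 : ι → ℕ) e = 0 := by
  haveI : IsEmpty {c : Cls F s t w (0 : ι → ℕ) // edeg c = e} := ⟨fun c => Indec_ne_zero _ (rep_Indec c.1) rfl⟩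
  rw [Icnt, Nat.card_of_isEmpty]

end Cls

theorem prod_monom {ι κ : Type} (S : Finset κ) (g : κ → ι →₀ ℕ) (c : κ → ℚ) :
    ∏ x ∈ S, MvPowerSeries.monomial (g x) (c x) = MvPowerSeries.monomial (∑ x ∈ S, g x) (∏ x ∈ S, c x) := by
  induction S using Finset.induction_on with
  | empty => simp
  | insert a S ha ih => rw [Finset.prod_insert ha, Finset.prod_insert ha, Finset.sum_insert ha, ih, MvPowerSeries.monomial_mul_monomial]

theorem coeff_prod_QS {ι 𝒳 : Type} [Fintype 𝒳] [DecidableEq 𝒳] (N : ℕ) (b : 𝒳 → ι →₀ ℕ) (T : 𝒳 → ℕ → ℚ) (α : ι →₀ ℕ) :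
    MvPowerSeries.coeff α (∏ x, QS N (b x) (T x)) =
      ∑ m ∈ (Fintype.piFinset fun _ : 𝒳 => Finset.range (N + 1)).filter (fun m => ∑ x, m x • b x = α), ∏ x, T x (m x) := by
  simp only [QS]
  rw [Finset.prod_univ_sum, map_sum, Finset.sum_filter]
  refine Finset.sum_congr rfl fun m _ => ?_
  rw [prod_monom, MvPowerSeries.coeff_monomial]
  simp only [eq_comm]


section HuaGen
variable {F : Type} [Field F] [Fintype F] {ι Ar : Type} [Fintype ι] [Fintype Ar] {s t : Ar → ι} {w : ι → ℚ}

theorem deg_sum (α : ι →₀ ℕ) : α.degree = ∑ i, α i := by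
  rw [Finsupp.degree_eq_sum]

set_option maxHeartbeats 2000000 in
theorem hua_gen (α : ι →₀ ℕ) (p : Polynomial F) (T : ℕ → ℕ → ℚ)
    (hT : ∀ (K : Type) [Field K] [Fintype K] [Algebra F K] (m : ℕ),
      (Tp p (Matrix (Fin m) (Fin m) K) : ℚ) / glq (Fintype.card K) m = T (Module.finrank F K) m) :
    (nT F s t w p α : ℚ) / ∏ i, glq (Fintype.card F) (α i) =
      MvPowerSeries.coeff α (∏ x ∈ Finset.Iic α ×ˢ Finset.range (∑ i, α i ^ 2 + 1),
        QS α.degree x.1 (T x.2) ^ Icnt F s t w x.1 x.2) := by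
  let 𝒳 : Type := Σ β : {β : ι →₀ ℕ // β ∈ Finset.Iic α}, Cls F s t w (⇑β.1)
  letI : Fintype 𝒳 := Fintype.ofFinite _
  let b : 𝒳 → ι →₀ ℕ := fun x => x.1.1
  let r : ∀ x : 𝒳, FRep F s t (stdV F (⇑(b x))) := fun x => rep _ x.2
  have hI : ∀ x, Indec (QA F ι Ar) (TM (r x)) := fun x => rep_Indec x.2
  have hne : ∀ x y, Nonempty (TM (r x) ≃ₗ[QA F ι Ar] TM (r y)) → x = y := by
    rintro ⟨⟨β, hβ⟩, c⟩ ⟨⟨β', hβ'⟩, c'⟩ ⟨e⟩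
    have h1 : β = β' := by
      ext i
      have := finrank_iso e i
      simpa [stdV, b] using this
    subst h1
    have h2 : c = c' := rep_inj c c' ⟨e⟩
    rw [h2]
  have hcov : ∀ β ≤ (⇑α : ι → ℕ), ∀ σ : FRep F s t (stdV F β), SS w σ → Indec (QA F ι Ar) (TM σ) →
      ∃ x, Nonempty (TM σ ≃ₗ[QA F ι Ar] TM (r x)) := by
    intro β hβ σ h1 h2
    obtain ⟨β, rfl⟩ : ∃ β' : ι →₀ ℕ, ⇑β' = β := ⟨Finsupp.equivFunOnFinite.symm β, rfl⟩
    exact ⟨⟨⟨β, Finset.mem_Iic.2 hβ⟩, Quotient.mk _ ⟨σ, h1, h2⟩⟩, rep_mk ⟨σ, h1, h2⟩⟩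
  have hb0 : ∀ x, b x ≠ 0 := fun x h => Indec_ne_zero (r x) (hI x) (by rw [h]; rfl)
  have hS : ∀ m : 𝒳 → ℕ, m ∈ (Fintype.piFinset fun _ : 𝒳 => Finset.range (α.degree + 1)).filter (fun m => ∑ x, m x • b x = α) ↔
      ∀ i, ∑ x, m x * b x i = α i := by
    intro m
    rw [Finset.mem_filter, DFunLike.ext_iff]
    have e1 : ∀ i, (∑ x, m x • b x) i = ∑ x, m x * b x i := by
      intro i
      simp [Finsupp.finset_sum_apply]
    simp only [e1]
    refine ⟨fun h => h.2, fun h => ⟨?_, h⟩⟩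
    rw [Fintype.mem_piFinset]
    intro x
    rw [Finset.mem_range, deg_sum]
    obtain ⟨i, hi⟩ := Finsupp.ne_iff.1 (hb0 x)
    rw [Finsupp.zero_apply] at hi
    have h1 : m x ≤ m x * b x i := Nat.le_mul_of_pos_right _ (Nat.pos_of_ne_zero hi)
    have h2 : m x * b x i ≤ ∑ x, m x * b x i := Finset.single_le_sum (f := fun x => m x * b x i) (fun _ _ => Nat.zero_le _) (Finset.mem_univ x)
    have h3 : α i ≤ ∑ i, α i := Finset.single_le_sum (fun _ _ => Nat.zero_le _) (Finset.mem_univ i)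
    have h4 := h i
    omega
  have key := hua w (fun x => ⇑(b x)) r (fun x => rep_SS x.2) hI hne α hcov p T hT _ hS
  rw [key]
  let e : 𝒳 → ℕ := fun x => edeg x.2
  have h1 := coeff_prod_QS α.degree b (fun x => T (e x)) α
  refine Eq.trans h1.symm ?_
  congr 1
  have hmaps : ∀ x ∈ (Finset.univ : Finset 𝒳), (b x, e x) ∈ Finset.Iic α ×ˢ Finset.range (∑ i, α i ^ 2 + 1) := by
    intro x _
    rw [Finset.mem_product]
    refine ⟨x.1.2, ?_⟩
    rw [Finset.mem_range, Nat.lt_succ_iff]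
    refine (rdeg_bound (r x) (hI x)).2.trans (Finset.sum_le_sum fun i _ => Nat.pow_le_pow_left (Finset.mem_Iic.1 x.1.2 i) 2)
  rw [← Finset.prod_fiberwise_of_maps_to hmaps]
  refine Finset.prod_congr rfl ?_
  rintro ⟨β, k⟩ hβ
  rw [Finset.mem_product] at hβ
  have h2 : ∀ x ∈ (Finset.univ : Finset 𝒳).filter (fun x => (b x, e x) = (β, k)), QS α.degree (b x) (T (e x)) = QS α.degree β (T k) := by
    intro x hx
    rw [Finset.mem_filter] at hx
    have := Prod.mk.inj hx.2
    rw [this.1, this.2]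
  rw [Finset.prod_congr rfl h2, Finset.prod_const]
  congr 1
  rw [← Fintype.card_subtype, Icnt, ← Nat.card_eq_fintype_card]
  symm
  refine Nat.card_congr (Equiv.ofBijective (fun c : {c : Cls F s t w (⇑β) // edeg c = k} =>
    (⟨⟨⟨β, hβ.1⟩, c.1⟩, Prod.ext rfl c.2⟩ : {x : 𝒳 // (b x, e x) = (β, k)})) ⟨?_, ?_⟩)
  · rintro ⟨c, hc⟩ ⟨c', hc'⟩ h
    have h3 := Subtype.mk.inj h
    exact Subtype.ext (eq_of_heq (Sigma.mk.inj h3).2)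
  · rintro ⟨⟨⟨β', h'⟩, c⟩, hx⟩
    obtain ⟨h3, h4⟩ := Prod.mk.inj hx
    change β' = β at h3
    subst h3
    exact ⟨⟨c, h4⟩, rfl⟩

end HuaGen

/-- finite fields -/
structure FFld : Type 1 where
  F : Type
  fld : Field F
  fin : Fintype F

noncomputable def FFld.q (ω : FFld) : ℕ := @Fintype.card ω.F ω.fin

theorem FFld.two_le (ω : FFld) : 2 ≤ ω.q := by
  letI := ω.fld
  letI := ω.fin
  exact Fintype.one_lt_card

theorem exists_irr (F : Type) [Field F] [Fintype F] (d : ℕ) (hd : 1 ≤ d) : ∃ p : Polynomial F, Irreducible p ∧ p.natDegree = d := by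
  obtain ⟨c, hc⟩ := CharP.exists F
  haveI : Fact c.Prime := ⟨CharP.char_is_prime F c⟩
  haveI : NeZero d := ⟨by omega⟩
  obtain ⟨x, hx⟩ := Field.exists_primitive_element F (FiniteField.Extension F c d)
  have h_int : IsIntegral F x := Algebra.IsIntegral.isIntegral x
  refine ⟨minpoly F x, minpoly.irreducible h_int, ?_⟩
  rw [← IntermediateField.adjoin.finrank h_int, hx, IntermediateField.finrank_top', FiniteField.finrank_extension]

theorem rat_Icnt {ι Ar : Type} [Fintype ι] [Fintype Ar] (s t : Ar → ι) (w : ι → ℚ) (α : ι → ℕ) (e : ℕ) :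
    ∃ r ∈ ratS, ∀ (F : Type) [Field F] [Fintype F], (Icnt F s t w α e : ℚ) = r (Fintype.card F) := by
  choose! tau htau1 htau2 using rat_tau
  choose! rT hrT1 hrT2 using fun (d : ℕ) (hd : 1 ≤ d) (α : ι → ℕ) => rat_T s t w d hd α
  let T : ℕ → FFld → ℕ → ℕ → ℚ := fun d ω e m => if m = 0 then 1 else if m = 1 then
    (if d ∣ e then (d : ℚ) else 0) * ((ω.q : ℚ) ^ e - 1)⁻¹ else tau d e m ω.q
  have hmain := solve (ι := ι) FFld.q FFld.two_le (fun ω β e => letI := ω.fld; letI := ω.fin; Icnt ω.F s t w β e)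
    (fun α => ∑ i, α i ^ 2) ?_ ?_ ?_ T ?_ ?_ ?_ ?_ (Finsupp.equivFunOnFinite.symm α) e
  · obtain ⟨r, hr, h⟩ := (mem_RtS _).1 hmain
    exact ⟨r, hr, fun F _ _ => h ⟨F, inferInstance, inferInstance⟩⟩
  · rintro ⟨F, _, _⟩ α β e h he
    exact Icnt_bound α β e h he
  · rintro ⟨F, _, _⟩ e
    exact Icnt_00 e
  · rintro ⟨F, _, _⟩ β
    exact Icnt_e0 β
  · intro d hd e m
    rcases m with _ | _ | m
    · exact Subalgebra.one_mem (RtS FFld.q)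
    · exact Subalgebra.mul_mem (RtS FFld.q) (Subalgebra.algebraMap_mem (RtS FFld.q) _) (RtS_qinv FFld.q FFld.two_le e)
    · exact (mem_RtS _).2 ⟨_, htau1 d hd e (m + 2), fun ω => rfl⟩
  · intro d ω e
    rfl
  · intro d ω e
    rfl
  · intro α d hd
    refine (mem_RtS _).2 ⟨_, ratS_div (hrT1 d hd α) (ratS_prod Finset.univ (a := fun i q => glq q (α i)) fun i _ => ratS_glq (α i))
      (fun q hq => Finset.prod_ne_zero_iff.2 fun i _ => glq_ne_zero hq _), ?_⟩
    rintro ⟨F, _, _⟩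
    obtain ⟨p, hp, hpd⟩ := exists_irr F d hd
    have h1 := hua_gen (F := F) (s := s) (t := t) (w := w) α p (T d ⟨F, inferInstance, inferInstance⟩) ?_
    · refine Eq.trans h1.symm ?_
      rw [hrT2 d hd α F p hp hpd]
      rfl
    · intro K _ _ _ m
      rcases m with _ | _ | m
      · rw [tau_zero]
        rfl
      · rw [tau_one F p hp K, hpd]
        rfl
      · exact htau2 d hd _ _ F p hp hpd K rfl


/-! ### Part G1: absolutely indecomposable = residue degree one, abstract form -/
section AbsIndecAbstract
open scoped Pointwise

theorem rad_nilp {E K : Type} [Ring E] [Finite E] [Field K] (π : E →+* K) (h0 : ∀ f, π f = 0 ↔ ¬ IsUnit f) :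
    ∃ m : ℕ, ∀ x ∈ ({f : E | π f = 0} ^ m : Set E), x = 0 := by
  obtain ⟨m, hm⟩ := IsArtinianRing.isNilpotent_jacobson_bot (R := E)
  rw [Ideal.jacobson_bot] at hm
  have hle : {f : E | π f = 0} ⊆ (Ring.jacobson E : Set E) := by
    intro x hx
    rw [SetLike.mem_coe, Ring.jacobson_eq_sInf_isMaximal, Submodule.mem_sInf]
    intro M hM
    by_contra hxM
    have hM' : Ideal.IsMaximal (M : Ideal E) := hM
    have hsup : (M ⊔ Submodule.span E {x} : Submodule E E) = ⊤ := by
      refine hM'.1.2 _ (lt_of_le_of_ne le_sup_left ?_)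
      intro h
      apply hxM
      have : x ∈ M ⊔ Submodule.span E {x} := Submodule.mem_sup_right (Submodule.mem_span_singleton_self x)
      rwa [← h] at this
    obtain ⟨i, hi, z, hz, h'⟩ := Submodule.mem_sup.1 (hsup ▸ Submodule.mem_top : (1 : E) ∈ M ⊔ Submodule.span E {x})
    obtain ⟨y, rfl⟩ := Submodule.mem_span_singleton.1 hz
    have h : y * x + i = 1 := by rw [add_comm]; exact h'
    have hx' : π x = 0 := hx
    have h1 : π i = 1 := by
      have := congrArg π h
      rw [map_add, map_mul, hx', mul_zero, zero_add, map_one] at this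
      exact this
    have h2 : IsUnit i := by
      by_contra h3
      rw [(h0 i).2 h3] at h1
      exact zero_ne_one h1
    exact hM'.ne_top (Ideal.eq_top_of_isUnit_mem _ hi h2)
  have hpow : ∀ k, ({f : E | π f = 0} ^ k : Set E) ⊆ ((Ring.jacobson E ^ k : Ideal E) : Set E) := by
    intro k
    induction k with
    | zero => intro x _; rw [Submodule.pow_zero, Ideal.one_eq_top]; trivial
    | succ k ih =>
      rw [pow_succ, Submodule.pow_succ]
      rintro x ⟨a, ha, b, hb, rfl⟩
      exact Ideal.mul_mem_mul (ih ha) (hle hb)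
  refine ⟨m, fun x hx => ?_⟩
  have := hpow m hx
  rw [hm] at this
  simpa using this

variable {F : Type} [Field F] [Fintype F] {E : Type} [Ring E] [Finite E] [Algebra F E] [Nontrivial E]
  {L : Type} [Field L] [IsAlgClosed L] [Algebra F L] {A : Type} [Ring A] [Algebra L A] [Module.Finite L A] [Nontrivial A]
  (g : E →+* A) (hg : ∀ (c : F) (x : E), g (c • x) = algebraMap F L c • g x)

theorem idem_of_rdeg (hspan : Submodule.span L (Set.range g) = ⊤) (hg : ∀ (c : F) (x : E), g (c • x) = algebraMap F L c • g x)
    [IsLocalRing E] (hd : rdeg F E = 1) (e : A) (he : e * e = e) : e = 0 ∨ e = 1 := by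
  obtain ⟨K, _, _, _, π, hs, h0⟩ := residue F E
  rw [← rdeg_eq F E K π hs h0] at hd
  obtain ⟨m, hm⟩ := rad_nilp π.toRingHom h0
  set J : Set E := {f : E | π.toRingHom f = 0} with hJ
  set N : Submodule L A := Submodule.span L (g '' J) with hN
  have hNm : N ^ m = ⊥ := by
    rw [hN, Submodule.span_pow, ← Set.image_pow, eq_bot_iff, Submodule.span_le]
    rintro _ ⟨x, hx, rfl⟩
    rw [hm x hx, map_zero]
    exact Submodule.zero_mem _
  have hle : (⊤ : Submodule L A) ≤ Submodule.span L {1} ⊔ N := by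
    rw [← hspan, Submodule.span_le]
    rintro _ ⟨x, rfl⟩
    obtain ⟨c, hc⟩ := (finrank_eq_one_iff_of_nonzero' (1 : K) one_ne_zero).1 hd (π x)
    have h1 : x = c • 1 + (x - c • 1) := by abel
    rw [h1, map_add, hg, map_one]
    refine Submodule.add_mem_sup (Submodule.smul_mem _ _ (Submodule.subset_span rfl)) (Submodule.subset_span ⟨_, ?_, rfl⟩)
    change π (x - c • 1) = 0
    rw [map_sub, map_smul, map_one, hc, sub_self]
  obtain ⟨y, hy, z, hz, hyz⟩ := Submodule.mem_sup.1 (hle (Submodule.mem_top (x := e)))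
  obtain ⟨l, rfl⟩ := Submodule.mem_span_singleton.1 hy
  have hzn : IsNilpotent z := ⟨m, by
    have := Submodule.pow_mem_pow N hz m
    rwa [hNm, Submodule.mem_bot] at this⟩
  by_cases hl : l = 0
  · left
    rw [hl, zero_smul, zero_add] at hyz
    subst hyz
    obtain ⟨k, hk⟩ := hzn
    have h2 : z ^ (k + 1) = z := IsIdempotentElem.pow_succ_eq k he
    rw [← h2, pow_succ, hk, zero_mul]
  · right
    have hu : IsUnit (l • (1 : A)) := by
      rw [← Algebra.algebraMap_eq_smul_one]
      exact (IsUnit.mk0 l hl).map _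
    have hc : Commute z (l • (1 : A)) := by
      rw [← Algebra.algebraMap_eq_smul_one]
      exact (Algebra.commutes l z).symm
    have h3 := hzn.isUnit_add_left_of_commute hu hc
    rw [hyz] at h3
    exact h3.mul_left_cancel (by rw [he, mul_one])

theorem sub_nilp (hA : ∀ e : A, e * e = e → e = 0 ∨ e = 1) (ψ : A) : ∃ (l : L) (m : ℕ), (ψ - algebraMap L A l) ^ m = 0 := by
  have h_int : IsIntegral L ψ := Algebra.IsIntegral.isIntegral ψ
  set f := minpoly L ψ with hf
  have hf0 : f ≠ 0 := minpoly.ne_zero h_int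
  obtain ⟨l, hl⟩ := IsAlgClosed.exists_root f (minpoly.degree_pos h_int).ne'
  obtain ⟨h, hh, hnd⟩ := Polynomial.exists_eq_pow_rootMultiplicity_mul_and_not_dvd f hf0 l
  set m := f.rootMultiplicity l with hm
  have hm0 : 0 < m := (Polynomial.rootMultiplicity_pos hf0).2 hl
  have hcop : IsCoprime ((Polynomial.X - Polynomial.C l) ^ m) h :=
    ((Polynomial.irreducible_X_sub_C l).coprime_iff_not_dvd.2 hnd).pow_left
  obtain ⟨u, v, huv⟩ := hcop
  have hfz : Polynomial.aeval ψ f = 0 := minpoly.aeval L ψ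
  have hidem : Polynomial.aeval ψ (v * h) * Polynomial.aeval ψ (v * h) = Polynomial.aeval ψ (v * h) := by
    have h1 : (v * h) * (v * h) = v * h - u * v * f := by
      rw [hh]
      linear_combination (v * h) * huv
    rw [← map_mul, h1, map_sub, map_mul _ (u * v) f, hfz, mul_zero, sub_zero]
  have key := congrArg (Polynomial.aeval ψ) huv
  rcases hA _ hidem with h1 | h1
  · exfalso
    have h2 : Polynomial.aeval ψ h = 0 := by
      have h3 : h = u * f + h * (v * h) := by
        rw [hh]
        linear_combination -h * huv
      rw [h3, map_add, map_mul, hfz, map_mul _ h, h1, mul_zero, mul_zero, add_zero]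
    have h4 : f ∣ h := minpoly.dvd L ψ h2
    exact hnd (((dvd_pow_self _ hm0.ne').trans (Dvd.intro h hh.symm)).trans h4)
  · refine ⟨l, m, ?_⟩
    have h3 : (Polynomial.X - Polynomial.C l) ^ m = v * f + (Polynomial.X - Polynomial.C l) ^ m * (1 - v * h) := by
      rw [hh]
      ring
    have h4 := congrArg (Polynomial.aeval ψ) h3
    rw [map_add, map_mul, hfz, map_mul, map_sub, h1, map_one, sub_self, mul_zero, mul_zero, add_zero] at h4
    simpa using h4

theorem rdeg_of_idem (hg : ∀ (c : F) (x : E), g (c • x) = algebraMap F L c • g x) (hinj : Function.Injective g)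
    (hdiag : ∀ (x : E) (l : L), g x = algebraMap L A l → ∃ c : F, l = algebraMap F L c)
    (hA : ∀ e : A, e * e = e → e = 0 ∨ e = 1) [IsLocalRing E] : rdeg F E = 1 := by
  obtain ⟨K, _, _, _, π, hs, h0⟩ := residue F E
  rw [← rdeg_eq F E K π hs h0]
  rw [finrank_eq_one_iff_of_nonzero' (1 : K) one_ne_zero]
  intro y
  obtain ⟨φ, rfl⟩ := hs y
  obtain ⟨l, m, hl⟩ := sub_nilp (L := L) hA (g φ)
  obtain ⟨p, hp⟩ := CharP.exists F
  haveI : Fact p.Prime := ⟨CharP.char_is_prime F p⟩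
  obtain ⟨n, hpr, hn⟩ := FiniteField.card F p
  haveI : CharP L p := charP_of_injective_algebraMap (algebraMap F L).injective p
  haveI : CharP A p := charP_of_injective_algebraMap (algebraMap L A).injective p
  haveI : CharP K p := charP_of_injective_algebraMap (algebraMap F K).injective p
  have hQ : m ≤ p ^ ((n : ℕ) * m) := by
    have h1 : 1 < p ^ (n : ℕ) := hn ▸ Fintype.one_lt_card
    rw [pow_mul]
    exact (Nat.lt_pow_self h1).le
  have h2 : (g φ - algebraMap L A l) ^ (p ^ ((n : ℕ) * m)) = 0 := pow_eq_zero_of_le hQ hl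
  rw [sub_pow_char_pow_of_commute p _ (Algebra.commutes l (g φ)).symm, sub_eq_zero, ← map_pow, ← map_pow] at h2
  obtain ⟨c, hc⟩ := hdiag _ _ h2
  have h3 : φ ^ (p ^ ((n : ℕ) * m)) = c • 1 := by
    apply hinj
    rw [h2, hg, map_one, hc, Algebra.algebraMap_eq_smul_one]
  have h4 := congrArg π h3
  rw [map_smul, map_pow, map_one] at h4
  refine ⟨c, ?_⟩
  have h5 : (π φ - c • 1) ^ (p ^ ((n : ℕ) * m)) = 0 := by
    rw [sub_pow_char_pow_of_commute p _ (Commute.all _ _), h4, smul_pow, one_pow]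
    have : c ^ p ^ ((n : ℕ) * m) = c := by
      rw [pow_mul, ← hn]
      exact FiniteField.pow_card_pow m c
    rw [this, sub_self]
  have h6 := eq_zero_of_pow_eq_zero h5
  rw [sub_eq_zero] at h6
  exact h6.symm

end AbsIndecAbstract


/-! ### Part G2: scalar extension of endomorphism algebras -/
section ScalarExt

variable {ι Ar : Type} [Fintype ι] {s t : Ar → ι} {β : ι → ℕ}

/-- representation given by matrices -/
noncomputable def mrep (K : Type) [Field K] (M : ∀ x : Ar, Matrix (Fin (β (t x))) (Fin (β (s x))) K) :
    FRep K s t (stdV K β) := fun x => Matrix.toLin' (M x)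

/-- the endomorphism algebra as an algebra of matrices -/
noncomputable def matE {K : Type} [Field K] (M : ∀ x : Ar, Matrix (Fin (β (t x))) (Fin (β (s x))) K) :
    Module.End (QA K ι Ar) (TM (mrep K M)) →ₐ[K] (∀ i, Matrix (Fin (β i)) (Fin (β i)) K) :=
  (Pi.algHom K _ fun i => (LinearMap.toMatrixAlgEquiv' (R := K) (n := Fin (β i))).toAlgHom.comp
    ((Pi.evalAlgHom K _ i).comp (famAlg (mrep K M))))

theorem matE_apply {K : Type} [Field K] (M : ∀ x : Ar, Matrix (Fin (β (t x))) (Fin (β (s x))) K)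
    (f : Module.End (QA K ι Ar) (TM (mrep K M))) (i : ι) : matE M f i = LinearMap.toMatrix' (famOf f i) := rfl

theorem matE_inj {K : Type} [Field K] (M : ∀ x : Ar, Matrix (Fin (β (t x))) (Fin (β (s x))) K) :
    Function.Injective (matE M) := by
  intro f g h
  apply famAlg_inj
  funext i
  have := congrFun h i
  rw [matE_apply, matE_apply] at this
  exact LinearMap.toMatrix'.injective this

theorem matE_comm {K : Type} [Field K] (M : ∀ x : Ar, Matrix (Fin (β (t x))) (Fin (β (s x))) K)
    (f : Module.End (QA K ι Ar) (TM (mrep K M))) (x : Ar) : matE M f (t x) * M x = M x * matE M f (s x) := by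
  rw [matE_apply, matE_apply]
  apply Matrix.toLin'.injective
  refine LinearMap.ext fun v => ?_
  rw [Matrix.toLin'_mul, Matrix.toLin'_mul, Matrix.toLin'_toMatrix', Matrix.toLin'_toMatrix']
  exact famOf_comm f x v

theorem matE_surj {K : Type} [Field K] (M : ∀ x : Ar, Matrix (Fin (β (t x))) (Fin (β (s x))) K)
    (N : ∀ i, Matrix (Fin (β i)) (Fin (β i)) K) (h : ∀ x, N (t x) * M x = M x * N (s x)) :
    ∃ f, matE M f = N := by
  have hc : ∀ x (v : stdV K β (s x)), Matrix.toLin' (N (t x)) (mrep K M x v) = mrep K M x (Matrix.toLin' (N (s x)) v) := by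
    intro x v
    have := congrArg (fun Q => Matrix.toLin' Q v) (h x)
    simp only [Matrix.toLin'_mul] at this
    exact this
  refine ⟨famLin (σ := mrep K M) (σ' := mrep K M) (fun i => Matrix.toLin' (N i)) hc, ?_⟩
  funext i
  rw [matE_apply]
  have h2 := congrFun (famOf_famLin (σ := mrep K M) (σ' := mrep K M) (fun i => Matrix.toLin' (N i)) hc) i
  exact (congrArg LinearMap.toMatrix' h2).trans (LinearMap.toMatrix'_toLin' _)

variable {F : Type} [Field F] {L : Type} [Field L] [Algebra F L]

/-- extension of scalars on matrices -/
def mext (L : Type) [Field L] [Algebra F L] (M : ∀ x : Ar, Matrix (Fin (β (t x))) (Fin (β (s x))) F) :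
    ∀ x : Ar, Matrix (Fin (β (t x))) (Fin (β (s x))) L := fun x => (M x).map (algebraMap F L)

theorem extE_ex (M : ∀ x : Ar, Matrix (Fin (β (t x))) (Fin (β (s x))) F) (f : Module.End (QA F ι Ar) (TM (mrep F M))) :
    ∃ f' : Module.End (QA L ι Ar) (TM (mrep L (mext L M))),
      matE (mext L M) f' = fun i => (matE M f i).map (algebraMap F L) := by
  apply matE_surj
  intro x
  have := congrArg (fun Q => Q.map (algebraMap F L)) (matE_comm M f x)
  simp only [Matrix.map_mul] at this
  exact this

/-- extension of scalars on endomorphisms -/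
noncomputable def extE (L : Type) [Field L] [Algebra F L] (M : ∀ x : Ar, Matrix (Fin (β (t x))) (Fin (β (s x))) F) :
    Module.End (QA F ι Ar) (TM (mrep F M)) →+* Module.End (QA L ι Ar) (TM (mrep L (mext L M))) where
  toFun f := (extE_ex (L := L) M f).choose
  map_one' := by
    apply matE_inj
    rw [(extE_ex (L := L) M _).choose_spec, map_one, map_one]
    funext i
    rw [Pi.one_apply, Pi.one_apply, Matrix.map_one _ (map_zero _) (map_one _)]
  map_zero' := by
    apply matE_inj
    rw [(extE_ex (L := L) M _).choose_spec, map_zero, map_zero]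
    funext i
    rw [Pi.zero_apply, Pi.zero_apply, Matrix.map_zero _ (map_zero _)]
  map_mul' f g := by
    apply matE_inj
    rw [(extE_ex (L := L) M _).choose_spec, map_mul, map_mul, (extE_ex (L := L) M _).choose_spec,
      (extE_ex (L := L) M _).choose_spec]
    funext i
    rw [Pi.mul_apply, Pi.mul_apply, Matrix.map_mul]
  map_add' f g := by
    apply matE_inj
    rw [(extE_ex (L := L) M _).choose_spec, map_add, map_add, (extE_ex (L := L) M _).choose_spec,
      (extE_ex (L := L) M _).choose_spec]
    funext i
    rw [Pi.add_apply, Pi.add_apply, Matrix.map_add _ (map_add _)]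

theorem matE_extE (M : ∀ x : Ar, Matrix (Fin (β (t x))) (Fin (β (s x))) F) (f) (i : ι) :
    matE (mext L M) (extE L M f) i = (matE M f i).map (algebraMap F L) :=
  congrFun (extE_ex (L := L) M f).choose_spec i

theorem extE_smul (M : ∀ x : Ar, Matrix (Fin (β (t x))) (Fin (β (s x))) F) (c : F) (f) :
    extE L M (c • f) = algebraMap F L c • extE L M f := by
  apply matE_inj
  funext i
  rw [matE_extE, map_smul, map_smul, Pi.smul_apply, Pi.smul_apply, matE_extE]
  ext p q
  simp

theorem extE_inj (M : ∀ x : Ar, Matrix (Fin (β (t x))) (Fin (β (s x))) F) : Function.Injective (extE L M) := by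
  intro f g h
  apply matE_inj
  funext i
  have := congrArg (fun f' => matE (mext L M) f' i) h
  simp only [matE_extE] at this
  exact Matrix.map_injective (algebraMap F L).injective this

theorem extE_diag (M : ∀ x : Ar, Matrix (Fin (β (t x))) (Fin (β (s x))) F) (hβ : β ≠ 0) (f) (l : L)
    (h : extE L M f = algebraMap L _ l) : ∃ c : F, l = algebraMap F L c := by
  obtain ⟨i, hi⟩ := Function.ne_iff.1 hβ
  have hi' : 0 < β i := Nat.pos_of_ne_zero hi
  have h1 := congrArg (fun f' => matE (mext L M) f' i ⟨0, hi'⟩ ⟨0, hi'⟩) h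
  simp only [matE_extE] at h1
  rw [AlgHom.commutes, Pi.algebraMap_apply, Matrix.algebraMap_matrix_apply, if_pos rfl, Matrix.map_apply] at h1
  exact ⟨_, h1.symm⟩

theorem extE_span (M : ∀ x : Ar, Matrix (Fin (β (t x))) (Fin (β (s x))) F) :
    Submodule.span L (Set.range (extE L M)) = ⊤ := by
  rw [eq_top_iff]
  intro ψ _
  let b := Module.Basis.ofVectorSpace F L
  have hk : ∀ k, ∃ f, matE M f = fun i => (matE (mext L M) ψ i).map (b.coord k) := by
    intro k
    apply matE_surj
    intro x
    have h := congrArg (fun Q => Q.map (b.coord k)) (matE_comm (mext L M) ψ x)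
    ext p q
    have h1 := congrFun (congrFun h p) q
    simp only [Matrix.map_apply, Matrix.mul_apply, mext, map_sum] at h1 ⊢
    convert h1 using 2 with y _ y _
    · rw [mul_comm _ (algebraMap F L _), ← Algebra.smul_def, map_smul, smul_eq_mul, mul_comm]
    · rw [← Algebra.smul_def, map_smul, smul_eq_mul]
  choose φ hφ using hk
  let S : Finset _ := Finset.univ.biUnion fun i : ι => Finset.univ.biUnion fun p : Fin (β i) =>
    Finset.univ.biUnion fun q : Fin (β i) => (b.repr (matE (mext L M) ψ i p q)).support
  have hψ : ψ = ∑ k ∈ S, b k • extE L M (φ k) := by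
    apply matE_inj
    funext i
    rw [map_sum, Finset.sum_apply]
    ext p q
    rw [Matrix.sum_apply]
    have h1 : ∀ k ∈ S, matE (mext L M) (b k • extE L M (φ k)) i p q = b.repr (matE (mext L M) ψ i p q) k • b k := by
      intro k _
      rw [map_smul, Pi.smul_apply, matE_extE, hφ]
      change b k * algebraMap F L (b.repr (matE (mext L M) ψ i p q) k) = _
      rw [Algebra.smul_def, mul_comm]
    rw [Finset.sum_congr rfl h1]
    conv_lhs => rw [← b.linearCombination_repr (matE (mext L M) ψ i p q)]
    rw [Finsupp.linearCombination_apply]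
    refine Finsupp.sum_of_support_subset _ ?_ _ (fun k _ => zero_smul _ _)
    intro k hk
    refine Finset.mem_biUnion.2 ⟨i, Finset.mem_univ _, Finset.mem_biUnion.2 ⟨p, Finset.mem_univ _,
      Finset.mem_biUnion.2 ⟨q, Finset.mem_univ _, hk⟩⟩⟩
  rw [hψ]
  exact Submodule.sum_mem _ fun k _ => Submodule.smul_mem _ _ (Submodule.subset_span ⟨_, rfl⟩)

theorem TM_nontriv {K : Type} [Field K] (M : ∀ x : Ar, Matrix (Fin (β (t x))) (Fin (β (s x))) K) :
    Nontrivial (TM (mrep K M)) ↔ β ≠ 0 := by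
  constructor
  · rintro h rfl
    obtain ⟨x, y, hxy⟩ := h
    apply hxy
    funext i p
    exact Fin.elim0 p
  · intro hβ
    obtain ⟨i, hi⟩ := Function.ne_iff.1 hβ
    have hi' : 0 < β i := Nat.pos_of_ne_zero hi
    refine ⟨⟨fun _ _ => 0, fun _ _ => 1, fun h => ?_⟩⟩
    exact zero_ne_one (congrFun (congrFun h i) ⟨0, hi'⟩)

theorem absIndec_iff [Fintype F] [IsAlgClosed L] (M : ∀ x : Ar, Matrix (Fin (β (t x))) (Fin (β (s x))) F) :
    Indec (QA L ι Ar) (TM (mrep L (mext L M))) ↔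
      Indec (QA F ι Ar) (TM (mrep F M)) ∧ rdeg F (Module.End (QA F ι Ar) (TM (mrep F M))) = 1 := by
  by_cases hβ : β ≠ 0
  swap
  · constructor
    · intro h; exact absurd ((TM_nontriv _).1 h.1) hβ
    · intro h; exact absurd ((TM_nontriv _).1 h.1.1) hβ
  haveI h1 := (TM_nontriv M).2 hβ
  haveI h2 := (TM_nontriv (mext L M)).2 hβ
  haveI h3 : Module.Finite L (Module.End (QA L ι Ar) (TM (mrep L (mext L M)))) :=
    Module.Finite.of_injective (matE (mext L M)).toLinearMap (matE_inj _)
  haveI h4 : Finite (TM (mrep F M)) := inferInstanceAs (Finite (∀ i, Fin (β i) → F))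
  constructor
  · intro h
    have hI : Indec (QA F ι Ar) (TM (mrep F M)) := by
      refine ⟨h1, fun e he => ?_⟩
      rcases h.2 (extE L M e) (by rw [← map_mul, he]) with h5 | h5
      · left; apply extE_inj (L := L) M; rw [h5, map_zero]
      · right; apply extE_inj (L := L) M; rw [h5, map_one]
    haveI := hI.local
    exact ⟨hI, rdeg_of_idem (L := L) (extE L M) (extE_smul M) (extE_inj M) (extE_diag M hβ) h.2⟩
  · rintro ⟨hI, hd⟩
    haveI := hI.local
    exact ⟨h2, fun e he => idem_of_rdeg (L := L) (extE L M) (extE_span M) (extE_smul M) hd e he⟩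

end ScalarExt


/-! ### Part H: translation of the statement -/
section Translate

variable {n : ℕ} {a : Fin n → Fin n → ℕ} {α : Fin n → ℕ}

/-- the arrows -/
abbrev qAr (n : ℕ) (a : Fin n → Fin n → ℕ) : Type := Σ i : Fin n, Σ j : Fin n, Fin (a i j)

/-- source -/
abbrev qs (n : ℕ) (a : Fin n → Fin n → ℕ) : qAr n a → Fin n := fun x => x.1
/-- target -/
abbrev qt (n : ℕ) (a : Fin n → Fin n → ℕ) : qAr n a → Fin n := fun x => x.2.1

/-- matrices of a representation -/
def qM {K : Type} [Field K] (σ : QRep n a K α) : ∀ x : qAr n a, Matrix (Fin (α (qt n a x))) (Fin (α (qs n a x))) K :=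
  fun x => σ x.1 x.2.1 x.2.2

/-- the associated family of linear maps -/
noncomputable def qF (α : Fin n → ℕ) {K : Type} [Field K] (σ : QRep n a K α) : FRep K (qs n a) (qt n a) (stdV K α) := mrep K (qM σ)

theorem qF_apply {K : Type} [Field K] (σ : QRep n a K α) (i j : Fin n) (t : Fin (a i j)) (v : Fin (α i) → K) :
    qF α σ ⟨i, j, t⟩ v = (σ i j t).mulVec v := Matrix.toLin'_apply _ _

theorem qF_inj {K : Type} [Field K] (σ σ' : QRep n a K α) (h : qF α σ = qF α σ') : σ = σ' := by
  funext i j t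
  exact Matrix.toLin'.injective (congrFun h ⟨i, j, t⟩)

theorem qF_surj {K : Type} [Field K] (τ : FRep K (qs n a) (qt n a) (stdV K α)) : ∃ σ : QRep n a K α, qF α σ = τ := by
  refine ⟨fun i j t => LinearMap.toMatrix' (τ ⟨i, j, t⟩), ?_⟩
  funext x
  exact Matrix.toLin'_toMatrix' _

theorem Stb_qF {K : Type} [Field K] (σ : QRep n a K α) (W : ∀ i, Submodule K (Fin (α i) → K)) :
    Stb (qF α σ) W ↔ ∀ i j (t : Fin (a i j)), ∀ x ∈ W i, (σ i j t).mulVec x ∈ W j := by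
  constructor
  · intro h i j t x hx
    have := h ⟨i, j, t⟩ x hx
    rwa [qF_apply] at this
  · rintro h ⟨i, j, t⟩ x hx
    rw [qF_apply]
    exact h i j t x hx

theorem IndecRep_iff {K : Type} [Field K] (σ : QRep n a K α) :
    IndecRep σ ↔ Indec (QA K (Fin n) (qAr n a)) (TM (qF α σ)) := by
  rw [indec_iff]
  refine and_congr (TM_nontriv (qM σ)).symm ?_
  constructor
  · intro h W W' hW hW' hc
    rcases h ⟨W, (Stb_qF σ W).1 hW⟩ ⟨W', (Stb_qF σ W').1 hW'⟩ hc with h1 | h1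
    · left; funext i; exact h1 i
    · right; funext i; exact h1 i
  · intro h U W hc
    rcases h U.U W.U ((Stb_qF σ U.U).2 U.stable) ((Stb_qF σ W.U).2 W.stable) hc with h1 | h1
    · left; intro i; exact congrFun h1 i
    · right; intro i; exact congrFun h1 i

theorem AbsIndec_iff {F : Type} [Field F] [Fintype F] (σ : QRep n a F α) :
    AbsIndec σ ↔ Indec (QA F (Fin n) (qAr n a)) (TM (qF α σ)) ∧
      rdeg F (Module.End (QA F (Fin n) (qAr n a)) (TM (qF α σ))) = 1 := by
  rw [AbsIndec, IndecRep_iff]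
  exact absIndec_iff (L := AlgebraicClosure F) (qM σ)

/-- weights -/
noncomputable def qw (θ : (Fin n → ℤ) →ₗ[ℤ] ℤ) (μ : ℚ) : Fin n → ℚ := fun i => (θ (Pi.single i 1) : ℚ) - μ

theorem qw_sum (θ : (Fin n → ℤ) →ₗ[ℤ] ℤ) (μ : ℚ) (β : Fin n → ℕ) :
    ∑ i, qw θ μ i * (β i : ℚ) = (θ (fun i => (β i : ℤ)) : ℚ) - μ * ((∑ i, β i : ℕ) : ℚ) := by
  have h : (fun i => (β i : ℤ)) = ∑ i, (β i : ℤ) • (Pi.single i 1 : Fin n → ℤ) := by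
    funext j
    rw [Finset.sum_apply]
    simp [Pi.single_apply]
  rw [h, map_sum]
  simp only [qw, map_smul, smul_eq_mul, sub_mul, Finset.sum_sub_distrib]
  push_cast
  rw [Finset.mul_sum]
  congr 1
  exact Finset.sum_congr rfl fun i _ => mul_comm _ _

theorem SS_iff {K : Type} [Field K] (θ : (Fin n → ℤ) →ₗ[ℤ] ℤ) (μ : ℚ) (hα : α ≠ 0) (σ : QRep n a K α) :
    SS (qw θ μ) (qF α σ) ↔ IsSemistable θ σ ∧ qSlopeIs n θ μ α := by
  have hht : ∀ β : Fin n → ℕ, β ≠ 0 → (0 : ℚ) < ((∑ i, β i : ℕ) : ℚ) := by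
    intro β hβ
    obtain ⟨i, hi⟩ := Function.ne_iff.1 hβ
    have h1 : β i ≤ ∑ i, β i := Finset.single_le_sum (f := β) (fun _ _ => Nat.zero_le _) (Finset.mem_univ i)
    have h2 : 0 < β i := Nat.pos_of_ne_zero hi
    exact_mod_cast lt_of_lt_of_le h2 h1
  have hdg : ∀ W : ∀ i, Submodule K (Fin (α i) → K), dg (V := stdV K α) (qw θ μ) W =
      (θ (fun i => (Module.finrank K (W i) : ℤ)) : ℚ) - μ * ((∑ i, Module.finrank K (W i) : ℕ) : ℚ) :=
    fun W => qw_sum θ μ _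
  have htop : dg (V := stdV K α) (qw θ μ) (⊤ : ∀ i, Submodule K (Fin (α i) → K)) =
      (θ (fun i => (α i : ℤ)) : ℚ) - μ * ((∑ i, α i : ℕ) : ℚ) := by
    rw [← qw_sum]
    exact Finset.sum_congr rfl fun i _ => by simp
  have hsl : qSlopeIs n θ μ α → qSlope n θ α = μ := by
    intro h
    rw [qSlope, h, mul_div_cancel_right₀ _ (hht α hα).ne']
  constructor
  · rintro ⟨h1, h2⟩
    have h3 : qSlopeIs n θ μ α := by
      rw [htop, sub_eq_zero] at h1
      exact h1
    refine ⟨fun W hb _ => ?_, h3⟩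
    have h4 := h2 W.U ((Stb_qF σ W.U).2 W.stable)
    rw [hdg, sub_nonpos] at h4
    rw [hsl h3, qSlope, div_le_iff₀]
    · exact h4
    · apply hht
      obtain ⟨i, hi⟩ := hb
      intro h0
      exact hi (Submodule.finrank_eq_zero.1 (congrFun h0 i))
  · rintro ⟨h1, h2⟩
    have h0 : dg (V := stdV K α) (qw θ μ) (⊤ : ∀ i, Submodule K (Fin (α i) → K)) = 0 := by
      rw [htop, sub_eq_zero]
      exact h2
    refine ⟨h0, fun W hW => ?_⟩
    by_cases hb : ∃ i, W i ≠ ⊥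
    · by_cases ht : ∃ i, W i ≠ ⊤
      · have h3 := h1 ⟨W, (Stb_qF σ W).1 hW⟩ hb ht
        rw [hsl h2, qSlope, div_le_iff₀] at h3
        · rw [hdg, sub_nonpos]
          exact h3
        · apply hht
          obtain ⟨i, hi⟩ := hb
          intro h0
          exact hi (Submodule.finrank_eq_zero.1 (congrFun h0 i))
      · push Not at ht
        have : W = ⊤ := funext ht
        rw [this]
        exact h0.le
    · push Not at hb
      have : W = ⊥ := funext hb
      rw [this, dg_bot]

theorem orbit_iff {K : Type} [Field K] (σ σ' : QRep n a K α) :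
    (∃ g : ∀ i, GL (Fin (α i)) K, glSmul g σ = σ') ↔
      Nonempty (TM (qF α σ) ≃ₗ[QA K (Fin n) (qAr n a)] TM (qF α σ')) := by
  rw [← (famIso (qF α σ) (qF α σ')).nonempty_congr]
  constructor
  · rintro ⟨g, rfl⟩
    have hl : ∀ i, (g i).val * ((g i)⁻¹).val = 1 := fun i => (g i).mul_inv
    have hr : ∀ i, ((g i)⁻¹).val * (g i).val = 1 := fun i => (g i).inv_mul
    refine ⟨⟨fun i => Matrix.toLin'OfInv (hr i) (hl i), ?_⟩⟩
    funext x
    obtain ⟨i, j, t⟩ := x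
    refine LinearMap.ext fun v => ?_
    rw [trF_apply, qF_apply, qF_apply]
    change Matrix.toLin' (g j).val ((σ i j t).mulVec (Matrix.toLin' ((g i)⁻¹).val v)) = _
    rw [Matrix.toLin'_apply, Matrix.toLin'_apply, Matrix.mulVec_mulVec, Matrix.mulVec_mulVec]
    rfl
  · rintro ⟨e, he⟩
    have hl : ∀ i, LinearMap.toMatrix' (e i).toLinearMap * LinearMap.toMatrix' (e i).symm.toLinearMap = 1 := by
      intro i
      rw [← LinearMap.toMatrix'_comp]
      simp
    have hr : ∀ i, LinearMap.toMatrix' (e i).symm.toLinearMap * LinearMap.toMatrix' (e i).toLinearMap = 1 := by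
      intro i
      rw [← LinearMap.toMatrix'_comp]
      simp
    refine ⟨fun i => ⟨LinearMap.toMatrix' (e i).toLinearMap, LinearMap.toMatrix' (e i).symm.toLinearMap, hl i, hr i⟩, ?_⟩
    apply qF_inj
    rw [← he]
    funext x
    obtain ⟨i, j, t⟩ := x
    refine LinearMap.ext fun v => ?_
    rw [trF_apply, qF_apply, qF_apply]
    change (LinearMap.toMatrix' (e j).toLinearMap * σ i j t * LinearMap.toMatrix' (e i).symm.toLinearMap).mulVec v = _
    rw [← Matrix.mulVec_mulVec, ← Matrix.mulVec_mulVec, LinearMap.toMatrix'_mulVec, LinearMap.toMatrix'_mulVec]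
    rfl

theorem rdeg_congr (F : Type) [Field F] [Fintype F] {R R' : Type} [Ring R] [Ring R'] (e : R ≃+* R') :
    rdeg F R = rdeg F R' := by
  rw [rdeg, rdeg, Nat.card_congr e.toEquiv]
  congr 2
  refine Nat.card_congr (e.toEquiv.subtypeEquiv fun f => ?_)
  rw [not_iff_not]
  exact (MulEquiv.isUnit_map e).symm

theorem rdeg_iso {F : Type} [Field F] [Fintype F] {ι Ar : Type} [Fintype ι] {s t : Ar → ι} {β : ι → ℕ}
    {σ σ' : FRep F s t (stdV F β)} (e : TM σ ≃ₗ[QA F ι Ar] TM σ') :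
    rdeg F (Module.End (QA F ι Ar) (TM σ)) = rdeg F (Module.End (QA F ι Ar) (TM σ')) :=
  rdeg_congr F (LinearEquiv.conjRingEquiv e)

theorem Ass_eq (F : Type) [Field F] [Fintype F] (θ : (Fin n → ℤ) →ₗ[ℤ] ℤ) (μ : ℚ) (hα : α ≠ 0) :
    Ass F n a θ μ α = Icnt F (qs n a) (qt n a) (qw θ μ) α 1 := by
  rw [Ass, Icnt]
  let toI : {σ : QRep n a F α // IsSemistable θ σ ∧ qSlopeIs n θ μ α ∧ AbsIndec σ} → IndS F (qs n a) (qt n a) (qw θ μ) α :=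
    fun σ => ⟨qF α σ.1, (SS_iff θ μ hα σ.1).2 ⟨σ.2.1, σ.2.2.1⟩, ((AbsIndec_iff σ.1).1 σ.2.2.2).1⟩
  let toC : {σ : QRep n a F α // IsSemistable θ σ ∧ qSlopeIs n θ μ α ∧ AbsIndec σ} →
      {c : Cls F (qs n a) (qt n a) (qw θ μ) α // edeg c = 1} := fun σ => ⟨Quotient.mk _ (toI σ), by
    obtain ⟨e⟩ := rep_mk (toI σ)
    exact (rdeg_iso e).symm.trans ((AbsIndec_iff σ.1).1 σ.2.2.2).2⟩
  refine Nat.card_congr (Equiv.ofBijective (Quot.lift toC ?_) ⟨?_, ?_⟩)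
  · intro σ σ' h
    refine Subtype.ext (Quotient.sound ?_)
    exact (orbit_iff σ.1 σ'.1).1 h
  · intro x y
    induction x using Quot.ind with | mk σ => ?_
    induction y using Quot.ind with | mk σ' => ?_
    intro h
    have h1 : (Quotient.mk _ (toI σ) : Cls F (qs n a) (qt n a) (qw θ μ) α) = Quotient.mk _ (toI σ') :=
      congrArg Subtype.val h
    have h2 := Quotient.exact h1
    exact Quot.sound ((orbit_iff σ.1 σ'.1).2 h2)
  · rintro ⟨c, hc⟩
    obtain ⟨σ, hσ⟩ := qF_surj (rep α c)
    have h1 := rep_SS c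
    have h2 := rep_Indec c
    rw [edeg] at hc
    have hc' := hc
    rw [← hσ] at h1 h2 hc'
    have h3 := (SS_iff θ μ hα σ).1 h1
    refine ⟨Quot.mk _ ⟨σ, h3.1, h3.2, (AbsIndec_iff σ).2 ⟨h2, hc'⟩⟩, ?_⟩
    refine Subtype.ext ?_
    change (Quotient.mk _ (⟨qF α σ, _⟩ : IndS F (qs n a) (qt n a) (qw θ μ) α) : Cls F (qs n a) (qt n a) (qw θ μ) α) = c
    conv_rhs => rw [← Quotient.out_eq c]
    exact congrArg _ (Subtype.ext hσ)

end Translate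

theorem Ass_polynomial_count (n : ℕ) (a : Fin n → Fin n → ℕ)
    (θ : (Fin n → ℤ) →ₗ[ℤ] ℤ) (μ : ℚ) (α : Fin n → ℕ) (hα : α ≠ 0) :
    ∃ f : Polynomial ℚ, ∀ (F : Type) [Field F] [Fintype F],
      (Ass F n a θ μ α : ℚ) = f.eval ((Fintype.card F : ℚ)) := by
  obtain ⟨r, hr, h⟩ := rat_Icnt (qs n a) (qt n a) (qw θ μ) α 1
  obtain ⟨f, hf⟩ := ratS_poly_of_int hr (by
    intro q hq
    haveI : Fact q.Prime := ⟨hq⟩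
    have h1 := h (ZMod q)
    rw [ZMod.card] at h1
    exact ⟨_, h1.symm.trans (Int.cast_natCast _).symm⟩)
  refine ⟨f, fun F _ _ => ?_⟩
  rw [Ass_eq F θ μ hα, h F]
  exact hf _ Fintype.one_lt_card
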